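/- arXiv:1805.10237 — 2 statements merged into one kernel-verified Lean document; each statement's English description precedes it below -/
import Mathlib

section
/- (Linear r-fold van Kampen–Flores theorem for prime powers.) Let r be a prime power (r = q^m for a prime q and integer m ≥ 1) and k a positive integer. Then from any (r−1)(kr+2)+1 pairwise distinct points in ℝ^{kr} one can choose r pairwise disjoint (k(r−1)+1)-tuples whose convex hulls have a common point: for every injective p : Fin ((r−1)*(k*r+2)+1) → EuclideanSpace ℝ (Fin (k*r)) there exist pairwise disjoint subsets A₁, …, A_r ⊆ Fin ((r−1)*(k*r+2)+1), each of cardinality k(r−1)+1, such that the intersection of the convex hulls convexHull ℝ (p '' A_s), s = 1, …, r, is nonempty. -/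
namespace VKF

set_option linter.unusedSectionVars false

/-- An explicit additive action of `G` on `X`. -/
structure IsAct {G X : Type*} [AddCommGroup G] (a : G → X → X) : Prop where
  zero : ∀ x, a 0 x = x
  add : ∀ g h x, a (g + h) x = a g (a h x)

section Frobenius

variable {𝔽 W : Type*} [Field 𝔽] [AddCommGroup W] [Module 𝔽 W] {q : ℕ}

lemma natCast_end_eq_zero [CharP 𝔽 q] : ((q : ℕ) : Module.End 𝔽 W) = 0 := by
  rw [← map_natCast (algebraMap 𝔽 (Module.End 𝔽 W)), CharP.cast_eq_zero, map_zero]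

lemma add_pow_of_commute [CharP 𝔽 q] (hq : q.Prime) {f g : Module.End 𝔽 W} (h : Commute f g) :
    (f + g) ^ q = f ^ q + g ^ q := by
  obtain ⟨r, hr⟩ := h.exists_add_pow_prime_eq hq
  rw [hr, natCast_end_eq_zero (𝔽 := 𝔽)]
  simp

lemma sum_pow_of_commute [CharP 𝔽 q] (hq : q.Prime) {ι : Type*} (s : Finset ι)
    (f : ι → Module.End 𝔽 W) (h : ∀ i j, Commute (f i) (f j)) :
    (∑ i ∈ s, f i) ^ q = ∑ i ∈ s, f i ^ q := by
  classical
  induction s using Finset.induction_on with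
  | empty => simp [hq.ne_zero]
  | insert a s ha ih =>
    rw [Finset.sum_insert ha, Finset.sum_insert ha, add_pow_of_commute hq, ih]
    exact Commute.sum_right _ _ _ fun i _ => h a i

lemma sub_one_pow_of_prime [CharP 𝔽 q] (hq : q.Prime) (f : Module.End 𝔽 W) :
    (f - 1) ^ q = f ^ q - 1 := by
  have h := add_pow_of_commute (𝔽 := 𝔽) hq (f := f - 1) (g := 1) (Commute.one_right _)
  rw [sub_add_cancel, one_pow] at h
  rw [h, add_sub_cancel_right]

end Frobenius

section Weyl

variable {𝔽 W : Type*} [Field 𝔽] [AddCommGroup W] [Module 𝔽 W] {q : ℕ}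
  {x m : Module.End 𝔽 W}

lemma weyl_apply_pow (h : x * m - m * x = 1) {v : W} (hv : x v = 0) (i : ℕ) :
    x ((m ^ (i + 1)) v) = ((i + 1 : ℕ) : 𝔽) • (m ^ i) v := by
  have hx : ∀ w, x (m w) = w + m (x w) := fun w => by
    have := congrArg (fun f : Module.End 𝔽 W => f w) h
    simp only [LinearMap.sub_apply, Module.End.mul_apply, Module.End.one_apply] at this
    rw [sub_eq_iff_eq_add] at this
    exact this
  induction i with
  | zero => simp [hx, hv]
  | succ i ih =>
    rw [pow_succ', Module.End.mul_apply, hx, ih, map_smul, ← Module.End.mul_apply, ← pow_succ']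
    push_cast
    module

lemma weyl_pow_apply_pow (h : x * m - m * x = 1) {v : W} (hv : x v = 0) (i : ℕ) :
    (x ^ i) ((m ^ i) v) = (i.factorial : 𝔽) • v := by
  induction i with
  | zero => simp
  | succ i ih =>
    rw [pow_succ, Module.End.mul_apply, weyl_apply_pow h hv, map_smul, ih, smul_smul,
      Nat.factorial_succ]
    push_cast
    rfl

lemma weyl_ker_le [CharP 𝔽 q] (hq : q.Prime) (h : x * m - m * x = 1) {v : W} (hv : x v = 0) :
    ∃ w, v = (x ^ (q - 1)) w := by
  have hne : ((q - 1).factorial : 𝔽) ≠ 0 := by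
    intro h0
    rw [CharP.cast_eq_zero_iff 𝔽 q, hq.dvd_factorial] at h0
    have := hq.pos
    omega
  refine ⟨((q - 1).factorial : 𝔽)⁻¹ • (m ^ (q - 1)) v, ?_⟩
  rw [map_smul, weyl_pow_apply_pow h hv, smul_smul, inv_mul_cancel₀ hne, one_smul]

lemma weyl_ker_pow_le [CharP 𝔽 q] (hq : q.Prime) (h : x * m - m * x = 1) (j : ℕ) (hj : j ≤ q)
    {v : W} (hv : (x ^ j) v = 0) : ∃ w, v = (x ^ (q - j)) w := by
  induction j generalizing v with
  | zero => exact ⟨0, by simpa using hv⟩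
  | succ j ih =>
    rw [pow_succ', Module.End.mul_apply] at hv
    obtain ⟨w, hw⟩ := weyl_ker_le hq h hv
    have h1 : (x ^ j) (v - (x ^ (q - (j + 1))) w) = 0 := by
      rw [map_sub, ← Module.End.mul_apply, ← pow_add, hw,
        show j + (q - (j + 1)) = q - 1 by omega, sub_self]
    obtain ⟨u, hu⟩ := ih (by omega) h1
    refine ⟨w + x u, ?_⟩
    rw [map_add, ← Module.End.mul_apply _ x, ← pow_succ, show q - (j + 1) + 1 = q - j by omega, ← hu]
    abel

end Weyl

section Operators

variable {𝔽 : Type*} [Field 𝔽] {G : Type*} [AddCommGroup G] {X Y ι : Type*} [Fintype ι]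

/-- Translation of functions along an action. -/
def tr (𝔽 : Type*) [Field 𝔽] (a : G → X → X) (g : G) : Module.End 𝔽 (X → 𝔽) :=
  LinearMap.funLeft 𝔽 𝔽 (a g)

@[simp] lemma tr_apply (a : G → X → X) (g : G) (φ : X → 𝔽) (x : X) : tr 𝔽 a g φ x = φ (a g x) :=
  rfl

/-- The operator `∑ c i (s i - 1)` of the group algebra, acting on functions. -/
def opX (c : ι → 𝔽) (s : ι → G) (a : G → X → X) : Module.End 𝔽 (X → 𝔽) :=
  ∑ i, c i • (tr 𝔽 a (s i) - 1)

lemma opX_apply (c : ι → 𝔽) (s : ι → G) (a : G → X → X) (φ : X → 𝔽) (x : X) :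
    opX c s a φ x = ∑ i, c i * (φ (a (s i) x) - φ x) := by
  simp [opX, LinearMap.sum_apply, Finset.sum_apply]

/-- The alternating operators `x, x^(q-1), x, …` of the periodic resolution. -/
def opY (q : ℕ) (c : ι → 𝔽) (s : ι → G) (a : G → X → X) (j : ℕ) : Module.End 𝔽 (X → 𝔽) :=
  if Even j then opX c s a else opX c s a ^ (q - 1)

lemma IsAct.tr_pow {a : G → X → X} (ha : IsAct a) (g : G) (n : ℕ) :
    tr 𝔽 a g ^ n = tr 𝔽 a (n • g) := by
  induction n with
  | zero => ext φ x; simp [ha.zero]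
  | succ n ih =>
    ext φ x
    rw [pow_succ', ih]
    simp [succ_nsmul, ha.add]

lemma IsAct.tr_commute {a : G → X → X} (ha : IsAct a) (g h : G) :
    Commute (tr 𝔽 a g) (tr 𝔽 a h) := by
  refine LinearMap.ext fun φ => funext fun x => ?_
  simp [← ha.add, add_comm]

lemma opX_pow_eq_zero {q : ℕ} [CharP 𝔽 q] (hq : q.Prime) (hG : ∀ g : G, q • g = 0)
    (c : ι → 𝔽) (s : ι → G) {a : G → X → X} (ha : IsAct a) : opX c s a ^ q = 0 := by
  rw [opX, sum_pow_of_commute hq]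
  · refine Finset.sum_eq_zero fun i _ => ?_
    rw [smul_pow, sub_one_pow_of_prime hq, ha.tr_pow, hG]
    have : tr 𝔽 a 0 = 1 := by ext φ x; simp [ha.zero]
    rw [this, sub_self, smul_zero]
  · intro i j
    exact ((((ha.tr_commute _ _).sub_left (Commute.one_left _)).sub_right
      (Commute.one_right _)).smul_left _).smul_right _

/-- A linear map commuting with translations commutes with the operators. -/
lemma opX_comm (c : ι → 𝔽) (s : ι → G) {a : G → X → X} {a' : G → Y → Y}
    (L : (X → 𝔽) →ₗ[𝔽] (Y → 𝔽)) (hL : ∀ i φ, L (tr 𝔽 a (s i) φ) = tr 𝔽 a' (s i) (L φ))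
    (φ : X → 𝔽) : L (opX c s a φ) = opX c s a' (L φ) := by
  simp [opX, LinearMap.sum_apply, hL]

lemma opX_pow_comm (c : ι → 𝔽) (s : ι → G) {a : G → X → X} {a' : G → Y → Y}
    (L : (X → 𝔽) →ₗ[𝔽] (Y → 𝔽)) (hL : ∀ i φ, L (tr 𝔽 a (s i) φ) = tr 𝔽 a' (s i) (L φ))
    (n : ℕ) (φ : X → 𝔽) : L ((opX c s a ^ n) φ) = (opX c s a' ^ n) (L φ) := by
  induction n generalizing φ with
  | zero => simp
  | succ n ih => rw [pow_succ, pow_succ, Module.End.mul_apply, ih, opX_comm c s L hL]; rfl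

lemma opY_comm (q : ℕ) (c : ι → 𝔽) (s : ι → G) {a : G → X → X} {a' : G → Y → Y}
    (L : (X → 𝔽) →ₗ[𝔽] (Y → 𝔽)) (hL : ∀ i φ, L (tr 𝔽 a (s i) φ) = tr 𝔽 a' (s i) (L φ))
    (j : ℕ) (φ : X → 𝔽) : L (opY q c s a j φ) = opY q c s a' j (L φ) := by
  unfold opY
  split_ifs
  · exact opX_comm c s L hL φ
  · exact opX_pow_comm c s L hL _ φ

lemma opY_opY {q : ℕ} [CharP 𝔽 q] (hq : q.Prime) (hG : ∀ g : G, q • g = 0)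
    (c : ι → 𝔽) (s : ι → G) {a : G → X → X} (ha : IsAct a) (j : ℕ) (φ : X → 𝔽) :
    opY q c s a j (opY q c s a (j + 1) φ) = 0 := by
  have h0 := opX_pow_eq_zero (𝔽 := 𝔽) hq hG c s ha
  have hq1 : q - 1 + 1 = q := by have := hq.pos; omega
  unfold opY
  rcases Nat.even_or_odd j with h | h
  · rw [if_pos h, if_neg (by simpa [Nat.even_add_one] using h), ← Module.End.mul_apply,
      ← pow_succ', hq1, h0, LinearMap.zero_apply]
  · rw [if_neg (by simpa using h), if_pos (by simpa [Nat.even_add_one] using h),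
      ← Module.End.mul_apply, ← pow_succ, hq1, h0, LinearMap.zero_apply]

lemma opY_add_two (q : ℕ) (c : ι → 𝔽) (s : ι → G) (a : G → X → X) (j : ℕ) :
    opY q c s a (j + 2) = opY q c s a j := by
  simp [opY, Nat.even_add]

/-- A linear functional invariant under translations kills the image of the operators. -/
lemma opY_invariant {q : ℕ} (hq : q.Prime) (c : ι → 𝔽) (s : ι → G) {a : G → X → X}
    (L : (X → 𝔽) →ₗ[𝔽] 𝔽) (hL : ∀ i φ, L (tr 𝔽 a (s i) φ) = L φ) (j : ℕ) (φ : X → 𝔽) :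
    L (opY q c s a j φ) = 0 := by
  have h1 : ∀ φ, L (opX c s a φ) = 0 := fun φ => by
    simp [opX, LinearMap.sum_apply, hL]
  unfold opY
  split_ifs
  · exact h1 φ
  · obtain ⟨n, hn⟩ : ∃ n, q - 1 = n + 1 := ⟨q - 2, by have := hq.two_le; omega⟩
    rw [hn, pow_succ', Module.End.mul_apply, h1]

/-- The operators kill invariant functions. -/
lemma opY_of_invariant {q : ℕ} (hq : q.Prime) (c : ι → 𝔽) (s : ι → G) {a : G → X → X}
    (φ : X → 𝔽) (hφ : ∀ g x, φ (a g x) = φ x) (j : ℕ) : opY q c s a j φ = 0 := by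
  have h1 : opX c s a φ = 0 := by
    ext x
    simp [opX_apply, hφ]
  unfold opY
  split_ifs
  · exact h1
  · obtain ⟨n, hn⟩ : ∃ n, q - 1 = n + 1 := ⟨q - 2, by have := hq.two_le; omega⟩
    rw [hn, pow_succ, Module.End.mul_apply, h1, map_zero]

/-- The operators are local with respect to invariant sets. -/
lemma opY_congr (q : ℕ) (c : ι → 𝔽) (s : ι → G) {a : G → X → X} (P : X → Prop)
    (hP : ∀ g x, P x → P (a g x)) (j : ℕ) {φ ψ : X → 𝔽} (h : ∀ x, P x → φ x = ψ x) (x : X)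
    (hx : P x) : opY q c s a j φ x = opY q c s a j ψ x := by
  let a' : G → {x // P x} → {x // P x} := fun g x => ⟨a g x, hP g x x.2⟩
  let L : (X → 𝔽) →ₗ[𝔽] ({x // P x} → 𝔽) := LinearMap.funLeft 𝔽 𝔽 Subtype.val
  have hL : ∀ i φ, L (tr 𝔽 a (s i) φ) = tr 𝔽 a' (s i) (L φ) := fun _ _ => rfl
  have h1 : L φ = L ψ := funext fun x => h x x.2
  have h2 := opY_comm q c s L hL j φ
  rw [h1, ← opY_comm q c s L hL j ψ] at h2
  exact congrFun h2 ⟨x, hx⟩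

lemma opY_eq_zero_of (q : ℕ) (c : ι → 𝔽) (s : ι → G) {a : G → X → X} (P : X → Prop)
    (hP : ∀ g x, P x → P (a g x)) (j : ℕ) {φ : X → 𝔽} (h : ∀ x, P x → φ x = 0) (x : X)
    (hx : P x) : opY q c s a j φ x = 0 := by
  rw [opY_congr q c s P hP j (ψ := 0) h x hx, map_zero, Pi.zero_apply]

end Operators

section Kernel

variable {𝔽 : Type*} [Field 𝔽] {G : Type*} [AddCommGroup G] {X ι : Type*} [Fintype ι] {q : ℕ}

/-- Multiplication by a function. -/
def mulBy (f : X → 𝔽) : Module.End 𝔽 (X → 𝔽) := LinearMap.mulLeft 𝔽 f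

@[simp] lemma mulBy_apply (f φ : X → 𝔽) (x : X) : mulBy f φ x = f x * φ x := rfl

lemma exists_weyl_partner [CharP 𝔽 q] (hq : q.Prime) (hG : ∀ g : G, q • g = 0)
    (c : ι → 𝔽) (s : ι → G) {a : G → X → X} (ha : IsAct a)
    (μ : X → 𝔽) (α : X → G → 𝔽) (hα : ∀ g h x, α (a g x) h = α x h)
    (hμ : ∀ g x, μ (a g x) = μ x + α x g) (hne : ∀ x, ∑ i, c i * α x (s i) ≠ 0) :
    ∃ m : Module.End 𝔽 (X → 𝔽), opX c s a * m - m * opX c s a = 1 := by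
  set β : X → 𝔽 := fun x => ∑ i, c i ^ q * α x (s i) ^ q with hβ
  have hβne : ∀ x, β x ≠ 0 := fun x => by
    have : β x = (∑ i, c i * α x (s i)) ^ q := by
      have := Fact.mk hq
      rw [sum_pow_char]
      simp [hβ, mul_pow]
    rw [this]
    exact pow_ne_zero _ (hne x)
  set B : ι → Module.End 𝔽 (X → 𝔽) := fun i => mulBy (fun x => c i * α x (s i)) * tr 𝔽 a (s i)
    with hB
  have hBB : ∀ i j, Commute (B i) (B j) := fun i j => by
    refine LinearMap.ext fun φ => funext fun x => ?_
    simp only [hB, Module.End.mul_apply, mulBy_apply, tr_apply, hα, ← ha.add]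
    rw [add_comm (s i)]
    ring
  set D : Module.End 𝔽 (X → 𝔽) := ∑ i, B i with hD
  have hDx : Commute D (opX c s a) := by
    refine LinearMap.ext fun φ => funext fun x => ?_
    simp only [hD, hB, Module.End.mul_apply, mulBy_apply, tr_apply, opX_apply,
      LinearMap.sum_apply, Finset.sum_apply, hα, ← ha.add, Finset.mul_sum, mul_sub,
      Finset.sum_sub_distrib]
    congr 1
    · refine (Finset.sum_congr rfl fun i _ => Finset.sum_congr rfl fun j _ => ?_)
      rw [add_comm (s i)]; ring
    · refine Finset.sum_congr rfl fun i _ => Finset.sum_congr rfl fun j _ => ?_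
      ring
  have hDq : D ^ q = mulBy β := by
    rw [hD, sum_pow_of_commute hq _ _ hBB]
    have hBp : ∀ i n φ x, ((B i) ^ n) φ x = c i ^ n * α x (s i) ^ n * φ (a (n • s i) x) := by
      intro i n
      induction n with
      | zero => intro φ x; simp [ha.zero]
      | succ n ih =>
        intro φ x
        rw [pow_succ', Module.End.mul_apply]
        simp only [hB, Module.End.mul_apply, mulBy_apply, tr_apply] at ih ⊢
        rw [ih, hα, ← ha.add, succ_nsmul]
        ring
    refine LinearMap.ext fun φ => funext fun x => ?_
    simp [LinearMap.sum_apply, Finset.sum_apply, hBp, hG, ha.zero, hβ, Finset.sum_mul]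
  have hinv : ∀ g x, (β (a g x)) = β x := fun g x => by simp [hβ, hα]
  set R : Module.End 𝔽 (X → 𝔽) := mulBy (fun x => (β x)⁻¹) with hR
  have hRx : Commute R (opX c s a) := by
    refine LinearMap.ext fun φ => funext fun x => ?_
    simp only [hR, Module.End.mul_apply, mulBy_apply, opX_apply, hinv, Finset.mul_sum]
    refine Finset.sum_congr rfl fun i _ => ?_
    ring
  have hcomm : opX c s a * mulBy μ - mulBy μ * opX c s a = D := by
    refine LinearMap.ext fun φ => funext fun x => ?_
    simp only [hD, hB, Module.End.mul_apply, mulBy_apply, tr_apply, opX_apply, hμ,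
      LinearMap.sum_apply, LinearMap.sub_apply, Pi.sub_apply, Finset.sum_apply, Finset.mul_sum]
    rw [← Finset.sum_sub_distrib]
    refine Finset.sum_congr rfl fun i _ => ?_
    ring
  have hq1 : q - 1 + 1 = q := by have := hq.pos; omega
  refine ⟨mulBy μ * (D ^ (q - 1) * R), ?_⟩
  have h1 : Commute (D ^ (q - 1) * R) (opX c s a) := (hDx.pow_left _).mul_left hRx
  rw [mul_assoc, h1.eq, ← mul_assoc (opX c s a), ← mul_assoc (mulBy μ) (opX c s a), ← sub_mul,
    hcomm, ← mul_assoc, ← pow_succ', hq1,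
    hDq]
  refine LinearMap.ext fun φ => funext fun x => ?_
  simp [hR, hβne x]

variable [Module (ZMod q) G]

lemma exists_label_function (𝔽 : Type*) [Field 𝔽] [CharP 𝔽 q] (hq : q.Prime) {a : G → X → X} (ha : IsAct a)
    (hfix : ∀ x, ∃ g, a g x ≠ x) :
    ∃ (μ : X → 𝔽) (α : X → G →+ ZMod q), (∀ g x, α (a g x) = α x) ∧
      (∀ g x, μ (a g x) = μ x + ZMod.castHom (dvd_refl q) 𝔽 (α x g)) ∧ ∀ x, α x ≠ 0 := by
  have := Fact.mk hq
  let S : Setoid X :=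
    { r := fun x y => ∃ g, a g x = y
      iseqv :=
        ⟨fun x => ⟨0, ha.zero x⟩, fun {x y} ⟨g, hg⟩ => ⟨-g, by
          rw [← hg, ← ha.add, neg_add_cancel, ha.zero]⟩,
         fun {x y z} ⟨g, hg⟩ ⟨h, hh⟩ => ⟨h + g, by rw [ha.add, hg, hh]⟩⟩ }
  let rep : X → X := fun x => (Quotient.mk S x).out
  have hrep : ∀ x, ∃ g, a g (rep x) = x := fun x => Quotient.exact (Quotient.out_eq (Quotient.mk S x))
  have hrepa : ∀ g x, rep (a g x) = rep x := fun g x => by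
    have : Quotient.mk S (a g x) = Quotient.mk S x := Quotient.sound (S.symm ⟨g, rfl⟩)
    simp only [rep, this]
  have hα : ∀ x : X, ∃ α : G →ₗ[ZMod q] ZMod q, α ≠ 0 ∧ ∀ g, a g x = x → α g = 0 := by
    intro x
    let St : AddSubgroup G :=
      { carrier := {g | a g x = x}
        zero_mem' := ha.zero x
        add_mem' := fun {g h} hg hh => by
          simp only [Set.mem_ofPred_eq] at *
          rw [ha.add, hh, hg]
        neg_mem' := fun {g} hg => by
          simp only [Set.mem_ofPred_eq] at *
          conv_lhs => rw [← hg]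
          rw [← ha.add, neg_add_cancel, ha.zero] }
    let St' : Submodule (ZMod q) G := AddSubgroup.toZModSubmodule q St
    have hlt : St' < ⊤ := by
      rw [lt_top_iff_ne_top]
      intro htop
      obtain ⟨g, hg⟩ := hfix x
      have : g ∈ St' := htop ▸ Submodule.mem_top
      exact hg this
    obtain ⟨f, hf0, hf⟩ := Submodule.exists_le_ker_of_lt_top St' hlt
    exact ⟨f, hf0, fun g hg => hf (show g ∈ St' from hg)⟩
  choose α hα0 hαst using hα
  choose γ hγ using hrep
  refine ⟨fun x => ZMod.castHom (dvd_refl q) 𝔽 (α (rep x) (γ x)), fun x => (α (rep x)).toAddMonoidHom,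
    fun g x => by simp only [hrepa], fun g x => ?_, fun x h => hα0 (rep x) ?_⟩
  · simp only [hrepa, LinearMap.toAddMonoidHom_coe, ← map_add]
    congr 1
    rw [← sub_eq_zero, ← map_sub]
    apply hαst
    have h1 : a (γ (a g x)) (rep x) = a g x := by
      have := hγ (a g x)
      rwa [hrepa] at this
    have h2 : a (γ x + g) (rep x) = a g x := by
      rw [add_comm, ha.add, hγ]
    have h3 : γ (a g x) - (γ x + g) = -(γ x + g) + γ (a g x) := by abel
    rw [h3, ha.add, h1, ← h2, ← ha.add, neg_add_cancel, ha.zero]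
  · ext g
    exact congrArg (fun f : G →+ ZMod q => f g) h

/-- Exactness of the periodic complex on an invariant set without fixed points. -/
theorem exists_eq_opY [CharP 𝔽 q] (hq : q.Prime) (c : ι → 𝔽) (s : ι → G)
    (hcs : ∀ α : G →+ ZMod q, α ≠ 0 → ∑ i, c i * ZMod.castHom (dvd_refl q) 𝔽 (α (s i)) ≠ 0)
    {a : G → X → X} (ha : IsAct a) (P : X → Prop) (hP : ∀ g x, P x → P (a g x))
    (hfix : ∀ x, P x → ∃ g, a g x ≠ x) (j : ℕ) (φ : X → 𝔽)
    (hφ : ∀ x, P x → opY q c s a j φ x = 0) :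
    ∃ ψ : X → 𝔽, (∀ x, ¬ P x → ψ x = 0) ∧ ∀ x, P x → φ x = opY q c s a (j + 1) ψ x := by
  classical
  have hG : ∀ g : G, q • g = 0 := fun g => by
    rw [← Nat.cast_smul_eq_nsmul (ZMod q), CharP.cast_eq_zero, zero_smul]
  let a' : G → {x // P x} → {x // P x} := fun g x => ⟨a g x, hP g x x.2⟩
  have ha' : IsAct a' := ⟨fun x => Subtype.ext (ha.zero x), fun g h x => Subtype.ext (ha.add g h x)⟩
  let L : (X → 𝔽) →ₗ[𝔽] ({x // P x} → 𝔽) := LinearMap.funLeft 𝔽 𝔽 Subtype.val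
  have hL : ∀ i φ, L (tr 𝔽 a (s i) φ) = tr 𝔽 a' (s i) (L φ) := fun _ _ => rfl
  obtain ⟨μ, α, h1, h2, h3⟩ := exists_label_function 𝔽 hq ha' (fun x => by
    obtain ⟨g, hg⟩ := hfix x x.2
    exact ⟨g, fun h => hg (congrArg Subtype.val h)⟩)
  obtain ⟨m, hm⟩ := exists_weyl_partner hq hG c s ha' μ
    (fun x g => ZMod.castHom (dvd_refl q) 𝔽 (α x g)) (fun g h x => by rw [h1]) h2
    (fun x => hcs _ (h3 x))
  have key : ∃ w, L φ = opY q c s a' (j + 1) w := by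
    have h0 : opY q c s a' j (L φ) = 0 := by
      rw [← opY_comm q c s L hL]
      exact funext fun x => hφ x x.2
    have hq2 := hq.two_le
    unfold opY at h0 ⊢
    rcases Nat.even_or_odd j with h | h
    · rw [if_pos h] at h0
      rw [if_neg (by simpa [Nat.even_add_one] using h)]
      exact weyl_ker_le hq hm h0
    · rw [if_neg (by simpa using h)] at h0
      rw [if_pos (by simpa [Nat.even_add_one] using h)]
      obtain ⟨w, hw⟩ := weyl_ker_pow_le hq hm (q - 1) (by omega) h0
      rw [show q - (q - 1) = 1 by omega, pow_one] at hw
      exact ⟨w, hw⟩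
  obtain ⟨w, hw⟩ := key
  refine ⟨fun x => if h : P x then w ⟨x, h⟩ else 0, fun x hx => by simp [hx], fun x hx => ?_⟩
  have h4 := opY_comm q c s L hL (j + 1) (fun x => if h : P x then w ⟨x, h⟩ else 0)
  have h5 : L (fun x => if h : P x then w ⟨x, h⟩ else 0) = w := by
    ext x
    simp [L, LinearMap.funLeft_apply, x.2]
  rw [h5, ← hw] at h4
  exact (congrFun h4 ⟨x, hx⟩).symm

end Kernel

section Differential

variable {𝔽 : Type*} [Field 𝔽] {α β Y : Type*}

/-- The alternating sum of the values of a function on the lists obtained from `l` by deleting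
one entry. -/
def difAt (𝔽 : Type*) [Field 𝔽] {α : Type*} : List α → ((List α → 𝔽) →ₗ[𝔽] 𝔽)
  | [] => 0
  | a :: l => LinearMap.proj l - (difAt 𝔽 l).comp (LinearMap.funLeft 𝔽 𝔽 (List.cons a))

/-- The simplicial coboundary on functions of lists. -/
def dif : (List α → 𝔽) →ₗ[𝔽] (List α → 𝔽) := LinearMap.pi (difAt 𝔽)

@[simp] lemma dif_nil (φ : List α → 𝔽) : dif φ [] = 0 := rfl

lemma dif_cons (φ : List α → 𝔽) (a : α) (l : List α) :
    dif φ (a :: l) = φ l - dif (fun t => φ (a :: t)) l := rfl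

lemma dif_sub_apply (φ ψ : List α → 𝔽) (l : List α) :
    dif (fun t => φ t - ψ t) l = dif φ l - dif ψ l :=
  congrFun (map_sub dif φ ψ) l

lemma dif_add_apply (φ ψ : List α → 𝔽) (l : List α) :
    dif (fun t => φ t + ψ t) l = dif φ l + dif ψ l :=
  congrFun (map_add dif φ ψ) l

lemma dif_mul_apply (c : 𝔽) (φ : List α → 𝔽) (l : List α) :
    dif (fun t => c * φ t) l = c * dif φ l :=
  congrFun (map_smul dif c φ) l

lemma dif_zero_apply (l : List α) : dif (fun _ => (0 : 𝔽)) l = 0 :=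
  congrFun (map_zero dif) l

lemma dif_dif (φ : List α → 𝔽) (l : List α) : dif (dif φ) l = 0 := by
  induction l generalizing φ with
  | nil => rfl
  | cons a l ih =>
    rw [dif_cons]
    simp only [dif_cons]
    rw [dif_sub_apply, ih, sub_zero, sub_self]

lemma dif_append (φ : List α → 𝔽) (l l' : List α) :
    dif φ (l ++ l') = dif (fun t => φ (t ++ l')) l +
      (-1) ^ l.length * dif (fun t => φ (l ++ t)) l' := by
  induction l generalizing φ with
  | nil => simp
  | cons a l ih =>
    simp only [List.cons_append, dif_cons, ih, List.length_cons]
    ring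

lemma dif_eq_zero (φ : List α → 𝔽) (l : List α)
    (h : ∀ t, t.Sublist l → t.length + 1 = l.length → φ t = 0) : dif φ l = 0 := by
  induction l generalizing φ with
  | nil => rfl
  | cons a l ih =>
    rw [dif_cons, h l (List.sublist_cons_self a l) rfl, zero_sub, neg_eq_zero]
    exact ih _ fun t ht hl => h _ (ht.cons_cons a) (by simp [hl])

lemma dif_congr {φ ψ : List α → 𝔽} (l : List α)
    (h : ∀ t, t.Sublist l → t.length + 1 = l.length → φ t = ψ t) : dif φ l = dif ψ l := by
  rw [← sub_eq_zero, ← dif_sub_apply]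
  exact dif_eq_zero _ _ fun t h1 h2 => sub_eq_zero.2 (h t h1 h2)

lemma dif_map (f : α → β) (φ : List β → 𝔽) (l : List α) :
    dif φ (l.map f) = dif (fun t => φ (t.map f)) l := by
  induction l generalizing φ with
  | nil => rfl
  | cons a l ih => simp only [List.map_cons, dif_cons, ih]

lemma dif_linear (L : (Y → 𝔽) →ₗ[𝔽] 𝔽) (Φ : List α → Y → 𝔽) (l : List α) :
    dif (fun t => L (Φ t)) l = L (fun y => dif (fun t => Φ t y) l) := by
  induction l generalizing Φ with
  | nil => exact (map_zero L).symm
  | cons a l ih =>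
    simp only [dif_cons, ih]
    rw [← map_sub]
    rfl

lemma dif_ofFn {n : ℕ} (φ : List α → 𝔽) (u : Fin (n + 1) → α) :
    dif φ (List.ofFn u) = ∑ j : Fin (n + 1), (-1) ^ (j : ℕ) * φ (List.ofFn (u ∘ j.succAbove)) := by
  induction n generalizing φ with
  | zero => simp [List.ofFn_succ, dif_cons]
  | succ n ih =>
    rw [List.ofFn_succ, dif_cons, ih, Fin.sum_univ_succ (n := n + 1), sub_eq_add_neg, ← Finset.sum_neg_distrib]
    congr 1
    · simp [Function.comp_def]
    · refine Finset.sum_congr rfl fun j _ => ?_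
      rw [List.ofFn_succ (f := u ∘ j.succ.succAbove)]
      simp only [Function.comp_apply, Fin.succ_succAbove_zero, Fin.succ_succAbove_succ, Fin.val_succ,
        pow_succ]
      simp [Function.comp_def]

lemma ofFn_succAbove_sublist {n : ℕ} (u : Fin (n + 1) → α) (j : Fin (n + 1)) :
    (List.ofFn (u ∘ j.succAbove)).Sublist (List.ofFn u) := by
  induction n with
  | zero => simp
  | succ n ih =>
    rw [List.ofFn_succ (f := u)]
    refine Fin.cases ?_ (fun j => ?_) j
    · simp [Function.comp_def]
    · rw [List.ofFn_succ (f := u ∘ j.succ.succAbove)]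
      simp only [Function.comp_apply, Fin.succ_succAbove_zero, Fin.succ_succAbove_succ]
      exact (ih (fun i => u i.succ) j).cons_cons _

lemma dif_adjacent (φ : List α → 𝔽) (hφ : ∀ l₁ a l₂, φ (l₁ ++ a :: a :: l₂) = 0)
    (l₁ : List α) (a : α) (l₂ : List α) : dif φ (l₁ ++ a :: a :: l₂) = 0 := by
  rw [dif_append]
  simp only [hφ, dif_cons, sub_sub_cancel]
  simp only [dif_zero_apply, mul_zero, add_zero]

end Differential

section Chains

variable {𝔽 : Type*} [Field 𝔽] {G : Type*} [AddCommGroup G] {ι α : Type*} [Fintype ι]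

/-- The action on lists induced by an action on entries. -/
def listAct (a : G → α → α) (g : G) : List α → List α := List.map (a g)

lemma IsAct.listAct {a : G → α → α} (ha : IsAct a) : IsAct (listAct a) where
  zero l := by
    have : a 0 = id := funext ha.zero
    simp [VKF.listAct, this]
  add g h l := by
    have : a (g + h) = a g ∘ a h := funext (ha.add g h)
    simp [VKF.listAct, this]

lemma opY_dif (q : ℕ) (c : ι → 𝔽) (s : ι → G) (a : G → α → α) (j : ℕ) (φ : List α → 𝔽) :
    dif (opY q c s (listAct a) j φ) = opY q c s (listAct a) j (dif φ) :=
  opY_comm (a := listAct a) (a' := listAct a) q c s dif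
    (fun i φ => funext fun l => (dif_map (a (s i)) φ l).symm) j φ

/-- The action of the labels on labelled vertices. -/
def vertAct (g : G) (x : ℕ × G) : ℕ × G := (x.1, g + x.2)

lemma isAct_vertAct : IsAct (vertAct : G → ℕ × G → ℕ × G) :=
  ⟨fun x => by simp [vertAct], fun g h x => by simp [vertAct, add_assoc]⟩

/-- Lists of labelled vertices with strictly decreasing positions, all less than `M`. -/
def Good (M : ℕ) (σ : List (ℕ × G)) : Prop :=
  σ.Pairwise (fun x y => y.1 < x.1) ∧ ∀ x ∈ σ, x.1 < M

lemma Good.sublist {M : ℕ} {σ τ : List (ℕ × G)} (h : Good M σ) (hτ : τ.Sublist σ) : Good M τ :=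
  ⟨h.1.sublist hτ, fun x hx => h.2 x (hτ.subset hx)⟩

lemma Good.mono {M M' : ℕ} {σ : List (ℕ × G)} (h : Good M σ) (hM : M ≤ M') : Good M' σ :=
  ⟨h.1, fun x hx => (h.2 x hx).trans_le hM⟩

lemma Good.act {M : ℕ} {σ : List (ℕ × G)} (h : Good M σ) (g : G) : Good M (listAct vertAct g σ) := by
  refine ⟨?_, ?_⟩
  · exact List.pairwise_map.2 h.1
  · intro x hx
    obtain ⟨y, hy, rfl⟩ := List.mem_map.1 hx
    exact h.2 y hy

lemma Good.cons {M : ℕ} {σ : List (ℕ × G)} (h : Good M σ) (s : G) : Good (M + 1) ((M, s) :: σ) := by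
  refine ⟨List.pairwise_cons.2 ⟨fun x hx => h.2 x hx, h.1⟩, fun x hx => ?_⟩
  rcases List.mem_cons.1 hx with rfl | hx
  · exact Nat.lt_succ_self _
  · exact (h.2 x hx).trans (Nat.lt_succ_self _)

@[simp] lemma length_listAct (a : G → α → α) (g : G) (σ : List α) :
    (listAct a g σ).length = σ.length := List.length_map _

variable (q : ℕ) (c : ι → 𝔽) (s : ι → G)

/-- The chains of the iterated join, viewed as linear functionals on functions of lists. -/
def chain : ℕ → ((List (ℕ × G) → 𝔽) →ₗ[𝔽] 𝔽)
  | 0 => LinearMap.proj [(0, 0)]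
  | j + 1 => (chain j).comp ((opY q c s (listAct vertAct) j).comp
      (LinearMap.funLeft 𝔽 𝔽 (List.cons (j + 1, 0))))

lemma chain_zero (Φ : List (ℕ × G) → 𝔽) : chain q c s 0 Φ = Φ [(0, 0)] := rfl

lemma chain_succ (j : ℕ) (Φ : List (ℕ × G) → 𝔽) : chain q c s (j + 1) Φ =
    chain q c s j (opY q c s (listAct vertAct) j (fun l => Φ ((j + 1, 0) :: l))) := rfl

lemma chain_eq_zero (j : ℕ) (Φ : List (ℕ × G) → 𝔽)
    (h : ∀ σ, Good (j + 1) σ → σ.length = j + 1 → Φ σ = 0) : chain q c s j Φ = 0 := by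
  induction j generalizing Φ with
  | zero =>
    rw [chain_zero]
    exact h _ ⟨by simp, by simp⟩ rfl
  | succ j ih =>
    rw [chain_succ]
    refine ih _ fun σ hσ hl => ?_
    refine opY_eq_zero_of q c s (fun σ => Good (j + 1) σ ∧ σ.length = j + 1)
      (fun g σ hσ => ⟨hσ.1.act g, by simpa using hσ.2⟩) j ?_ σ ⟨hσ, hl⟩
    exact fun τ hτ => h _ (hτ.1.cons 0) (by simp [hτ.2])

lemma chain_congr (j : ℕ) {Φ Ψ : List (ℕ × G) → 𝔽}
    (h : ∀ σ, Good (j + 1) σ → σ.length = j + 1 → Φ σ = Ψ σ) :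
    chain q c s j Φ = chain q c s j Ψ := by
  rw [← sub_eq_zero, ← map_sub]
  exact chain_eq_zero q c s j _ fun σ h1 h2 => sub_eq_zero.2 (h σ h1 h2)

/-- The boundary of the chains. -/
lemma chain_dif {q : ℕ} [CharP 𝔽 q] (hq : q.Prime) (hG : ∀ g : G, q • g = 0) (j : ℕ)
    (Φ : List (ℕ × G) → 𝔽) :
    chain q c s (j + 1) (dif Φ) = chain q c s j (opY q c s (listAct vertAct) j Φ) := by
  induction j generalizing Φ with
  | zero =>
    rw [chain_succ, chain_zero, chain_zero]
    have h1 : (fun l => dif Φ ((0 + 1, (0 : G)) :: l)) =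
      Φ - dif (fun l => Φ ((0 + 1, (0 : G)) :: l)) := rfl
    rw [h1, map_sub, ← opY_dif, Pi.sub_apply, dif_cons, dif_nil, sub_zero, sub_eq_self]
    exact opY_invariant hq c s (LinearMap.proj []) (fun _ _ => rfl) 0 _
  | succ j ih =>
    rw [chain_succ]
    have h1 : (fun l => dif Φ ((j + 1 + 1, (0 : G)) :: l)) =
      Φ - dif (fun l => Φ ((j + 1 + 1, (0 : G)) :: l)) := rfl
    rw [h1, map_sub, ← opY_dif, map_sub, ih, opY_opY hq hG c s isAct_vertAct.listAct, map_zero,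
      sub_zero]

end Chains

section Planar

/-- For a Plücker matrix with nonzero off-diagonal entries, there are as many rows with
positive entries as rows with negative entries; here is one inequality. -/
lemma exists_sink {J : Type*} [Fintype J] [DecidableEq J] [Nontrivial J] (A : J → J → ℝ)
    (hanti : ∀ i j, A i j = -A j i) (hne : ∀ i j, i ≠ j → A i j ≠ 0)
    (hpl : ∀ i j k l, A i j * A k l - A i k * A j l + A i l * A j k = 0)
    (s : J) (hs : ∀ i, i ≠ s → 0 < A s i) : ∃ t, ∀ i, i ≠ t → A t i < 0 := by
  obtain ⟨p, hp⟩ := exists_ne s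
  obtain ⟨t, ht, hmax⟩ := Finset.exists_max_image (Finset.univ.erase s)
    (fun i => A p i / A s i) ⟨p, by simp [hp]⟩
  have hts : t ≠ s := (Finset.mem_erase.1 ht).1
  refine ⟨t, fun i hi => ?_⟩
  by_cases his : i = s
  · rw [his, hanti, neg_lt_zero]; exact hs t hts
  · have h1 := hmax i (by simp [his])
    have h2 := hs i his
    have h3 := hs t hts
    have h4 := hs p hp
    have h5 := hpl s p t i
    rw [div_le_div_iff₀ h2 h3] at h1
    refine lt_of_le_of_ne ?_ (hne t i (Ne.symm hi))
    by_contra hcon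
    push Not at hcon
    have := mul_pos h4 hcon
    nlinarith

lemma card_source_eq_card_sink {J : Type*} [Fintype J] [DecidableEq J] [Nontrivial J]
    (A : J → J → ℝ)
    (hanti : ∀ i j, A i j = -A j i) (hne : ∀ i j, i ≠ j → A i j ≠ 0)
    (hpl : ∀ i j k l, A i j * A k l - A i k * A j l + A i l * A j k = 0)
    [DecidablePred fun t => ∀ i, i ≠ t → 0 < A t i]
    [DecidablePred fun t => ∀ i, i ≠ t → A t i < 0] :
    (Finset.univ.filter fun t => ∀ i, i ≠ t → 0 < A t i).card =
      (Finset.univ.filter fun t => ∀ i, i ≠ t → A t i < 0).card := by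
  have h1 : (Finset.univ.filter fun t => ∀ i, i ≠ t → 0 < A t i).card ≤ 1 := by
    rw [Finset.card_le_one]
    intro a ha b hb
    simp only [Finset.mem_filter, Finset.mem_univ, true_and] at ha hb
    by_contra hab
    have := ha b (Ne.symm hab)
    have := hb a hab
    have := hanti a b
    linarith
  have h2 : (Finset.univ.filter fun t => ∀ i, i ≠ t → A t i < 0).card ≤ 1 := by
    rw [Finset.card_le_one]
    intro a ha b hb
    simp only [Finset.mem_filter, Finset.mem_univ, true_and] at ha hb
    by_contra hab
    have := ha b (Ne.symm hab)
    have := hb a hab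
    have := hanti a b
    linarith
  have h3 : (Finset.univ.filter fun t => ∀ i, i ≠ t → 0 < A t i).Nonempty ↔
      (Finset.univ.filter fun t => ∀ i, i ≠ t → A t i < 0).Nonempty := by
    constructor
    · rintro ⟨s, hs⟩
      obtain ⟨t, ht⟩ := exists_sink A hanti hne hpl s (by simpa using hs)
      exact ⟨t, by simpa using ht⟩
    · rintro ⟨s, hs⟩
      obtain ⟨t, ht⟩ := exists_sink (fun i j => -A i j) (fun i j => by rw [hanti])
        (fun i j hij => neg_ne_zero.2 (hne i j hij)) (fun i j k l => by linarith [hpl i j k l]) s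
        (by simpa using hs)
      exact ⟨t, by simpa using ht⟩
  rw [← Finset.card_pos, ← Finset.card_pos] at h3
  omega

end Planar

section Sign

variable (𝔽 : Type*) [Field 𝔽]

/-- The sign of a real number, as an element of a field. -/
noncomputable def sgn (x : ℝ) : 𝔽 := (SignType.sign x : SignType)

lemma sgn_mul (x y : ℝ) : sgn 𝔽 (x * y) = sgn 𝔽 x * sgn 𝔽 y := by simp [sgn, sign_mul]

lemma sgn_pos {x : ℝ} (hx : 0 < x) : sgn 𝔽 x = 1 := by simp [sgn, sign_pos hx]

lemma sgn_neg {x : ℝ} (hx : x < 0) : sgn 𝔽 x = -1 := by simp [sgn, sign_neg hx]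

lemma sgn_neg_eq (x : ℝ) : sgn 𝔽 (-x) = -sgn 𝔽 x := by
  rw [← neg_one_mul, sgn_mul, sgn_neg 𝔽 (by norm_num), neg_one_mul]

lemma sgn_neg_one_pow (n : ℕ) : sgn 𝔽 ((-1) ^ n) = (-1) ^ n := by
  induction n with
  | zero => simp [sgn]
  | succ n ih => rw [pow_succ, sgn_mul, ih, sgn_neg 𝔽 (by norm_num), pow_succ]

lemma sgn_mul_self {x : ℝ} (hx : x ≠ 0) : sgn 𝔽 x * sgn 𝔽 x = 1 := by
  rw [← sgn_mul, sgn_pos]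
  exact mul_self_pos.2 hx

/-- In characteristic `q`, the sign of a real `q`-th root of unity is `1`. -/
lemma sgn_of_pow_eq_one {q : ℕ} [CharP 𝔽 q] (hq : q.Prime) {x : ℝ} (hx : x ^ q = 1) :
    sgn 𝔽 x = 1 := by
  rcases hq.eq_two_or_odd' with rfl | hodd
  · have h2 : (-1 : 𝔽) = 1 := by
      have : (2 : 𝔽) = 0 := by exact_mod_cast CharP.cast_eq_zero 𝔽 2
      linear_combination -this
    rcases lt_trichotomy x 0 with h | h | h
    · rw [sgn_neg 𝔽 h, h2]
    · rw [h] at hx; norm_num at hx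
    · exact sgn_pos 𝔽 h
  · apply sgn_pos
    by_contra h
    push Not at h
    have := hodd.pow_nonpos h
    linarith

end Sign

section Cochain

variable {𝔽 : Type*} [Field 𝔽] {V : Type*} [AddCommGroup V] [Module ℝ V] {N : ℕ}
  (e : Module.Basis (Fin N) ℝ V)

/-- The family `w` has a linear relation with positive coefficients. -/
def PosRel {n : ℕ} (w : Fin n → V) : Prop :=
  ∃ c : Fin n → ℝ, (∀ i, 0 < c i) ∧ ∑ i, c i • w i = 0

open Classical in
variable (𝔽) in
/-- The intersection cochain: the oriented indicator of simplices around the origin. -/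
noncomputable def interFin (w : Fin (N + 1) → V) : 𝔽 :=
  if PosRel w then sgn 𝔽 (e.det fun i => w i.succ) else 0

variable (𝔽) in
/-- The intersection cochain on lists of vectors. -/
noncomputable def inter (l : List V) : 𝔽 :=
  if h : l.length = N + 1 then interFin 𝔽 e (fun i => l.get (i.cast h.symm)) else 0

lemma inter_ofFn (w : Fin (N + 1) → V) : inter 𝔽 e (List.ofFn w) = interFin 𝔽 e w := by
  simp [inter, -List.ofFn_succ]

lemma relation_eq_zero {u : Fin (N + 2) → V} {i j : Fin (N + 2)} (hij : j ≠ i)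
    (hgen : ∀ (i : Fin (N + 2)) (j : Fin (N + 1)),
      LinearIndependent ℝ (u ∘ i.succAbove ∘ j.succAbove))
    {c : Fin (N + 2) → ℝ} (hc : ∑ k, c k • u k = 0) (hi : c i = 0) (hj : c j = 0) : c = 0 := by
  obtain ⟨j', rfl⟩ := Fin.exists_succAbove_eq hij
  rw [Fin.sum_univ_succAbove _ i, Fin.sum_univ_succAbove _ j', hi, hj, zero_smul, zero_smul,
    zero_add, zero_add] at hc
  have := (Fintype.linearIndependent_iff.1 (hgen i j')) _ hc
  funext k
  by_cases hk : k = i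
  · rw [hk, hi]; rfl
  · obtain ⟨k', rfl⟩ := Fin.exists_succAbove_eq hk
    by_cases hk' : k' = j'
    · rw [hk', hj]; rfl
    · obtain ⟨k'', rfl⟩ := Fin.exists_succAbove_eq hk'
      exact this k''

lemma posRel_succAbove_iff {u : Fin (N + 2) → V}
    (hgen : ∀ (i : Fin (N + 2)) (j : Fin (N + 1)),
      LinearIndependent ℝ (u ∘ i.succAbove ∘ j.succAbove))
    (t : Fin (N + 2)) {r : Fin (N + 2) → ℝ} (hr : ∑ k, r k • u k = 0) (hrt : r t = 0)
    (hne : ∀ i, i ≠ t → r i ≠ 0) :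
    PosRel (u ∘ t.succAbove) ↔ (∀ i, i ≠ t → 0 < r i) ∨ (∀ i, i ≠ t → r i < 0) := by
  rw [Fin.sum_univ_succAbove _ t, hrt, zero_smul, zero_add] at hr
  constructor
  · rintro ⟨c, hc, hc0⟩
    let c' : Fin (N + 2) → ℝ := t.insertNth 0 c
    have hc' : ∑ k, c' k • u k = 0 := by
      rw [Fin.sum_univ_succAbove _ t]
      simpa [c'] using hc0
    have hrr : ∑ k, r k • u k = 0 := by
      rw [Fin.sum_univ_succAbove _ t, hrt, zero_smul, zero_add, hr]
    set i₀ : Fin (N + 2) := t.succAbove 0 with hi₀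
    have hi₀t : i₀ ≠ t := Fin.succAbove_ne t 0
    set z : ℝ := c' i₀ / r i₀ with hz
    have hz0 : (fun k => c' k - z * r k) = 0 := by
      refine relation_eq_zero (i := t) (j := i₀) hi₀t hgen ?_ ?_ ?_
      · simp only [sub_smul, mul_smul, Finset.sum_sub_distrib, ← Finset.smul_sum, hc', hrr]
        simp
      · simp [c', hrt]
      · simp only [hz]
        rw [div_mul_cancel₀ _ (hne _ hi₀t), sub_self]
    have hpos : ∀ i, i ≠ t → 0 < z * r i := fun i hi => by
      have h1 := congrFun hz0 i
      simp only [Pi.zero_apply, sub_eq_zero] at h1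
      rw [← h1]
      obtain ⟨i', rfl⟩ := Fin.exists_succAbove_eq hi
      simpa [c'] using hc i'
    rcases lt_trichotomy z 0 with h | h | h
    · right
      intro i hi
      have := hpos i hi
      by_contra hcon
      push Not at hcon
      nlinarith
    · have := hpos _ hi₀t
      simp [h] at this
    · left
      intro i hi
      exact (mul_pos_iff_of_pos_left h).1 (hpos i hi)
  · rintro (h | h)
    · exact ⟨fun i => r (t.succAbove i), fun i => h _ (Fin.succAbove_ne t i), hr⟩
    · refine ⟨fun i => -r (t.succAbove i), fun i => neg_pos.2 (h _ (Fin.succAbove_ne t i)), ?_⟩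
      simp only [neg_smul, Finset.sum_neg_distrib, neg_eq_zero]
      exact hr

lemma det_cons_succAbove {n : ℕ} (e : Module.Basis (Fin (n + 1)) ℝ V) (w : Fin (n + 1) → V)
    (b : Fin (n + 1) → ℝ) (i : Fin (n + 1)) :
    e.det (Fin.cons (∑ k, b k • w k) (w ∘ i.succAbove)) = (-1) ^ (i : ℕ) * (b i * e.det w) := by
  have h1 := e.det.neg_one_pow_smul_map_insertNth i (∑ k, b k • w k) (w ∘ i.succAbove)
  have h2 : (i.insertNth (∑ k, b k • w k) (w ∘ i.succAbove) : Fin (n + 1) → V) =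
      Function.update w i (∑ k, b k • w k) := by
    refine Fin.insertNth_eq_iff.2 ⟨by simp, ?_⟩
    funext j
    simp [Fin.removeNth]
  rw [h2, AlternatingMap.map_update_sum, Finset.sum_eq_single i] at h1
  · rw [AlternatingMap.map_update_smul, Function.update_eq_self] at h1
    change _ = e.det (Fin.cons (∑ k, b k • w k) (w ∘ i.succAbove)) at h1
    rw [← h1]
    simp
  · intro k _ hk
    rw [AlternatingMap.map_update_smul, AlternatingMap.map_update_self _ _ hk.symm, smul_zero]
  · simp

/-- The intersection cochain is a cocycle on generic families. -/
theorem interFin_cocycle {N : ℕ} (hN : 0 < N) (e : Module.Basis (Fin N) ℝ V) (u : Fin (N + 2) → V)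
    (hgen : ∀ (i : Fin (N + 2)) (j : Fin (N + 1)),
      LinearIndependent ℝ (u ∘ i.succAbove ∘ j.succAbove)) :
    ∑ j : Fin (N + 2), (-1) ^ (j : ℕ) * interFin 𝔽 e (u ∘ j.succAbove) = 0 := by
  classical
  obtain ⟨n, rfl⟩ : ∃ n, N = n + 1 := ⟨N - 1, by omega⟩
  set w : Fin (n + 1) → V := fun i => u i.succ.succ with hw
  have hwli : LinearIndependent ℝ w := by
    have := hgen 0 0
    simpa [Function.comp_def] using this
  have hspan : ∀ v : V, ∃ b : Fin (n + 1) → ℝ, v = ∑ k, b k • w k := by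
    intro v
    have hcard : Fintype.card (Fin (n + 1)) = Module.finrank ℝ V :=
      (Module.finrank_eq_card_basis e).symm
    let B := basisOfLinearIndependentOfCardEqFinrank hwli hcard
    refine ⟨B.repr v, ?_⟩
    conv_lhs => rw [← B.sum_repr v]
    simp [B]
  obtain ⟨a, ha⟩ := hspan (u 0)
  obtain ⟨b, hb⟩ := hspan (u 1)
  set c : Fin (n + 3) → ℝ := Fin.cons 1 (Fin.cons 0 fun i => -a i) with hc
  set d : Fin (n + 3) → ℝ := Fin.cons 0 (Fin.cons 1 fun i => -b i) with hd
  have hc0 : c 0 = 1 := rfl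
  have hc1 : c 1 = 0 := rfl
  have hd0 : d 0 = 0 := rfl
  have hd1 : d 1 = 1 := rfl
  have hcu : ∑ k, c k • u k = 0 := by
    rw [Fin.sum_univ_succ, Fin.sum_univ_succ]
    simp [hc, ha, hw]
  have hdu : ∑ k, d k • u k = 0 := by
    rw [Fin.sum_univ_succ, Fin.sum_univ_succ]
    simp [hd, hb, hw]
  set A : Fin (n + 3) → Fin (n + 3) → ℝ := fun i j => c i * d j - c j * d i with hA
  have hrel : ∀ i, ∑ k, A i k • u k = 0 := by
    intro i
    have : ∑ k, A i k • u k = c i • ∑ k, d k • u k - d i • ∑ k, c k • u k := by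
      rw [Finset.smul_sum, Finset.smul_sum, ← Finset.sum_sub_distrib]
      refine Finset.sum_congr rfl fun k _ => ?_
      simp only [hA]
      module
    rw [this, hcu, hdu, smul_zero, smul_zero, sub_zero]
  have hAii : ∀ i, A i i = 0 := fun i => by simp [hA]
  have hanti : ∀ i j, A i j = -A j i := fun i j => by simp only [hA]; ring
  have hne : ∀ i j, i ≠ j → A i j ≠ 0 := by
    intro i j hij h0
    have h1 := relation_eq_zero (i := i) (j := j) hij.symm hgen (hrel i) (hAii i) h0
    have h2 : d i = 0 := by simpa [hA, hc0, hd0] using congrFun h1 0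
    have h3 : c i = 0 := by simpa [hA, hc1, hd1] using congrFun h1 1
    have h4 : i ≠ 1 := by rintro rfl; rw [hd1] at h2; norm_num at h2
    have h5 := relation_eq_zero (i := i) (j := 1) h4.symm hgen hcu h3 hc1
    have := congrFun h5 0
    rw [hc0] at this
    norm_num at this
  have hpl : ∀ i j k l, A i j * A k l - A i k * A j l + A i l * A j k = 0 := fun i j k l => by
    simp only [hA]; ring
  set ω : ℝ := e.det w with hω
  have hsign : ∀ j : Fin (n + 3), (-1) ^ (j : ℕ) * e.det (fun i => u (j.succAbove i.succ)) =
      ω * A j (j.succAbove 0) := by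
    intro j
    refine Fin.cases ?_ (fun j => Fin.cases ?_ (fun i => ?_) j) j
    · have : A 0 1 = 1 := by simp [hA, hc0, hc1, hd0, hd1]
      simp [this, hω, hw]
    · have h1 : A 1 0 = -1 := by simp [hA, hc0, hc1, hd0, hd1]
      simp [h1, hω, hw]
    · have h1 : A i.succ.succ 0 = b i := by simp [hA, hc0, hd]
      have h2 : (fun k : Fin (n + 1) => u (i.succ.succ.succAbove k.succ)) =
          Fin.cons (∑ k, b k • w k) (w ∘ i.succAbove) := by
        funext k
        refine Fin.cases ?_ (fun k => ?_) k
        · rw [← hb]; simp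
        · simp [hw]
      rw [h2, det_cons_succAbove, Fin.succ_succAbove_zero, h1]
      simp only [Fin.val_succ, pow_succ]
      have : ((-1 : ℝ) ^ (i : ℕ)) * (-1) ^ (i : ℕ) = 1 := by
        rw [← mul_pow]; norm_num
      linear_combination (b i * ω) * this
  have hterm : ∀ j : Fin (n + 3), (-1) ^ (j : ℕ) * interFin 𝔽 e (u ∘ j.succAbove) =
      sgn 𝔽 ω * ((if ∀ i, i ≠ j → 0 < A j i then 1 else 0) -
        (if ∀ i, i ≠ j → A j i < 0 then 1 else 0)) := by
    intro j
    have h1 := posRel_succAbove_iff hgen j (hrel j) (hAii j)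
      (fun i hi => hne j i hi.symm)
    have h2 : (-1) ^ (j : ℕ) * sgn 𝔽 (e.det (fun i => u (j.succAbove i.succ))) =
        sgn 𝔽 ω * sgn 𝔽 (A j (j.succAbove 0)) := by
      rw [← sgn_neg_one_pow, ← sgn_mul, hsign, sgn_mul]
    have h3 : j.succAbove 0 ≠ j := Fin.succAbove_ne j 0
    by_cases hp : ∀ i, i ≠ j → 0 < A j i
    · have hn : ¬ ∀ i, i ≠ j → A j i < 0 := fun h => lt_asymm (h _ h3) (hp _ h3)
      rw [interFin, if_pos (h1.2 (Or.inl hp)), if_pos hp, if_neg hn]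
      simp only [Function.comp_apply]
      rw [h2, sgn_pos 𝔽 (hp _ h3)]
      simp
    · by_cases hn : ∀ i, i ≠ j → A j i < 0
      · rw [interFin, if_pos (h1.2 (Or.inr hn)), if_neg hp, if_pos hn]
        simp only [Function.comp_apply]
        rw [h2, sgn_neg 𝔽 (hn _ h3)]
        simp
      · rw [interFin, if_neg (fun h => (h1.1 h).elim hp hn), if_neg hp, if_neg hn]
        simp
  rw [Finset.sum_congr rfl fun j _ => hterm j, ← Finset.mul_sum, Finset.sum_sub_distrib,
    Finset.sum_boole, Finset.sum_boole, card_source_eq_card_sink A hanti hne hpl, sub_self, mul_zero]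

/-- The cocycle property on lists all of whose sublists with `N` entries are independent. -/
theorem inter_cocycle (hN : 0 < N) (l : List V) (hl : l.length = N + 2)
    (hgen : ∀ t : List V, t.Sublist l → t.length = N → LinearIndependent ℝ t.get) :
    dif (inter 𝔽 e) l = 0 := by
  obtain ⟨u, rfl⟩ : ∃ u : Fin (N + 2) → V, l = List.ofFn u :=
    ⟨fun i => l.get (i.cast hl.symm), by
      apply List.ext_get
      · simp [hl]
      · intro n h1 h2; simp [-List.ofFn_succ]⟩
  rw [dif_ofFn]
  simp only [inter_ofFn]
  refine interFin_cocycle hN e u fun i j => ?_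
  have h := hgen (List.ofFn (u ∘ i.succAbove ∘ j.succAbove))
    ((ofFn_succAbove_sublist (u ∘ i.succAbove) j).trans (ofFn_succAbove_sublist u i)) (by simp)
  have h2 := h.comp (Fin.cast (by simp)) (Fin.cast_injective
    (show N = (List.ofFn (u ∘ i.succAbove ∘ j.succAbove)).length by simp))
  convert h2 using 1
  funext k
  simp

lemma inter_map {q : ℕ} [CharP 𝔽 q] (hq : q.Prime) (ρ : V →ₗ[ℝ] V) (hρ : ρ ^ q = 1) (l : List V) :
    inter 𝔽 e (l.map ρ) = inter 𝔽 e l := by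
  have hinj : Function.Injective ρ := by
    obtain ⟨n, hn⟩ : ∃ n, q = n + 1 := ⟨q - 1, by have := hq.pos; omega⟩
    intro x y hxy
    have : ∀ z, (ρ ^ n) (ρ z) = z := fun z => by
      rw [← Module.End.mul_apply, ← pow_succ, ← hn, hρ, Module.End.one_apply]
    rw [← this x, hxy, this y]
  have hdet : sgn 𝔽 (LinearMap.det ρ) = 1 := by
    refine sgn_of_pow_eq_one 𝔽 hq ?_
    rw [← map_pow, hρ, map_one]
  by_cases hl : l.length = N + 1
  · have hl' : (l.map ρ).length = N + 1 := by simp [hl]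
    rw [inter, inter, dif_pos hl, dif_pos hl', interFin, interFin]
    have h1 : PosRel (fun i : Fin (N + 1) => (l.map ρ).get (i.cast hl'.symm)) ↔
        PosRel (fun i : Fin (N + 1) => l.get (i.cast hl.symm)) := by
      unfold PosRel
      refine exists_congr fun c => and_congr_right fun _ => ?_
      have : ∑ i : Fin (N + 1), c i • (l.map ρ).get (i.cast hl'.symm) =
          ρ (∑ i, c i • l.get (i.cast hl.symm)) := by simp
      rw [this, map_eq_zero_iff ρ hinj]
    have h2 : e.det (fun i => (l.map ρ).get (i.succ.cast hl'.symm)) =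
        LinearMap.det ρ * e.det (fun i => l.get (i.succ.cast hl.symm)) := by
      rw [← Module.Basis.det_comp]
      congr 1
      funext i
      simp
    simp only [h2, sgn_mul, hdet, one_mul]
    by_cases hp : PosRel (fun i : Fin (N + 1) => l.get (i.cast hl.symm))
    · rw [if_pos hp, if_pos (h1.2 hp)]
    · rw [if_neg hp, if_neg (fun h => hp (h1.1 h))]
  · rw [inter, inter, dif_neg hl, dif_neg (by simpa using hl)]

end Cochain

section Sets

variable {G : Type*} [AddCommGroup G] [DecidableEq G]

/-- The translation action on finite sets of labels. -/
def setAct (g : G) (S : Finset G) : Finset G := S.image (g + ·)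

lemma mem_setAct {g x : G} {S : Finset G} : x ∈ setAct g S ↔ x - g ∈ S := by
  simp only [setAct, Finset.mem_image]
  constructor
  · rintro ⟨y, hy, rfl⟩; simpa using hy
  · intro h; exact ⟨x - g, h, by abel⟩

lemma isAct_setAct : IsAct (setAct : G → Finset G → Finset G) :=
  ⟨fun S => by ext x; simp [mem_setAct], fun g h S => by ext x; simp [mem_setAct, sub_sub]⟩

lemma setAct_ssubset {g : G} {S T : Finset G} (h : S ⊂ T) : setAct g S ⊂ setAct g T :=
  Finset.image_ssubset_image (add_right_injective g) |>.2 h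

lemma setAct_nonempty {g : G} {S : Finset G} : (setAct g S).Nonempty ↔ S.Nonempty :=
  Finset.image_nonempty

variable [Fintype G]

lemma setAct_ne_univ {g : G} {S : Finset G} (h : S ≠ Finset.univ) : setAct g S ≠ Finset.univ := by
  intro h1
  apply h
  ext x
  have : g + x ∈ setAct g S := by simp [h1]
  simpa [mem_setAct] using this

/-- A nonempty proper set of labels is moved by some translation. -/
lemma exists_setAct_ne {S : Finset G} (h : S.Nonempty) (h' : S ≠ Finset.univ) :
    ∃ g, setAct g S ≠ S := by
  by_contra hcon
  push Not at hcon
  obtain ⟨x, hx⟩ := h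
  apply h'
  ext y
  simp only [Finset.mem_univ, iff_true]
  rw [← hcon (y - x), mem_setAct]
  simpa using hx

/-- Strictly increasing lists of `n` nonempty proper sets of labels. -/
def Flag (n : ℕ) (τ : List (Finset G)) : Prop :=
  τ.length = n ∧ τ.Pairwise (· ⊂ ·) ∧ ∀ S ∈ τ, S.Nonempty ∧ S ≠ Finset.univ

lemma Flag.act {n : ℕ} (g : G) (τ : List (Finset G)) (h : Flag n τ) :
    Flag n (listAct setAct g τ) := by
  refine ⟨by simpa using h.1, List.pairwise_map.2 (h.2.1.imp setAct_ssubset), ?_⟩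
  intro S hS
  obtain ⟨S', hS', rfl⟩ := List.mem_map.1 hS
  exact ⟨setAct_nonempty.2 (h.2.2 S' hS').1, setAct_ne_univ (h.2.2 S' hS').2⟩

lemma Flag.exists_ne {n : ℕ} (τ : List (Finset G)) (h : Flag (n + 1) τ) :
    ∃ g, listAct setAct g τ ≠ τ := by
  obtain ⟨h1, -, h3⟩ := h
  cases τ with
  | nil => simp at h1
  | cons S τ =>
    obtain ⟨g, hg⟩ := exists_setAct_ne (h3 S (by simp)).1 (h3 S (by simp)).2
    refine ⟨g, fun h => hg ?_⟩
    simp only [listAct, List.map_cons, List.cons.injEq] at h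
    exact h.1

lemma Flag.sublist {n : ℕ} {τ τ' : List (Finset G)} (h : Flag (n + 1) τ) (hs : τ'.Sublist τ)
    (hl : τ'.length + 1 = τ.length) : Flag n τ' :=
  ⟨by have := h.1; omega, h.2.1.sublist hs, fun S hS => h.2.2 S (hs.subset hS)⟩

lemma length_add_le_of_pairwise_ssubset (τ : List (Finset G)) (a : ℕ) (b : ℕ) (hab : a ≤ b)
    (h : τ.Pairwise (· ⊂ ·))
    (ha : ∀ S ∈ τ, a < S.card ∧ S.card ≤ b) : τ.length + a ≤ b := by
  induction τ generalizing a with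
  | nil => simpa
  | cons S τ ih =>
    rw [List.pairwise_cons] at h
    have h1 := ha S (by simp)
    have := ih S.card h1.2 h.2 fun T hT =>
      ⟨Finset.card_lt_card (h.1 T hT), (ha T (by simp [hT])).2⟩
    simp only [List.length_cons]
    omega

lemma Flag.lt {n : ℕ} {τ : List (Finset G)} (h : Flag n τ) : n < Fintype.card G := by
  have hpos : 0 < Fintype.card G := Fintype.card_pos
  have := length_add_le_of_pairwise_ssubset τ 0 (Fintype.card G - 1) (by omega) h.2.1
    fun S hS => ⟨Finset.card_pos.2 (h.2.2 S hS).1, by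
      have := (Finset.card_lt_iff_ne_univ S).2 (h.2.2 S hS).2
      omega⟩
  have := h.1
  omega

end Sets

lemma pairwise_ssubset_or_adjacent {G : Type*} (τ : List (Finset G)) (h : τ.Pairwise (· ⊆ ·)) :
    τ.Pairwise (· ⊂ ·) ∨ ∃ l₁ a l₂, τ = l₁ ++ a :: a :: l₂ := by
  induction τ with
  | nil => left; exact List.Pairwise.nil
  | cons S τ ih =>
    rw [List.pairwise_cons] at h
    rcases ih h.2 with h1 | ⟨l₁, a, l₂, rfl⟩
    · by_cases hS : ∀ T ∈ τ, S ⊂ T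
      · left; exact List.pairwise_cons.2 ⟨hS, h1⟩
      · right
        push Not at hS
        obtain ⟨T, hT, hST⟩ := hS
        have hTS : T = S := by
          by_contra hne
          exact hST ((h.1 T hT).ssubset_of_ne (Ne.symm hne))
        subst hTS
        cases τ with
        | nil => simp at hT
        | cons U τ =>
          rw [List.pairwise_cons] at h1
          have hU : U = T := by
            rcases List.mem_cons.1 hT with h2 | h2
            · exact h2.symm
            · exact absurd (h1.1 T h2) (fun h3 => h3.not_subset (h.1 U (by simp)))
          exact ⟨[], T, τ, by simp [hU]⟩
    · right; exact ⟨S :: l₁, a, l₂, rfl⟩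

section Transfer

variable {𝔽 : Type*} [Field 𝔽] {G : Type*} [AddCommGroup G] [DecidableEq G] [Fintype G]

/-- A function of lists vanishes on degenerate lists. -/
def Normal {α : Type*} (ψ : List α → 𝔽) : Prop := ∀ l₁ a l₂, ψ (l₁ ++ a :: a :: l₂) = 0

lemma normal_of_flag {n : ℕ} {ψ : List (Finset G) → 𝔽} (h : ∀ τ, ¬ Flag n τ → ψ τ = 0) :
    Normal ψ := by
  intro l₁ a l₂
  refine h _ fun hf => ?_
  have h1 := (List.pairwise_append.1 hf.2.1).2.1
  rw [List.pairwise_cons] at h1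
  exact (h1.1 a (by simp)).ne rfl

/-- The transfer of cochains along `Big`, twisted by the cocycle `J`. -/
def transfer (J : List (ℕ × G) → 𝔽) (Big : List (ℕ × G) → Finset G) :
    ℕ → ((List (Finset G) → 𝔽) →ₗ[𝔽] (List (ℕ × G) → 𝔽))
  | 0 => LinearMap.pi fun σ => J σ • LinearMap.proj [Big σ]
  | j + 1 => LinearMap.pi fun σ => (LinearMap.proj σ).comp (dif.comp ((transfer J Big j).comp
      (LinearMap.funLeft 𝔽 𝔽 (· ++ [Big σ]))))

variable {J : List (ℕ × G) → 𝔽} {Big : List (ℕ × G) → Finset G}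

lemma transfer_zero (ψ : List (Finset G) → 𝔽) (σ : List (ℕ × G)) :
    transfer J Big 0 ψ σ = J σ * ψ [Big σ] := rfl

lemma transfer_succ (j : ℕ) (ψ : List (Finset G) → 𝔽) (σ : List (ℕ × G)) :
    transfer J Big (j + 1) ψ σ = dif (transfer J Big j fun τ => ψ (τ ++ [Big σ])) σ := rfl

lemma transfer_act (hJ : ∀ g σ, J (listAct vertAct g σ) = J σ)
    (hB : ∀ g σ, Big (listAct vertAct g σ) = setAct g (Big σ)) (j : ℕ) (g : G)
    (ψ : List (Finset G) → 𝔽) (σ : List (ℕ × G)) :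
    transfer J Big j (fun τ => ψ (listAct setAct g τ)) σ =
      transfer J Big j ψ (listAct vertAct g σ) := by
  induction j generalizing ψ σ with
  | zero => rw [transfer_zero, transfer_zero, hJ, hB]; rfl
  | succ j ih =>
    rw [transfer_succ, transfer_succ]
    have h1 : (fun σ' => transfer J Big j (fun τ => ψ (τ ++ [Big (listAct vertAct g σ)]))
        (listAct vertAct g σ')) =
        transfer J Big j (fun τ => ψ (listAct setAct g (τ ++ [Big σ]))) := by
      funext σ'
      rw [← ih, hB]
      simp only [listAct, List.map_append, List.map_cons, List.map_nil]
    rw [← h1]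
    exact (dif_map _ _ _).symm

lemma transfer_congr (j : ℕ) {ψ ψ' : List (Finset G) → 𝔽}
    (h : ∀ τ, τ.length = j + 1 → ψ τ = ψ' τ) : transfer J Big j ψ = transfer J Big j ψ' := by
  funext σ
  induction j generalizing ψ ψ' σ with
  | zero => rw [transfer_zero, transfer_zero, h _ rfl]
  | succ j ih =>
    rw [transfer_succ, transfer_succ]
    have h1 : (transfer J Big j fun τ => ψ (τ ++ [Big σ])) =
        transfer J Big j fun τ => ψ' (τ ++ [Big σ]) :=
      funext fun σ' => ih (fun τ hτ => h _ (by simp [hτ])) σ'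
    rw [h1]

lemma transfer_eq_zero {M N : ℕ} (hBm : ∀ σ τ, τ.Sublist σ → Big τ ⊆ Big σ)
    (hBu : ∀ σ, Good M σ → Big σ ≠ Finset.univ)
    (hBJ : ∀ σ, Good M σ → σ.length = N + 1 → J σ ≠ 0 → (Big σ).Nonempty)
    (j : ℕ) (ψ : List (Finset G) → 𝔽) (σ : List (ℕ × G)) (hσ : Good M σ)
    (hl : σ.length = N + 1 + j)
    (h : ∀ τ : List (Finset G), τ.length = j + 1 → τ.Pairwise (· ⊆ ·) →
      (∀ S ∈ τ, S.Nonempty ∧ S ≠ Finset.univ ∧ S ⊆ Big σ) → ψ τ = 0) :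
    transfer J Big j ψ σ = 0 := by
  induction j generalizing ψ σ with
  | zero =>
    rw [transfer_zero]
    by_cases hJ : J σ = 0
    · rw [hJ, zero_mul]
    · rw [h _ rfl (by simp), mul_zero]
      simpa using ⟨hBJ σ hσ (by simpa using hl) hJ, hBu σ hσ⟩
  | succ j ih =>
    rw [transfer_succ]
    refine dif_eq_zero _ _ fun σ' hs hl' => ih _ _ (hσ.sublist hs) (by omega) fun τ h1 h2 h3 => ?_
    have h4 : ∀ S ∈ τ, S ⊆ Big σ := fun S hS => (h3 S hS).2.2.trans (hBm σ σ' hs)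
    refine h _ (by simp [h1]) ?_ ?_
    · rw [List.pairwise_append]
      exact ⟨h2, by simp, by simpa using h4⟩
    · intro S hS
      rcases List.mem_append.1 hS with hS | hS
      · exact ⟨(h3 S hS).1, (h3 S hS).2.1, h4 S hS⟩
      · rw [List.mem_singleton] at hS
        subst hS
        refine ⟨?_, hBu σ hσ, subset_rfl⟩
        obtain ⟨S, hS⟩ := List.exists_mem_of_ne_nil τ (by rintro rfl; simp at h1)
        exact (h3 S hS).1.mono (h4 S hS)

lemma transfer_dif {M N : ℕ} (hJc : ∀ σ, Good M σ → σ.length = N + 2 → dif J σ = 0)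
    (j : ℕ) (ψ : List (Finset G) → 𝔽) (σ : List (ℕ × G)) (hσ : Good M σ)
    (hl : σ.length = N + 2 + j) :
    transfer J Big (j + 1) (dif ψ) σ = (-1) ^ (j + 1) * dif (transfer J Big j ψ) σ := by
  induction j generalizing ψ σ with
  | zero =>
    rw [transfer_succ]
    have h1 : (transfer J Big 0 fun τ => dif ψ (τ ++ [Big σ])) =
        fun σ' => ψ [Big σ] * J σ' - transfer J Big 0 ψ σ' := by
      funext σ'
      simp only [transfer_zero, List.cons_append, List.nil_append, dif_cons, dif_nil]
      ring
    rw [h1, dif_sub_apply, dif_mul_apply, hJc σ hσ hl]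
    ring
  | succ j ih =>
    rw [transfer_succ]
    have h1 : (transfer J Big (j + 1) fun τ => dif ψ (τ ++ [Big σ])) =
        transfer J Big (j + 1) (dif fun τ => ψ (τ ++ [Big σ])) +
          ((-1 : 𝔽) ^ (j + 2)) • transfer J Big (j + 1) ψ := by
      rw [← map_smul, ← map_add]
      refine transfer_congr _ fun τ hτ => ?_
      rw [dif_append]
      simp [dif_cons, hτ]
    have h2 : dif (transfer J Big (j + 1) (dif fun τ => ψ (τ ++ [Big σ]))) σ = 0 := by
      rw [dif_congr (ψ := fun σ' => (-1) ^ (j + 1) *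
        dif (transfer J Big j fun τ => ψ (τ ++ [Big σ])) σ')]
      · rw [dif_mul_apply]
        have := dif_dif (transfer J Big j fun τ => ψ (τ ++ [Big σ])) σ
        rw [show dif (fun σ' => dif (transfer J Big j fun τ => ψ (τ ++ [Big σ])) σ') σ = 0 from this,
          mul_zero]
      · intro σ' hs hl'
        exact ih _ _ (hσ.sublist hs) (by omega)
    rw [h1, map_add, Pi.add_apply, h2, zero_add, map_smul]
    rfl

variable {ι : Type*} [Fintype ι] {q : ℕ} [CharP 𝔽 q] [Module (ZMod q) G]

theorem chain_transfer_eq_zero (hq : q.Prime) (c : ι → 𝔽) (s : ι → G)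
    (hcs : ∀ α : G →+ ZMod q, α ≠ 0 → ∑ i, c i * ZMod.castHom (dvd_refl q) 𝔽 (α (s i)) ≠ 0)
    {M N : ℕ} (hM : M = N + Fintype.card G)
    (hJ : ∀ g σ, J (listAct vertAct g σ) = J σ)
    (hJc : ∀ σ, Good M σ → σ.length = N + 2 → dif J σ = 0)
    (hB : ∀ g σ, Big (listAct vertAct g σ) = setAct g (Big σ))
    (hBm : ∀ σ τ, τ.Sublist σ → Big τ ⊆ Big σ)
    (hBu : ∀ σ, Good M σ → Big σ ≠ Finset.univ)
    (hBJ : ∀ σ, Good M σ → σ.length = N + 1 → J σ ≠ 0 → (Big σ).Nonempty)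
    (n i : ℕ) (hi : i + n + 1 = Fintype.card G) (φ : List (Finset G) → 𝔽) (hφ : Normal φ)
    (hdφ : ∀ τ, Flag (i + 2) τ → dif φ τ = 0)
    (hyφ : ∀ τ, Flag (i + 1) τ → opY q c s (listAct setAct) (N + i + 1) φ τ = 0) :
    chain q c s (N + i) (transfer J Big i φ) = 0 := by
  have hG : ∀ g : G, q • g = 0 := fun g => by
    rw [← Nat.cast_smul_eq_nsmul (ZMod q), CharP.cast_eq_zero, zero_smul]
  have key : ∀ χ : List (Finset G) → 𝔽, Normal χ → (∀ τ, Flag (i + 1) τ → χ τ = 0) →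
      chain q c s (N + i) (transfer J Big i χ) = 0 := by
    intro χ h1 h2
    refine chain_eq_zero q c s _ _ fun σ hσ hl => ?_
    refine transfer_eq_zero hBm hBu hBJ i χ σ (hσ.mono (by omega)) (by omega) fun τ h3 h4 h5 => ?_
    rcases pairwise_ssubset_or_adjacent τ h4 with h6 | ⟨l₁, a, l₂, rfl⟩
    · exact h2 τ ⟨h3, h6, fun S hS => ⟨(h5 S hS).1, (h5 S hS).2.1⟩⟩
    · exact h1 l₁ a l₂
  induction n generalizing i φ with
  | zero =>
    refine key φ hφ fun τ hτ => ?_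
    have := hτ.lt
    omega
  | succ n ih =>
    obtain ⟨ψ, hψ0, hψ⟩ := exists_eq_opY hq c s hcs (a := listAct setAct) isAct_setAct.listAct
      (Flag (i + 1)) Flag.act Flag.exists_ne (N + i + 1) φ hyφ
    rw [show N + i + 1 + 1 = N + i + 2 by ring, opY_add_two] at hψ
    have hψn : Normal ψ := normal_of_flag hψ0
    have hyn : Normal (opY q c s (listAct setAct) (N + i) ψ) := by
      refine normal_of_flag (n := i + 1) fun τ hτ => ?_
      refine opY_eq_zero_of q c s (a := listAct setAct) (fun τ => ¬ Flag (i + 1) τ) ?_ _ hψ0 τ hτ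
      intro g τ hτ h
      apply hτ
      have := Flag.act (-g) _ h
      rwa [← isAct_setAct.listAct.add, neg_add_cancel, isAct_setAct.listAct.zero] at this
    have h1 : chain q c s (N + i) (transfer J Big i φ) =
        chain q c s (N + i) (transfer J Big i (opY q c s (listAct setAct) (N + i) ψ)) := by
      rw [← sub_eq_zero, ← map_sub, ← map_sub]
      refine key _ (fun l₁ a l₂ => ?_) fun τ hτ => ?_
      · rw [Pi.sub_apply, hφ, hyn, sub_zero]
      · rw [Pi.sub_apply, hψ τ hτ, sub_self]
    have h2 : transfer J Big i (opY q c s (listAct setAct) (N + i) ψ) =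
        opY q c s (listAct vertAct) (N + i) (transfer J Big i ψ) :=
      opY_comm q c s _ (fun k φ => funext fun σ => transfer_act hJ hB i (s k) φ σ) _ _
    rw [h1, h2, ← chain_dif c s hq hG]
    have h3 : chain q c s (N + i + 1) (dif (transfer J Big i ψ)) =
        chain q c s (N + (i + 1)) ((-1 : 𝔽) ^ (i + 1) • transfer J Big (i + 1) (dif ψ)) := by
      refine chain_congr q c s _ fun σ hσ hl => ?_
      rw [Pi.smul_apply, transfer_dif hJc i ψ σ (hσ.mono (by omega)) (by omega), smul_eq_mul,
        ← mul_assoc, ← mul_pow]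
      simp
    rw [h3, map_smul, smul_eq_zero]
    right
    refine ih (i + 1) (by omega) (dif ψ) (dif_adjacent ψ hψn) (fun τ _ => dif_dif ψ τ) ?_ ?_
    · intro τ hτ
      rw [show N + (i + 1) + 1 = N + i + 2 by ring, opY_add_two, ← opY_dif]
      rw [dif_congr (ψ := φ) τ, hdφ τ hτ]
      intro t ht hl
      exact (hψ t (hτ.sublist ht hl)).symm
    · intro χ h1 h2
      refine chain_eq_zero q c s _ _ fun σ hσ hl => ?_
      refine transfer_eq_zero hBm hBu hBJ (i + 1) χ σ (hσ.mono (by omega)) (by omega)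
        fun τ h3 h4 h5 => ?_
      rcases pairwise_ssubset_or_adjacent τ h4 with h6 | ⟨l₁, a, l₂, rfl⟩
      · exact h2 τ ⟨h3, h6, fun S hS => ⟨(h5 S hS).1, (h5 S hS).2.1⟩⟩
      · exact h1 l₁ a l₂

/-- If the supports of the cocycle always have a nonempty set of overfull labels, then the
cocycle vanishes on the chain. -/
theorem chain_eq_zero_of_big (hq : q.Prime) (c : ι → 𝔽) (s : ι → G)
    (hcs : ∀ α : G →+ ZMod q, α ≠ 0 → ∑ i, c i * ZMod.castHom (dvd_refl q) 𝔽 (α (s i)) ≠ 0)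
    {M N : ℕ} (hM : M = N + Fintype.card G)
    (hJ : ∀ g σ, J (listAct vertAct g σ) = J σ)
    (hJc : ∀ σ, Good M σ → σ.length = N + 2 → dif J σ = 0)
    (hB : ∀ g σ, Big (listAct vertAct g σ) = setAct g (Big σ))
    (hBm : ∀ σ τ, τ.Sublist σ → Big τ ⊆ Big σ)
    (hBu : ∀ σ, Good M σ → Big σ ≠ Finset.univ)
    (hBJ : ∀ σ, Good M σ → σ.length = N + 1 → J σ ≠ 0 → (Big σ).Nonempty) :
    chain q c s N J = 0 := by
  have hpos : 0 < Fintype.card G := Fintype.card_pos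
  set φ : List (Finset G) → 𝔽 := fun τ => if τ.length = 1 then 1 else 0 with hφ
  have h := chain_transfer_eq_zero hq c s hcs hM hJ hJc hB hBm hBu hBJ (Fintype.card G - 1) 0
    (by omega) φ ?_ ?_ ?_
  · have h1 : transfer J Big 0 φ = J := funext fun σ => by simp [transfer_zero, hφ]
    rwa [h1] at h
  · intro l₁ a l₂
    simp [hφ]
    omega
  · rintro τ ⟨hτ, -⟩
    match τ, hτ with
    | [S, T], _ => simp [dif_cons, hφ]
  · intro τ _
    rw [opY_of_invariant hq c s (a := listAct setAct) φ (fun g τ => by simp [hφ]), Pi.zero_apply]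

end Transfer

section Diagonal

variable {𝔽 : Type*} [Field 𝔽] {G : Type*} [AddCommGroup G] {X Y ι : Type*} [Fintype ι]

/-- On functions invariant under the diagonal action, acting on the second factor amounts to
acting on the first factor by the inverse. -/
lemma opY_diagonal (q : ℕ) (c : ι → 𝔽) (s : ι → G) {a : G → X → X} {b : G → Y → Y}
    (ha : IsAct a) (hb : IsAct b) (Φ : X × Y → 𝔽) (hΦ : ∀ g x y, Φ (a g x, b g y) = Φ (x, y))
    (j : ℕ) :
    opY q c s (fun g p => (p.1, b g p.2)) j Φ =
      opY q c (fun i => -s i) (fun g p => (a g p.1, p.2)) j Φ := by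
  have hshift : ∀ Ψ : X × Y → 𝔽, (∀ g x y, Ψ (a g x, b g y) = Ψ (x, y)) →
      ∀ g x y, Ψ (x, b g y) = Ψ (a (-g) x, y) := fun Ψ hΨ g x y => by
    rw [← hΨ g (a (-g) x) y, ← ha.add, add_neg_cancel, ha.zero]
  have h1 : ∀ Ψ : X × Y → 𝔽, (∀ g x y, Ψ (a g x, b g y) = Ψ (x, y)) →
      opX c s (fun g p => (p.1, b g p.2)) Ψ =
        opX c (fun i => -s i) (fun g p => (a g p.1, p.2)) Ψ := by
    intro Ψ hΨ
    ext ⟨x, y⟩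
    simp only [opX_apply, hshift Ψ hΨ]
  have h2 : ∀ Ψ : X × Y → 𝔽, (∀ g x y, Ψ (a g x, b g y) = Ψ (x, y)) →
      ∀ g x y, opX c s (fun g p => (p.1, b g p.2)) Ψ (a g x, b g y) =
        opX c s (fun g p => (p.1, b g p.2)) Ψ (x, y) := by
    intro Ψ hΨ g x y
    simp only [opX_apply, hΨ, ← hb.add]
    refine Finset.sum_congr rfl fun i _ => ?_
    rw [add_comm (s i), hb.add, hΨ]
  have h3 : ∀ n : ℕ, ∀ Ψ : X × Y → 𝔽, (∀ g x y, Ψ (a g x, b g y) = Ψ (x, y)) →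
      (opX c s (fun g p => (p.1, b g p.2)) ^ n) Ψ =
        (opX c (fun i => -s i) (fun g p => (a g p.1, p.2)) ^ n) Ψ := by
    intro n
    induction n with
    | zero => intro Ψ _; rfl
    | succ n ih =>
      intro Ψ hΨ
      rw [pow_succ, pow_succ, Module.End.mul_apply, Module.End.mul_apply, ← h1 Ψ hΨ,
        ih _ (h2 Ψ hΨ)]
  unfold opY
  split_ifs
  · exact h1 Φ hΦ
  · exact h3 _ Φ hΦ

end Diagonal

section Descent

variable {𝔽 : Type*} [Field 𝔽] {G : Type*} [AddCommGroup G] {ι B : Type*} [Fintype ι]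
  {V : Type*} [AddCommGroup V] [Module ℝ V] {N : ℕ} {e : Module.Basis (Fin N) ℝ V}
  {F : ℕ × G → V} {b : B → V} {a : G → B → B} {ρ : G → V →ₗ[ℝ] V}

lemma chain_opY_eq (q : ℕ) (c : ι → 𝔽) (s : ι → G) (ha : IsAct a)
    (Φ : List B → List (ℕ × G) → 𝔽)
    (hΦ : ∀ g τ σ, Φ (listAct a g τ) (listAct vertAct g σ) = Φ τ σ) (j : ℕ) (τ : List B) :
    chain q c s j (opY q c s (listAct vertAct) j (Φ τ)) =
      opY q c (fun i => -s i) (listAct a) j (fun τ => chain q c s j (Φ τ)) τ := by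
  let L₁ : (List B × List (ℕ × G) → 𝔽) →ₗ[𝔽] (List (ℕ × G) → 𝔽) :=
    LinearMap.funLeft 𝔽 𝔽 (fun σ => (τ, σ))
  let L₂ : (List B × List (ℕ × G) → 𝔽) →ₗ[𝔽] (List B → 𝔽) :=
    LinearMap.pi fun τ => (chain q c s j).comp (LinearMap.funLeft 𝔽 𝔽 (fun σ => (τ, σ)))
  have h1 := opY_comm (a := fun g (p : List B × List (ℕ × G)) => (p.1, listAct vertAct g p.2))
    (a' := listAct vertAct) q c s L₁ (fun _ _ => rfl) j (fun p => Φ p.1 p.2)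
  have h2 := opY_comm (a := fun g (p : List B × List (ℕ × G)) => (listAct a g p.1, p.2))
    (a' := listAct a) q c (fun i => -s i) L₂ (fun _ _ => rfl) j (fun p => Φ p.1 p.2)
  have h3 := opY_diagonal q c s ha.listAct isAct_vertAct.listAct
    (fun p : List B × List (ℕ × G) => Φ p.1 p.2) hΦ j
  have h4 : L₁ (fun p => Φ p.1 p.2) = Φ τ := rfl
  have h5 : L₂ (fun p => Φ p.1 p.2) = fun τ => chain q c s j (Φ τ) := rfl
  rw [← h4, ← h1, ← h5, ← h2, ← h3]
  rfl

variable {q : ℕ} [CharP 𝔽 q] [Module (ZMod q) G]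

/-- If the intersection cochain of generic vertices vanished on the chain, then its value at a
single vertex would be a coboundary up to the image of the periodic operator. -/
theorem exists_dif_add_opY (hq : q.Prime) (c : ι → 𝔽) (s : ι → G)
    (hcs : ∀ α : G →+ ZMod q, α ≠ 0 → ∑ i, c i * ZMod.castHom (dvd_refl q) 𝔽 (α (s i)) ≠ 0)
    (hN : 0 < N) {M : ℕ} (hM : N + 1 ≤ M) (ha : IsAct a)
    (hρ : ∀ g, ρ g ^ q = 1) (hF : ∀ g x, F (vertAct g x) = ρ g (F x))
    (hb : ∀ g x, b (a g x) = ρ g (b x))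
    (P : List B → Prop) (hPs : ∀ τ τ', P τ → τ'.Sublist τ → P τ')
    (hPa : ∀ g τ, P τ → P (listAct a g τ))
    (hPf : ∀ τ, P τ → τ ≠ [] → ∃ g, listAct a g τ ≠ τ)
    (hgen : ∀ σ τ, Good M σ → P τ → σ.length + τ.length = N →
      LinearIndependent ℝ (σ.map F ++ τ.map b).get)
    (h0 : chain q c s N (fun σ => inter 𝔽 e (σ.map F)) = 0) (n j : ℕ) (hj : j + n = N) :
    ∃ u v : List B → 𝔽, ∀ τ, P τ → τ.length = n →
      chain q c s j (fun σ => inter 𝔽 e (σ.map F ++ τ.map b)) =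
        dif u τ + opY q c (fun i => -s i) (listAct a) (j + 1) v τ := by
  have hG : ∀ g : G, q • g = 0 := fun g => by
    rw [← Nat.cast_smul_eq_nsmul (ZMod q), CharP.cast_eq_zero, zero_smul]
  have hcs' : ∀ α : G →+ ZMod q, α ≠ 0 →
      ∑ i, c i * ZMod.castHom (dvd_refl q) 𝔽 (α (-s i)) ≠ 0 := by
    intro α hα
    simpa using hcs α hα
  set Φ : List B → List (ℕ × G) → 𝔽 := fun τ σ => inter 𝔽 e (σ.map F ++ τ.map b) with hΦdef
  have hΦ : ∀ g τ σ, Φ (listAct a g τ) (listAct vertAct g σ) = Φ τ σ := by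
    intro g τ σ
    rw [hΦdef]
    dsimp only
    rw [← inter_map e hq (ρ g) (hρ g) (σ.map F ++ τ.map b)]
    congr 1
    simp [listAct, Function.comp_def, hF, hb]
  induction n generalizing j with
  | zero =>
    obtain rfl : j = N := by omega
    refine ⟨0, 0, fun τ _ hl => ?_⟩
    rw [List.length_eq_zero_iff] at hl
    subst hl
    simpa [hΦdef] using h0
  | succ n ih =>
    obtain ⟨u, v, huv⟩ := ih (j + 1) (by omega)
    set ψ : List B → 𝔽 := fun τ => chain q c s j (Φ τ) with hψ
    set y := opY q c (fun i => -s i) (listAct a) with hy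
    have key : ∀ τ, P τ → τ.length = n + 1 → y j ψ τ = y j ((-(-1 : 𝔽) ^ j) • dif v) τ := by
      intro τ hτ hl
      rw [hψ, hy, ← chain_opY_eq q c s ha Φ hΦ, ← chain_dif c s hq hG]
      have h1 : chain q c s (j + 1) (dif (Φ τ)) = chain q c s (j + 1)
          ((-(-1 : 𝔽) ^ j) • fun σ => dif (fun τ' => Φ τ' σ) τ) := by
        refine chain_congr q c s _ fun σ hσ hlσ => ?_
        have h2 := inter_cocycle (𝔽 := 𝔽) e hN (σ.map F ++ τ.map b) (by simp; omega) (by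
          intro t ht htl
          obtain ⟨t₁, t₂, rfl, ht₁, ht₂⟩ := List.sublist_append_iff.1 ht
          obtain ⟨σ', hσ', rfl⟩ := List.sublist_map_iff.1 ht₁
          obtain ⟨τ', hτ', rfl⟩ := List.sublist_map_iff.1 ht₂
          exact hgen σ' τ' ((hσ.sublist hσ').mono (by omega)) (hPs _ _ hτ hτ') (by simpa using htl))
        rw [dif_append, dif_map, dif_map, List.length_map, hlσ] at h2
        rw [Pi.smul_apply, smul_eq_mul, hΦdef]
        rw [eq_neg_of_add_eq_zero_left h2]
        ring
      rw [h1, map_smul, ← dif_linear, map_smul, Pi.smul_apply]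
      congr 1
      rw [dif_congr (ψ := fun τ' => dif u τ' + y (j + 1 + 1) v τ') τ (fun t ht htl =>
        huv t (hPs _ _ hτ ht) (by omega)), dif_add_apply]
      have h3 : dif (fun t => dif u t) τ = 0 := dif_dif u τ
      have h4 : dif (fun t => y (j + 1 + 1) v t) τ = y j (dif v) τ := by
        rw [hy, ← opY_add_two _ _ _ _ j]
        exact congrFun (opY_dif q c (fun i => -s i) a (j + 2) v) τ
      rw [h3, h4, zero_add]
    obtain ⟨w, -, hw⟩ := exists_eq_opY hq c (fun i => -s i) hcs' (a := listAct a) ha.listAct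
      (fun τ => P τ ∧ τ.length = n + 1) (fun g τ h => ⟨hPa g τ h.1, by simpa using h.2⟩)
      (fun τ h => hPf τ h.1 (by rintro rfl; simp at h)) j (ψ - (-(-1 : 𝔽) ^ j) • dif v) (by
        rintro τ ⟨h1, h2⟩
        rw [map_sub, Pi.sub_apply, sub_eq_zero]
        exact key τ h1 h2)
    refine ⟨(-(-1 : 𝔽) ^ j) • v, w, fun τ h1 h2 => ?_⟩
    have := hw τ ⟨h1, h2⟩
    rw [Pi.sub_apply, sub_eq_iff_eq_add'] at this
    rw [map_smul]
    exact this

/-- The intersection cochain of generic vertices does not vanish on the chain, provided that there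
is an invariant cycle on which it does not vanish. -/
theorem chain_ne_zero (hq : q.Prime) (c : ι → 𝔽) (s : ι → G)
    (hcs : ∀ α : G →+ ZMod q, α ≠ 0 → ∑ i, c i * ZMod.castHom (dvd_refl q) 𝔽 (α (s i)) ≠ 0)
    (hN : 0 < N) {M : ℕ} (hM : N + 1 ≤ M) (ha : IsAct a)
    (hρ : ∀ g, ρ g ^ q = 1) (hF : ∀ g x, F (vertAct g x) = ρ g (F x))
    (hb : ∀ g x, b (a g x) = ρ g (b x))
    (P : List B → Prop) (hPs : ∀ τ τ', P τ → τ'.Sublist τ → P τ')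
    (hPa : ∀ g τ, P τ → P (listAct a g τ))
    (hPf : ∀ τ, P τ → τ ≠ [] → ∃ g, listAct a g τ ≠ τ)
    (hgen : ∀ σ τ, Good M σ → P τ → σ.length + τ.length = N →
      LinearIndependent ℝ (σ.map F ++ τ.map b).get)
    (ε : (List B → 𝔽) →ₗ[𝔽] 𝔽)
    (hεP : ∀ φ ψ : List B → 𝔽, (∀ τ, P τ → τ.length = N → φ τ = ψ τ) → ε φ = ε ψ)
    (hεd : ∀ u, ε (dif u) = 0) (hεa : ∀ g φ, ε (tr 𝔽 (listAct a) g φ) = ε φ)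
    (hε : ε (fun τ => inter 𝔽 e (F (0, 0) :: τ.map b)) ≠ 0) :
    chain q c s N (fun σ => inter 𝔽 e (σ.map F)) ≠ 0 := by
  intro h0
  obtain ⟨u, v, h⟩ := exists_dif_add_opY hq c s hcs hN hM ha hρ hF hb P hPs hPa hPf hgen h0 N 0
    (zero_add N)
  apply hε
  rw [hεP (fun τ => inter 𝔽 e (F (0, 0) :: τ.map b)) (dif u + opY q c (fun i => -s i) (listAct a) (0 + 1) v) h, map_add, hεd, zero_add]
  exact opY_invariant hq c _ ε (fun i φ => hεa _ φ) _ _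

end Descent

section Space

variable (E : ℕ) (G : Type*) [AddCommGroup G]

/-- The target space of the test map: one coordinate for each coordinate index and each nonzero
label, representing functions of labels modulo constants. -/
abbrev Space := Fin E × {s : G // s ≠ 0} → ℝ

variable {E G}

/-- The quotient map modulo functions that are constant on blocks. -/
def toSpace : (Fin E × G → ℝ) →ₗ[ℝ] Space E G :=
  LinearMap.pi fun x => LinearMap.proj (R := ℝ) (φ := fun _ : Fin E × G => ℝ) (x.1, x.2.1) -
    LinearMap.proj (R := ℝ) (φ := fun _ : Fin E × G => ℝ) (x.1, 0)

lemma toSpace_apply (w : Fin E × G → ℝ) (x : Fin E × {s : G // s ≠ 0}) :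
    toSpace w x = w (x.1, x.2) - w (x.1, 0) := rfl

open Classical in
/-- The representative vanishing at the label zero. -/
noncomputable def lift : Space E G →ₗ[ℝ] (Fin E × G → ℝ) :=
  LinearMap.pi fun x => if h : x.2 ≠ 0 then LinearMap.proj (x.1, ⟨x.2, h⟩) else 0

lemma lift_zero_right (v : Space E G) (e : Fin E) : lift v (e, 0) = 0 := by simp [lift]

lemma lift_of_ne (v : Space E G) (e : Fin E) {s : G} (h : s ≠ 0) :
    lift v (e, s) = v (e, ⟨s, h⟩) := by simp [lift, h]

lemma toSpace_lift (v : Space E G) : toSpace (lift v) = v := by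
  funext ⟨e, s, hs⟩
  rw [toSpace_apply, lift_zero_right, sub_zero, lift_of_ne v e hs]

lemma lift_toSpace (w : Fin E × G → ℝ) (e : Fin E) (s : G) :
    lift (toSpace w) (e, s) = w (e, s) - w (e, 0) := by
  by_cases h : s = 0
  · subst h
    rw [lift_zero_right, sub_self]
  · rw [lift_of_ne _ _ h, toSpace_apply]

lemma lift_toSpace_sub (w : Fin E × G → ℝ) (e : Fin E) (s s' : G) :
    lift (toSpace w) (e, s) - lift (toSpace w) (e, s') = w (e, s) - w (e, s') := by
  rw [lift_toSpace, lift_toSpace]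
  ring

lemma toSpace_congr {w w' : Fin E × G → ℝ} (h : ∀ e s, w (e, s) - w (e, 0) = w' (e, s) - w' (e, 0)) :
    toSpace w = toSpace w' :=
  funext fun x => h x.1 x.2

/-- Translation of the labels on the level of representatives. -/
def shift (g : G) : (Fin E × G → ℝ) →ₗ[ℝ] (Fin E × G → ℝ) :=
  LinearMap.funLeft ℝ ℝ fun x => (x.1, x.2 - g)

lemma shift_apply (g : G) (w : Fin E × G → ℝ) (e : Fin E) (s : G) :
    shift g w (e, s) = w (e, s - g) := rfl

lemma shift_shift (g h : G) (w : Fin E × G → ℝ) : shift g (shift h w) = shift (g + h) w := by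
  funext ⟨e, s⟩
  simp only [shift_apply, sub_sub]

lemma shift_zero (w : Fin E × G → ℝ) : shift (0 : G) w = w := by
  funext ⟨e, s⟩
  simp only [shift_apply, sub_zero]

/-- The representation of the group of labels on the target space. -/
noncomputable def rep (g : G) : Space E G →ₗ[ℝ] Space E G := toSpace ∘ₗ shift g ∘ₗ lift

lemma rep_toSpace (g : G) (w : Fin E × G → ℝ) : rep g (toSpace w) = toSpace (shift g w) := by
  change toSpace (shift g (lift (toSpace w))) = _
  refine toSpace_congr fun e s => ?_
  rw [shift_apply, shift_apply, lift_toSpace_sub]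
  rfl

lemma rep_add (g h : G) (v : Space E G) : rep (g + h) v = rep g (rep h v) := by
  rw [← toSpace_lift v, rep_toSpace, rep_toSpace, rep_toSpace, shift_shift]

lemma rep_zero (v : Space E G) : rep (0 : G) v = v := by
  rw [← toSpace_lift v, rep_toSpace, shift_zero]

lemma rep_pow_apply (g : G) (n : ℕ) (v : Space E G) : (rep g ^ n) v = rep (n • g) v := by
  induction n with
  | zero => simp [rep_zero]
  | succ n ih => rw [pow_succ', Module.End.mul_apply, ih, succ_nsmul', rep_add]

lemma rep_pow {q : ℕ} (hG : ∀ g : G, q • g = 0) (g : G) : (rep g : Space E G →ₗ[ℝ] _) ^ q = 1 := by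
  ext1 v
  simp [rep_pow_apply, hG, rep_zero]

variable [DecidableEq G]

/-- The class of the indicator function of a set of labels in a block. -/
def ind (x : Fin E × Finset G) : Space E G :=
  toSpace fun y => if y.1 = x.1 ∧ y.2 ∈ x.2 then 1 else 0

/-- The translation action on indices of indicators. -/
def blockAct (g : G) (x : Fin E × Finset G) : Fin E × Finset G := (x.1, setAct g x.2)

lemma isAct_blockAct : IsAct (blockAct : G → Fin E × Finset G → Fin E × Finset G) :=
  ⟨fun x => Prod.ext rfl (isAct_setAct.zero x.2), fun g h x => Prod.ext rfl (isAct_setAct.add g h x.2)⟩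

lemma ind_blockAct (g : G) (x : Fin E × Finset G) : ind (blockAct g x) = rep g (ind x) := by
  rw [ind, ind, rep_toSpace]
  congr 1
  funext ⟨e, s⟩
  simp [blockAct, mem_setAct, shift_apply]

lemma ind_add_ind (e : Fin E) (S T : Finset G) :
    ind (e, S) + ind (e, T) = ind (e, S ∪ T) + ind (e, S ∩ T) := by
  simp only [ind, ← map_add]
  congr 1
  funext ⟨e', s⟩
  by_cases h1 : e' = e <;> by_cases h2 : s ∈ S <;> by_cases h3 : s ∈ T <;> simp [h1, h2, h3]

lemma ind_empty (e : Fin E) : ind (e, (∅ : Finset G)) = 0 := by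
  rw [ind, ← map_zero toSpace]
  exact toSpace_congr fun e s => by simp

variable [Fintype G]

lemma ind_univ (e : Fin E) : ind (e, (Finset.univ : Finset G)) = 0 := by
  rw [ind, ← map_zero toSpace]
  exact toSpace_congr fun e s => by simp

/-- Lists of block indices forming flags of nonempty proper sets in each block. -/
def Flags (τ : List (Fin E × Finset G)) : Prop :=
  (∀ x ∈ τ, x.2.Nonempty ∧ x.2 ≠ Finset.univ) ∧ τ.Pairwise fun x y => x.1 ≠ y.1 ∨ x.2 ⊂ y.2

lemma Flags.sublist {τ τ' : List (Fin E × Finset G)} (h : Flags τ) (hs : τ'.Sublist τ) : Flags τ' :=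
  ⟨fun x hx => h.1 x (hs.subset hx), h.2.sublist hs⟩

lemma Flags.act (g : G) {τ : List (Fin E × Finset G)} (h : Flags τ) :
    Flags (listAct blockAct g τ) := by
  refine ⟨fun x hx => ?_, List.pairwise_map.2 (h.2.imp fun hxy => hxy.imp id setAct_ssubset)⟩
  obtain ⟨y, hy, rfl⟩ := List.mem_map.1 hx
  exact ⟨setAct_nonempty.2 (h.1 y hy).1, setAct_ne_univ (h.1 y hy).2⟩

lemma Flags.exists_ne {τ : List (Fin E × Finset G)} (h : Flags τ) (hτ : τ ≠ []) :
    ∃ g, listAct blockAct g τ ≠ τ := by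
  cases τ with
  | nil => exact absurd rfl hτ
  | cons x τ =>
    obtain ⟨g, hg⟩ := exists_setAct_ne (h.1 x (by simp)).1 (h.1 x (by simp)).2
    refine ⟨g, fun h => hg ?_⟩
    simp only [listAct, List.map_cons, List.cons.injEq] at h
    exact congrArg Prod.snd h.1

lemma linearIndependent_cons {V : Type*} [AddCommGroup V] [Module ℝ V] {v : V} {l : List V}
    (hl : LinearIndependent ℝ l.get) (hv : v ∉ Submodule.span ℝ {x | x ∈ l}) :
    LinearIndependent ℝ (v :: l).get := by
  have h1 : (v :: l).get = Fin.cons v l.get := by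
    funext i
    refine Fin.cases rfl (fun j => rfl) i
  rw [h1]
  refine linearIndependent_finCons.2 ⟨hl, ?_⟩
  have h2 : Set.range l.get = {x | x ∈ l} := by
    ext x
    simp [List.mem_iff_get]
  rwa [h2]

/-- The difference of the values at two labels of a block. -/
noncomputable def coordDiff (e : Fin E) (s s' : G) : Space E G →ₗ[ℝ] ℝ :=
  (LinearMap.proj (R := ℝ) (φ := fun _ : Fin E × G => ℝ) (e, s) -
    LinearMap.proj (R := ℝ) (φ := fun _ : Fin E × G => ℝ) (e, s')) ∘ₗ lift

lemma coordDiff_apply (e : Fin E) (s s' : G) (v : Space E G) :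
    coordDiff e s s' v = lift v (e, s) - lift v (e, s') := rfl

lemma coordDiff_toSpace (e : Fin E) (s s' : G) (w : Fin E × G → ℝ) :
    coordDiff e s s' (toSpace w) = w (e, s) - w (e, s') := by
  rw [coordDiff_apply, lift_toSpace_sub]

lemma Flags.linearIndependent {τ : List (Fin E × Finset G)} (h : Flags τ) :
    LinearIndependent ℝ (τ.map ind).get := by
  induction τ with
  | nil => exact linearIndependent_empty_type (ι := Fin 0)
  | cons x τ ih =>
    obtain ⟨e, S⟩ := x
    rw [List.map_cons]
    refine linearIndependent_cons (ih (h.sublist (List.sublist_cons_self _ _))) fun hspan => ?_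
    have hS := h.1 (e, S) (by simp)
    have hp := (List.pairwise_cons.1 h.2).1
    obtain ⟨s, hs⟩ := hS.1
    have hs' : ∃ s', s' ∉ S ∧ ∀ y ∈ τ, y.1 = e → s' ∈ y.2 := by
      by_cases hex : ∃ y ∈ τ, y.1 = e
      · -- the first later set of the block is the smallest one
        obtain ⟨y, hy, hmin⟩ : ∃ y ∈ τ.toFinset.filter (fun y => y.1 = e),
            ∀ z ∈ τ.toFinset.filter (fun y => y.1 = e), y.2.card ≤ z.2.card := by
          refine Finset.exists_min_image _ _ ?_
          obtain ⟨y, h1, h2⟩ := hex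
          exact ⟨y, by simp [h1, h2]⟩
        simp only [Finset.mem_filter, List.mem_toFinset] at hy hmin
        have h1 : S ⊂ y.2 := (hp y hy.1).resolve_left (by simp [hy.2])
        obtain ⟨s', h2, h3⟩ := Finset.exists_of_ssubset h1
        refine ⟨s', h3, fun z hz hze => ?_⟩
        by_cases hyz : y = z
        · rwa [← hyz]
        · have hR := (h.sublist (List.sublist_cons_self _ _)).2
          have h4 : y.2 ⊆ z.2 ∨ z.2 ⊂ y.2 := by
            have : Std.Symm (fun x y : Fin E × Finset G => x.1 ≠ y.1 ∨ (x.2 ⊆ y.2 ∨ y.2 ⊆ x.2)) :=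
              ⟨fun _ _ hxy => hxy.imp Ne.symm Or.symm⟩
            have := List.Pairwise.forall_of_forall
              (R := fun x y : Fin E × Finset G => x.1 ≠ y.1 ∨ (x.2 ⊆ y.2 ∨ y.2 ⊆ x.2))
              (l := τ)
              (fun x _ => Or.inr (Or.inl subset_rfl))
              (hR.imp fun hxy => hxy.imp id fun h => Or.inl h.subset) hy.1 hz
            rcases this with h5 | h5 | h5
            · exact absurd (hy.2.trans hze.symm) h5
            · exact Or.inl h5
            · by_cases h6 : z.2 = y.2
              · exact Or.inl h6.symm.subset
              · exact Or.inr (h5.ssubset_of_ne h6)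
          rcases h4 with h4 | h4
          · exact h4 h2
          · have := Finset.card_lt_card h4
            have := hmin z ⟨hz, hze⟩
            omega
      · push Not at hex
        have : ∃ s', s' ∉ S := by
          by_contra hcon
          push Not at hcon
          exact hS.2 (Finset.eq_univ_iff_forall.2 hcon)
        obtain ⟨s', hs'⟩ := this
        exact ⟨s', hs', fun y hy hye => absurd hye (hex y hy)⟩
    obtain ⟨s', hs', hall⟩ := hs'
    have hker : Submodule.span ℝ {v | v ∈ τ.map ind} ≤ LinearMap.ker (coordDiff e s s') := by
      rw [Submodule.span_le]
      intro v hv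
      obtain ⟨y, hy, rfl⟩ := List.mem_map.1 hv
      rw [SetLike.mem_coe, LinearMap.mem_ker, ind, coordDiff_toSpace]
      by_cases hye : e = y.1
      · have h1 := hall y hy hye.symm
        have h2 : s ∈ y.2 := ((hp y hy).resolve_left (by simp [hye])).subset hs
        simp [hye, h1, h2]
      · simp [hye]
    have := hker hspan
    rw [LinearMap.mem_ker, ind, coordDiff_toSpace] at this
    simp [hs, hs'] at this

end Space

section FlagCycle

variable {G : Type*} [AddCommGroup G] [DecidableEq G] [Fintype G] {E R N : ℕ}

/-- The initial segments of an enumeration of the labels. -/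
def flagSet (π : Fin (R + 1) ≃ G) (j : ℕ) : Finset G :=
  Finset.univ.filter fun s => (π.symm s : ℕ) ≤ j

lemma mem_flagSet {π : Fin (R + 1) ≃ G} {j : ℕ} {s : G} : s ∈ flagSet π j ↔ (π.symm s : ℕ) ≤ j := by
  simp [flagSet]

lemma flagSet_nonempty (π : Fin (R + 1) ≃ G) (j : ℕ) : (flagSet π j).Nonempty :=
  ⟨π 0, by simp [mem_flagSet]⟩

lemma flagSet_ne_univ (π : Fin (R + 1) ≃ G) {j : ℕ} (hj : j < R) : flagSet π j ≠ Finset.univ := by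
  intro h
  have h1 : π (Fin.last R) ∈ flagSet π j := by simp [h]
  rw [mem_flagSet, Equiv.symm_apply_apply, Fin.val_last] at h1
  omega

lemma flagSet_eq_univ (π : Fin (R + 1) ≃ G) {j : ℕ} (hj : R ≤ j) : flagSet π j = Finset.univ := by
  ext s
  have := (π.symm s).isLt
  simp only [mem_flagSet, Finset.mem_univ, iff_true]
  omega

lemma flagSet_ssubset (π : Fin (R + 1) ≃ G) {i j : ℕ} (hij : i < j) (hj : j ≤ R) :
    flagSet π i ⊂ flagSet π j := by
  rw [Finset.ssubset_iff_of_subset]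
  · refine ⟨π ⟨j, by omega⟩, ?_, ?_⟩
    · simp [mem_flagSet]
    · simpa [mem_flagSet] using hij
  · intro s hs
    rw [mem_flagSet] at *
    omega

lemma flagSet_act (g : G) (π : Fin (R + 1) ≃ G) (j : ℕ) :
    flagSet (π.trans (Equiv.addLeft g)) j = setAct g (flagSet π j) := by
  ext s
  rw [mem_setAct, mem_flagSet, mem_flagSet]
  simp [sub_eq_neg_add]

/-- Exchange two adjacent labels of an enumeration. -/
def adjSwap (j : Fin R) (π : Fin (R + 1) ≃ G) : Fin (R + 1) ≃ G :=
  (Equiv.swap j.castSucc j.succ).trans π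

lemma adjSwap_adjSwap (j : Fin R) (π : Fin (R + 1) ≃ G) : adjSwap j (adjSwap j π) = π := by
  ext x
  simp [adjSwap]

lemma adjSwap_ne (j : Fin R) (π : Fin (R + 1) ≃ G) : adjSwap j π ≠ π := by
  intro h
  have h1 := congrArg (fun f : Fin (R + 1) ≃ G => f j.castSucc) h
  simp [adjSwap, Fin.ext_iff] at h1

lemma flagSet_adjSwap_of_ne {j : Fin R} (π : Fin (R + 1) ≃ G) {i : ℕ} (hij : i ≠ j) :
    flagSet (adjSwap j π) i = flagSet π i := by
  ext s
  rw [mem_flagSet, mem_flagSet]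
  simp only [adjSwap, Equiv.symm_trans_apply, Equiv.symm_swap, Equiv.swap_apply_def, Fin.ext_iff,
    Fin.val_castSucc, Fin.val_succ]
  split_ifs <;> simp <;> omega

lemma flagSet_union_adjSwap (j : Fin R) (π : Fin (R + 1) ≃ G) :
    flagSet π j ∪ flagSet (adjSwap j π) j = flagSet π (j + 1) := by
  ext s
  rw [Finset.mem_union, mem_flagSet, mem_flagSet, mem_flagSet]
  simp only [adjSwap, Equiv.symm_trans_apply, Equiv.symm_swap, Equiv.swap_apply_def, Fin.ext_iff,
    Fin.val_castSucc, Fin.val_succ]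
  split_ifs <;> simp <;> omega

lemma mem_flagSet_inter_adjSwap {j : Fin R} {π : Fin (R + 1) ≃ G} {s : G} :
    s ∈ flagSet π j ∩ flagSet (adjSwap j π) j ↔ (π.symm s : ℕ) < j := by
  rw [Finset.mem_inter, mem_flagSet, mem_flagSet]
  simp only [adjSwap, Equiv.symm_trans_apply, Equiv.symm_swap, Equiv.swap_apply_def, Fin.ext_iff,
    Fin.val_castSucc, Fin.val_succ]
  split_ifs <;> simp <;> omega

/-- The block and the position in the block of an index. -/
def pos (hN : N = E * R) : Fin N ≃ Fin E × Fin R := (finCongr hN).trans finProdFinEquiv.symm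

lemma pos_lt (hN : N = E * R) {i j : Fin N} (hij : i < j) (h : (pos hN i).1 = (pos hN j).1) :
    (pos hN i).2 < (pos hN j).2 := by
  have h1 : ∀ i : Fin N, (i : ℕ) = (pos hN i).2 + R * (pos hN i).1 := fun i => by
    have : finProdFinEquiv (pos hN i) = i.cast hN := finProdFinEquiv.apply_symm_apply _
    rw [← finProdFinEquiv_apply_val, this]
    rfl
  have hij' : (i : ℕ) < j := hij
  rw [h1 i, h1 j, h] at hij'
  exact Fin.lt_def.2 (by omega)

/-- The family of flags given by an enumeration of the labels in each block. -/
def flagFn (hN : N = E * R) (θ : Fin E → (Fin (R + 1) ≃ G)) (i : Fin N) : Fin E × Finset G :=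
  ((pos hN i).1, flagSet (θ (pos hN i).1) (pos hN i).2)

lemma flags_flagFn (hN : N = E * R) (θ : Fin E → (Fin (R + 1) ≃ G)) :
    Flags (List.ofFn (flagFn hN θ)) := by
  refine ⟨?_, ?_⟩
  · intro x hx
    rw [List.mem_ofFn] at hx
    obtain ⟨i, rfl⟩ := hx
    exact ⟨flagSet_nonempty _ _, flagSet_ne_univ _ (pos hN i).2.isLt⟩
  · rw [List.pairwise_ofFn]
    intro i j hij
    by_cases h : (pos hN i).1 = (pos hN j).1
    · right
      simp only [flagFn, h]
      exact flagSet_ssubset _ (pos_lt hN hij h) (pos hN j).2.isLt.le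
    · exact Or.inl h

lemma flagFn_act (hN : N = E * R) (g : G) (θ : Fin E → (Fin (R + 1) ≃ G)) :
    List.ofFn (flagFn hN fun e => (θ e).trans (Equiv.addLeft g)) =
      listAct blockAct g (List.ofFn (flagFn hN θ)) := by
  rw [listAct, List.map_ofFn]
  congr 1
  funext i
  simp [flagFn, flagSet_act, blockAct]

variable (e : Module.Basis (Fin N) ℝ (Space E G))

/-- The orientation of the simplex spanned by a family of flags. -/
noncomputable def flagDet (hN : N = E * R) (θ : Fin E → (Fin (R + 1) ≃ G)) : ℝ :=
  e.det fun i => ind (flagFn hN θ i)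

lemma flagDet_ne_zero (hN : N = E * R) (θ : Fin E → (Fin (R + 1) ≃ G)) : flagDet e hN θ ≠ 0 := by
  have h := (flags_flagFn hN θ).linearIndependent
  rw [List.map_ofFn] at h
  have h1 : LinearIndependent ℝ fun i => ind (flagFn hN θ i) := by
    have h2 := h.comp (Fin.cast (List.length_ofFn (f := ind ∘ flagFn hN θ)).symm)
      (Fin.cast_injective _)
    convert h2 using 1
    funext i
    simp
  have := (Module.Basis.is_basis_iff_det e (v := fun i => ind (flagFn hN θ i))).1
    ⟨h1, h1.span_eq_top_of_card_eq_finrank' (by simp [Module.finrank_eq_card_basis e])⟩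
  exact this.ne_zero

lemma flagDet_act (hN : N = E * R) (g : G) (θ : Fin E → (Fin (R + 1) ≃ G)) :
    flagDet e hN (fun e => (θ e).trans (Equiv.addLeft g)) =
      LinearMap.det (rep g : Space E G →ₗ[ℝ] Space E G) * flagDet e hN θ := by
  rw [flagDet, flagDet, ← Module.Basis.det_comp]
  congr 1
  funext i
  simp only [Function.comp_apply, flagFn, flagSet_act, ← ind_blockAct]
  rfl

/-- Exchange two adjacent labels in one block. -/
def blockSwap (hN : N = E * R) (i : Fin N) (θ : Fin E → (Fin (R + 1) ≃ G)) :
    Fin E → (Fin (R + 1) ≃ G) :=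
  Function.update θ (pos hN i).1 (adjSwap (pos hN i).2 (θ (pos hN i).1))

lemma blockSwap_blockSwap (hN : N = E * R) (i : Fin N) (θ : Fin E → (Fin (R + 1) ≃ G)) :
    blockSwap hN i (blockSwap hN i θ) = θ := by
  simp [blockSwap, adjSwap_adjSwap]

lemma blockSwap_ne (hN : N = E * R) (i : Fin N) (θ : Fin E → (Fin (R + 1) ≃ G)) :
    blockSwap hN i θ ≠ θ := by
  intro h
  have := congrFun h (pos hN i).1
  simp only [blockSwap, Function.update_self] at this
  exact adjSwap_ne _ _ this

lemma flagFn_blockSwap_of_ne (hN : N = E * R) {i i' : Fin N} (hi : i' ≠ i)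
    (θ : Fin E → (Fin (R + 1) ≃ G)) : flagFn hN (blockSwap hN i θ) i' = flagFn hN θ i' := by
  simp only [flagFn, blockSwap]
  by_cases h : (pos hN i').1 = (pos hN i).1
  · rw [h, Function.update_self, flagSet_adjSwap_of_ne]
    intro h2
    exact hi ((pos hN).injective (Prod.ext h (Fin.ext h2)))
  · rw [Function.update_of_ne h]

lemma flagFn_blockSwap_self (hN : N = E * R) (i : Fin N) (θ : Fin E → (Fin (R + 1) ≃ G)) :
    flagFn hN (blockSwap hN i θ) i =
      ((pos hN i).1, flagSet (adjSwap (pos hN i).2 (θ (pos hN i).1)) (pos hN i).2) := by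
  simp [flagFn, blockSwap]

lemma flagDet_blockSwap (hN : N = E * R) (i : Fin N) (θ : Fin E → (Fin (R + 1) ≃ G)) :
    flagDet e hN (blockSwap hN i θ) = -flagDet e hN θ := by
  set w : Fin N → Space E G := fun i => ind (flagFn hN θ i) with hw
  have h1 : flagDet e hN (blockSwap hN i θ) =
      e.det (Function.update w i (ind (flagFn hN (blockSwap hN i θ) i))) := by
    rw [flagDet]
    congr 1
    funext i'
    by_cases h : i' = i
    · subst h; rw [Function.update_self]
    · rw [Function.update_of_ne h, flagFn_blockSwap_of_ne hN h]
  have h2 : flagDet e hN θ = e.det (Function.update w i (ind (flagFn hN θ i))) := by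
    rw [show ind (flagFn hN θ i) = w i from rfl, Function.update_eq_self]
    rfl
  rw [← add_eq_zero_iff_eq_neg, h1, h2, add_comm, ← AlternatingMap.map_update_add,
    flagFn_blockSwap_self, flagFn, ind_add_ind, flagSet_union_adjSwap, AlternatingMap.map_update_add]
  rcases hb : pos hN i with ⟨b, j⟩
  dsimp only
  have key : ∀ j' : ℕ, j' ≠ j → e.det (Function.update w i (ind (b, flagSet (θ b) j'))) = 0 := by
    intro j' hj'
    by_cases hR : j' < R
    · have h3 : ind (b, flagSet (θ b) j') = w ((pos hN).symm (b, ⟨j', hR⟩)) := by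
        simp [hw, flagFn]
      rw [h3]
      refine AlternatingMap.map_update_self _ _ ?_
      intro h4
      have h5 : pos hN i = (b, ⟨j', hR⟩) := by rw [h4, Equiv.apply_symm_apply]
      rw [hb] at h5
      apply hj'
      rw [show j = ⟨j', hR⟩ from (Prod.ext_iff.1 h5).2]
    · rw [flagSet_eq_univ _ (by omega), ind_univ]
      exact AlternatingMap.map_update_zero _ _ _
  rw [key _ (by omega), zero_add]
  rcases Nat.eq_zero_or_pos (j : ℕ) with h0 | h0
  · have : flagSet (θ b) j ∩ flagSet (adjSwap j (θ b)) j = ∅ := by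
      ext s
      rw [mem_flagSet_inter_adjSwap, h0]
      simp
    rw [this, ind_empty]
    exact AlternatingMap.map_update_zero _ _ _
  · have : flagSet (θ b) j ∩ flagSet (adjSwap j (θ b)) j = flagSet (θ b) (j - 1) := by
      ext s
      rw [mem_flagSet_inter_adjSwap, mem_flagSet]
      omega
    rw [this]
    exact key _ (by omega)

variable {𝔽 : Type*} [Field 𝔽]

variable (𝔽) in
/-- Evaluation on the oriented cycle formed by all families of complete flags. -/
noncomputable def cycle (hN : N = E * R) : (List (Fin E × Finset G) → 𝔽) →ₗ[𝔽] 𝔽 :=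
  ∑ θ : Fin E → (Fin (R + 1) ≃ G),
    sgn 𝔽 (flagDet e hN θ) • LinearMap.proj (R := 𝔽) (φ := fun _ => 𝔽) (List.ofFn (flagFn hN θ))

lemma cycle_apply (hN : N = E * R) (φ : List (Fin E × Finset G) → 𝔽) :
    cycle e 𝔽 hN φ = ∑ θ : Fin E → (Fin (R + 1) ≃ G),
      sgn 𝔽 (flagDet e hN θ) * φ (List.ofFn (flagFn hN θ)) := by
  simp [cycle, LinearMap.sum_apply]

lemma cycle_congr (hN : N = E * R) (φ ψ : List (Fin E × Finset G) → 𝔽)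
    (h : ∀ τ, Flags τ → τ.length = N → φ τ = ψ τ) : cycle e 𝔽 hN φ = cycle e 𝔽 hN ψ := by
  rw [cycle_apply, cycle_apply]
  refine Finset.sum_congr rfl fun θ _ => ?_
  rw [h _ (flags_flagFn hN θ) (by simp)]

lemma cycle_tr {q : ℕ} [CharP 𝔽 q] (hq : q.Prime) (hG : ∀ g : G, q • g = 0) (hN : N = E * R) (g : G)
    (φ : List (Fin E × Finset G) → 𝔽) :
    cycle e 𝔽 hN (tr 𝔽 (listAct blockAct) g φ) = cycle e 𝔽 hN φ := by
  rw [cycle_apply, cycle_apply]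
  let f : (Fin E → (Fin (R + 1) ≃ G)) → (Fin E → (Fin (R + 1) ≃ G)) :=
    fun θ e => (θ e).trans (Equiv.addLeft g)
  have hf : Function.Bijective f := by
    refine (Finite.injective_iff_bijective).1 fun θ θ' h => ?_
    funext e
    ext x
    have := congrArg (fun f : Fin (R + 1) ≃ G => f x) (congrFun h e)
    simpa [f] using this
  refine Fintype.sum_bijective f hf _ _ fun θ => ?_
  have h1 : flagDet e hN (f θ) =
      LinearMap.det (rep g : Space E G →ₗ[ℝ] Space E G) * flagDet e hN θ := flagDet_act e hN g θ
  have h2 : LinearMap.det (rep g : Space E G →ₗ[ℝ] Space E G) ^ q = 1 := by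
    rw [← map_pow, rep_pow hG, map_one]
  rw [h1, sgn_mul, sgn_of_pow_eq_one 𝔽 hq h2, one_mul, tr_apply, ← flagFn_act]

lemma cycle_dif (hN : N = E * R) (hpos : 0 < N) (u : List (Fin E × Finset G) → 𝔽) :
    cycle e 𝔽 hN (dif u) = 0 := by
  obtain ⟨n, rfl⟩ : ∃ n, N = n + 1 := ⟨N - 1, by omega⟩
  rw [cycle_apply]
  simp only [dif_ofFn, Finset.mul_sum]
  rw [Finset.sum_comm]
  refine Finset.sum_eq_zero fun i _ => ?_
  refine Finset.sum_involution (fun θ _ => blockSwap hN i θ) ?_ (fun θ _ _ => blockSwap_ne hN i θ)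
    (fun _ _ => Finset.mem_univ _) (fun θ _ => blockSwap_blockSwap hN i θ)
  intro θ _
  have h1 : flagFn hN (blockSwap hN i θ) ∘ i.succAbove = flagFn hN θ ∘ i.succAbove := by
    funext x
    exact flagFn_blockSwap_of_ne hN (Fin.succAbove_ne i x) θ
  rw [h1, flagDet_blockSwap, sgn_neg_eq]
  ring

end FlagCycle

lemma sum_telescope {R : ℕ} (f : Fin (R + 1) → ℝ) (x : Fin (R + 1)) :
    ∑ j : Fin R, (f j.succ - f j.castSucc) * (if (x : ℕ) ≤ j then 1 else 0) =
      f (Fin.last R) - f x := by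
  induction R with
  | zero =>
    have hx : x = Fin.last 0 := Fin.ext (by omega)
    subst hx
    simp
  | succ R ih =>
    refine Fin.lastCases ?_ (fun x => ?_) x
    · rw [sub_self]
      refine Finset.sum_eq_zero fun j _ => ?_
      rw [if_neg, mul_zero]
      have := j.isLt
      rw [Fin.val_last]
      omega
    · rw [Fin.sum_univ_castSucc]
      have := ih (fun i => f i.castSucc) x
      have hx : (x : ℕ) ≤ R := by omega
      simp only [Fin.val_castSucc, Fin.val_last, hx, if_true, Fin.succ_castSucc, Fin.succ_last] at this ⊢
      rw [this]
      ring

lemma existsUnique_strictMono_equiv {G : Type*} [Fintype G] {R : ℕ} (hG : Fintype.card G = R + 1)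
    (u : G → ℝ) (hu : Function.Injective u) :
    ∃! π : Fin (R + 1) ≃ G, StrictMono (u ∘ π) := by
  let _ : LinearOrder G := LinearOrder.lift' u hu
  have hlt : ∀ x y : G, x < y ↔ u x < u y := fun x y => Iff.rfl
  let π₀ : Fin (R + 1) ≃o G := Fintype.orderIsoFinOfCardEq G hG
  refine ⟨π₀.toEquiv, fun x y hxy => (hlt _ _).1 (π₀.strictMono hxy), fun π hπ => ?_⟩
  have hπ' : StrictMono π := fun x y hxy => (hlt _ _).2 (hπ hxy)
  let π₁ : Fin (R + 1) ≃o G := ⟨π, hπ'.le_iff_le⟩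
  have h1 : π₁.trans π₀.symm = OrderIso.refl _ := Subsingleton.elim _ _
  ext x
  have h2 := congrArg (fun f : Fin (R + 1) ≃o Fin (R + 1) => π₀ (f x)) h1
  have h3 : π₁ x = π₀ x := by simpa using h2
  exact h3

section FlagCycle

variable {G : Type*} [AddCommGroup G] [DecidableEq G] [Fintype G] {E R N : ℕ}

lemma posRel_flagFn_iff (hN : N = E * R) (v : Space E G)
    (hv : ∀ b s s', s ≠ s' → coordDiff b s s' v ≠ 0) (θ : Fin E → (Fin (R + 1) ≃ G)) :
    PosRel (Fin.cons v fun i => ind (flagFn hN θ i) : Fin (N + 1) → Space E G) ↔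
      ∀ b, StrictMono ((fun s => lift v (b, s)) ∘ θ b) := by
  constructor
  · rintro ⟨c, hc, h⟩ b x y hxy
    have hne := hv b (θ b x) (θ b y) ((θ b).injective.ne hxy.ne)
    rw [coordDiff_apply, sub_ne_zero] at hne
    refine lt_of_le_of_ne ?_ hne
    have h1 := congrArg (coordDiff b (θ b x) (θ b y)) h
    rw [map_zero, map_sum, Fin.sum_univ_succ] at h1
    simp only [map_smul, Fin.cons_zero, Fin.cons_succ, smul_eq_mul] at h1
    have h2 : 0 ≤ ∑ i : Fin N, c i.succ * coordDiff b (θ b x) (θ b y) (ind (flagFn hN θ i)) := by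
      refine Finset.sum_nonneg fun i _ => mul_nonneg (hc _).le ?_
      rw [ind, coordDiff_toSpace, sub_nonneg]
      dsimp only
      by_cases h3 : b = (flagFn hN θ i).1 ∧ θ b y ∈ (flagFn hN θ i).2
      · rw [if_pos h3, if_pos]
        refine ⟨h3.1, ?_⟩
        have h4 := h3.2
        have h5 : b = (pos hN i).1 := h3.1
        simp only [flagFn, ← h5, mem_flagSet, Equiv.symm_apply_apply] at h4 ⊢
        have : (x : ℕ) < y := hxy
        omega
      · rw [if_neg h3]
        split_ifs <;> norm_num
    have h3 : c 0 * coordDiff b (θ b x) (θ b y) v ≤ 0 := by linarith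
    have h4 : coordDiff b (θ b x) (θ b y) v ≤ 0 := by
      by_contra hcon
      push Not at hcon
      exact absurd h3 (not_le.2 (mul_pos (hc 0) hcon))
    rw [coordDiff_apply] at h4
    simp only [Function.comp_apply]
    linarith
  · intro h
    let f : Fin E → Fin (R + 1) → ℝ := fun b i => lift v (b, θ b i)
    let d : Fin E × Fin R → ℝ := fun x => f x.1 x.2.succ - f x.1 x.2.castSucc
    refine ⟨Fin.cons 1 fun i => d (pos hN i), ?_, ?_⟩
    · refine Fin.cases one_pos fun i => ?_
      rw [Fin.cons_succ]
      exact sub_pos.2 (h _ (Fin.castSucc_lt_succ))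
    · rw [Fin.sum_univ_succ]
      simp only [Fin.cons_zero, Fin.cons_succ, one_smul]
      rw [← toSpace_lift v]
      simp only [ind, ← map_smul, ← map_sum, ← map_add]
      rw [← map_zero toSpace]
      have key : ∀ b s, (lift (toSpace (lift v)) + ∑ i : Fin N, d (pos hN i) •
          fun y : Fin E × G => if y.1 = (flagFn hN θ i).1 ∧ y.2 ∈ (flagFn hN θ i).2 then (1 : ℝ)
            else 0) (b, s) = f b (Fin.last R) := by
        intro b s
        rw [toSpace_lift, Pi.add_apply, Finset.sum_apply]
        have h1 : lift v (b, s) = f b ((θ b).symm s) := by simp [f]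
        rw [h1, ← eq_sub_iff_add_eq', ← sum_telescope]
        simp only [Pi.smul_apply, smul_eq_mul, flagFn]
        refine (?_ : _ = ∑ x : Fin E × Fin R, d x *
          if b = x.1 ∧ s ∈ flagSet (θ x.1) x.2 then (1 : ℝ) else 0).trans ?_
        · exact (pos hN).sum_comp (fun x => d x *
            if b = x.1 ∧ s ∈ flagSet (θ x.1) x.2 then (1 : ℝ) else 0)
        rw [Fintype.sum_prod_type, Finset.sum_eq_single b]
        · refine Finset.sum_congr rfl fun j _ => ?_
          simp only [true_and, mem_flagSet, d]
        · intro b' _ hb'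
          refine Finset.sum_eq_zero fun j _ => ?_
          rw [if_neg (fun h => hb' h.1.symm), mul_zero]
        · intro hb; exact absurd (Finset.mem_univ _) hb
      refine toSpace_congr fun b s => ?_
      rw [toSpace_lift] at key
      rw [key b s, key b 0]
      simp

variable {𝔽 : Type*} [Field 𝔽] (e : Module.Basis (Fin N) ℝ (Space E G))

/-- A generic vector meets exactly one simplex of the cycle of complete flags. -/
theorem cycle_inter (hN : N = E * R) (hG : Fintype.card G = R + 1) (v : Space E G)
    (hv : ∀ b s s', s ≠ s' → coordDiff b s s' v ≠ 0) :
    cycle e 𝔽 hN (fun τ => inter 𝔽 e (v :: τ.map ind)) = 1 := by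
  have h1 : ∀ b, ∃! π : Fin (R + 1) ≃ G, StrictMono ((fun s => lift v (b, s)) ∘ π) := fun b =>
    existsUnique_strictMono_equiv hG _ fun s s' h => by
      by_contra hne
      exact hv b s s' hne (by rw [coordDiff_apply, sub_eq_zero]; exact h)
  choose θ₀ hθ₀ hu using h1
  have h2 : ∀ θ : Fin E → (Fin (R + 1) ≃ G),
      inter 𝔽 e (v :: (List.ofFn (flagFn hN θ)).map ind) =
        interFin 𝔽 e (Fin.cons v fun i => ind (flagFn hN θ i)) := by
    intro θ
    rw [← inter_ofFn, List.map_ofFn, List.ofFn_succ]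
    rfl
  rw [cycle_apply, Finset.sum_eq_single θ₀]
  · rw [h2, interFin, if_pos ((posRel_flagFn_iff hN v hv θ₀).2 hθ₀)]
    exact sgn_mul_self 𝔽 (flagDet_ne_zero e hN θ₀)
  · intro θ _ hθ
    rw [h2, interFin, if_neg, mul_zero]
    intro h
    exact hθ (funext fun b => hu b _ ((posRel_flagFn_iff hN v hv θ).1 h b))
  · intro h
    exact absurd (Finset.mem_univ _) h

end FlagCycle

lemma exists_mem_forall_notMem {κ ι : Type*} [Fintype κ] [Countable ι]
    (W : ι → Submodule ℝ (κ → ℝ)) (hW : ∀ i, W i ≠ ⊤) {U : Set (κ → ℝ)} (hU : IsOpen U)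
    (hne : U.Nonempty) : ∃ v ∈ U, ∀ i, v ∉ W i := by
  by_contra hcon
  push Not at hcon
  have h1 : U ⊆ ⋃ i, (W i : Set (κ → ℝ)) := fun v hv => by simpa using hcon v hv
  have h2 : MeasureTheory.volume (⋃ i, (W i : Set (κ → ℝ))) = 0 :=
    MeasureTheory.measure_iUnion_null fun i =>
      MeasureTheory.Measure.addHaar_submodule _ _ (hW i)
  exact (hU.measure_pos MeasureTheory.volume hne).ne' (MeasureTheory.measure_mono_null h1 h2)

lemma exists_seq_of_strong {α : Type*} (Q : ∀ n : ℕ, (∀ m, m < n → α) → α → Prop)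
    (h : ∀ n w, ∃ x, Q n w x) : ∃ v : ℕ → α, ∀ n, Q n (fun m _ => v m) (v n) := by
  choose f hf using h
  refine ⟨Nat.lt_wfRel.wf.fix f, fun n => ?_⟩
  have h1 := hf n (fun m _ => Nat.lt_wfRel.wf.fix f m)
  rw [WellFounded.fix_eq]
  exact h1

lemma span_ne_top_of_length_lt {V : Type*} [AddCommGroup V] [Module ℝ V] (l : List V)
    (h : l.length < Module.finrank ℝ V) : Submodule.span ℝ {x | x ∈ l} ≠ ⊤ := by
  classical
  intro htop
  have h1 : {x | x ∈ l} = (l.toFinset : Set V) := by ext x; simp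
  have h2 := finrank_span_finset_le_card (R := ℝ) l.toFinset
  rw [Set.finrank, ← h1, htop, finrank_top] at h2
  have := l.toFinset_card_le
  omega

section Generic

variable {G : Type*} [AddCommGroup G] [DecidableEq G] [Fintype G] {E : ℕ}

lemma rep_surjective (g : G) : Function.Surjective (rep g : Space E G →ₗ[ℝ] Space E G) :=
  fun v => ⟨rep (-g) v, by rw [← rep_add, add_neg_cancel, rep_zero]⟩

lemma comap_rep_ne_top (g : G) {W : Submodule ℝ (Space E G)} (h : W ≠ ⊤) :
    W.comap (rep g) ≠ ⊤ := by
  intro h1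
  apply h
  rw [eq_top_iff]
  intro v _
  obtain ⟨u, rfl⟩ := rep_surjective g v
  have : u ∈ W.comap (rep g) := by rw [h1]; trivial
  exact this

lemma ker_coordDiff_ne_top (b : Fin E) {s s' : G} (h : s ≠ s') :
    LinearMap.ker (coordDiff b s s') ≠ ⊤ := by
  intro h1
  have h2 : toSpace (fun y : Fin E × G => if y.2 = s then (1 : ℝ) else 0) ∈
      LinearMap.ker (coordDiff b s s') := by rw [h1]; trivial
  rw [LinearMap.mem_ker, coordDiff_toSpace] at h2
  simp [h.symm] at h2

/-- The orbit map of a sequence of vectors. -/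
noncomputable def orbit (v : ℕ → Space E G) (x : ℕ × G) : Space E G := rep x.2 (v x.1)

lemma orbit_vertAct (v : ℕ → Space E G) (g : G) (x : ℕ × G) :
    orbit v (vertAct g x) = rep g (orbit v x) := by
  simp [orbit, vertAct, rep_add]

lemma exists_generic (U : ℕ → Set (Space E G)) (hU : ∀ i, IsOpen (U i))
    (hne : ∀ i, (U i).Nonempty) :
    ∃ v : ℕ → Space E G, (∀ i, v i ∈ U i) ∧
      (∀ b s s', s ≠ s' → coordDiff b s s' (v 0) ≠ 0) ∧
      ∀ M σ τ, Good M σ → Flags τ → σ.length + τ.length ≤ Module.finrank ℝ (Space E G) →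
        LinearIndependent ℝ (σ.map (orbit v) ++ τ.map ind).get := by
  have hstep : ∀ (n : ℕ) (w : ∀ m, m < n → Space E G), ∃ x, x ∈ U n ∧
      (∀ b s s', s ≠ s' → coordDiff b s s' x ≠ 0) ∧
      ∀ (s : G) (σ : List (ℕ × G)) (τ : List (Fin E × Finset G)),
        σ.length + τ.length < Module.finrank ℝ (Space E G) →
        rep s x ∉ Submodule.span ℝ {y | y ∈ σ.map
          (orbit fun m => if h : m < n then w m h else 0) ++ τ.map ind} := by
    intro n w
    let ι := (Fin E × {x : G × G // x.1 ≠ x.2}) ⊕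
      (G × {x : List (ℕ × G) × List (Fin E × Finset G) //
        x.1.length + x.2.length < Module.finrank ℝ (Space E G)})
    let W : ι → Submodule ℝ (Space E G) := Sum.elim
      (fun x => LinearMap.ker (coordDiff x.1 x.2.1.1 x.2.1.2))
      (fun x => (Submodule.span ℝ {y | y ∈ x.2.1.1.map
        (orbit fun m => if h : m < n then w m h else 0) ++ x.2.1.2.map ind}).comap (rep x.1))
    obtain ⟨x, hx, hxW⟩ := exists_mem_forall_notMem W (by
      rintro (⟨b, ⟨s, s'⟩, h⟩ | ⟨s, ⟨σ, τ⟩, h⟩)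
      · exact ker_coordDiff_ne_top b h
      · exact comap_rep_ne_top s (span_ne_top_of_length_lt _ (by simpa using h))) (hU n) (hne n)
    exact ⟨x, hx, fun b s s' h => hxW (Sum.inl (b, ⟨(s, s'), h⟩)),
      fun s σ τ h => hxW (Sum.inr (s, ⟨(σ, τ), h⟩))⟩
  obtain ⟨v, hv⟩ := exists_seq_of_strong _ hstep
  refine ⟨v, fun i => (hv i).1, (hv 0).2.1, fun M σ => ?_⟩
  induction σ generalizing M with
  | nil => exact fun τ _ hτ _ => hτ.linearIndependent
  | cons x σ ih =>
    intro τ hσ hτ hl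
    obtain ⟨n, s⟩ := x
    simp only [List.length_cons] at hl
    rw [List.map_cons, List.cons_append]
    refine linearIndependent_cons (ih M τ (hσ.sublist (List.sublist_cons_self _ _)) hτ (by omega)) ?_
    have h1 := (hv n).2.2 s σ τ (by omega)
    have h2 : σ.map (orbit fun m => if m < n then v m else 0) = σ.map (orbit v) := by
      refine List.map_congr_left fun y hy => ?_
      have := (List.pairwise_cons.1 hσ.1).1 y hy
      simp only at this
      simp [orbit, this]
    simp only [dite_eq_ite] at h1
    rwa [h2] at h1

lemma inter_eq_zero_of_pos {𝔽 V : Type*} [Field 𝔽] [AddCommGroup V] [Module ℝ V] {N : ℕ}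
    (e : Module.Basis (Fin N) ℝ V) (f : V →ₗ[ℝ] ℝ) {l : List V} (h : ∀ x ∈ l, 0 < f x) :
    inter 𝔽 e l = 0 := by
  rw [inter]
  split_ifs with hl
  · rw [interFin, if_neg]
    rintro ⟨c, hc, h0⟩
    have h1 := congrArg f h0
    rw [map_zero, map_sum] at h1
    refine h1.not_gt (Finset.sum_pos (fun i _ => ?_) ⟨0, Finset.mem_univ _⟩)
    rw [map_smul, smul_eq_mul]
    exact mul_pos (hc i) (h _ (List.get_mem _ _))
  · rfl

lemma exists_pos_of_zero_notMem_convexHull {V : Type*} [NormedAddCommGroup V] [NormedSpace ℝ V]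
    (l : List V) (h : (0 : V) ∉ convexHull ℝ {y | y ∈ l}) :
    ∃ f : V →L[ℝ] ℝ, ∀ y ∈ l, 0 < f y := by
  have hfin : {y | y ∈ l}.Finite := List.finite_toSet _
  obtain ⟨f, u, hu, hf⟩ := geometric_hahn_banach_point_closed (convex_convexHull ℝ _)
    (hfin.isClosed_convexHull ℝ) h
  rw [map_zero] at hu
  exact ⟨f, fun y hy => hu.trans (hf _ (subset_convexHull ℝ _ hy))⟩

/-- A sequence of vectors can be perturbed to a generic one so that finitely many given simplices
that miss the origin still do so. -/
theorem exists_generic_inter_eq_zero {𝔽 : Type*} [Field 𝔽] {N : ℕ}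
    (e : Module.Basis (Fin N) ℝ (Space E G)) (v₀ : ℕ → Space E G) (T : Set (List (ℕ × G)))
    (hT : T.Finite) (h0 : ∀ σ ∈ T, (0 : Space E G) ∉ convexHull ℝ {y | y ∈ σ.map (orbit v₀)}) :
    ∃ v : ℕ → Space E G, (∀ σ ∈ T, inter 𝔽 e (σ.map (orbit v)) = 0) ∧
      (∀ b s s', s ≠ s' → coordDiff b s s' (v 0) ≠ 0) ∧
      ∀ M σ τ, Good M σ → Flags τ → σ.length + τ.length = N →
        LinearIndependent ℝ (σ.map (orbit v) ++ τ.map ind).get := by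
  have h1 : ∀ σ ∈ T, ∃ f : Space E G →L[ℝ] ℝ, ∀ x ∈ σ, 0 < f (orbit v₀ x) := by
    intro σ hσ
    obtain ⟨f, hf⟩ := exists_pos_of_zero_notMem_convexHull _ (h0 σ hσ)
    exact ⟨f, fun x hx => hf _ (List.mem_map_of_mem hx)⟩
  choose! f hf using h1
  have hU : ∀ i, IsOpen {w : Space E G | ∀ σ ∈ T, ∀ s, (i, s) ∈ σ → 0 < f σ (rep s w)} := by
    intro i
    have h2 : {w : Space E G | ∀ σ ∈ T, ∀ s, (i, s) ∈ σ → 0 < f σ (rep s w)} =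
        ⋂ σ ∈ T, ⋂ s : G, {w : Space E G | (i, s) ∈ σ → 0 < f σ (rep s w)} := by
      ext w
      simp only [Set.mem_iInter, Set.mem_ofPred_eq]
    rw [h2]
    refine hT.isOpen_biInter fun σ _ => isOpen_iInter_of_finite fun s => ?_
    by_cases h : (i, s) ∈ σ
    · simp only [h, true_imp_iff]
      exact isOpen_lt continuous_const
        ((f σ).continuous.comp (LinearMap.continuous_of_finiteDimensional _))
    · simp only [h, false_imp_iff]
      exact isOpen_const
  obtain ⟨v, hvU, hv0, hv⟩ := exists_generic _ hU fun i => ⟨v₀ i, fun σ hσ s h => hf σ hσ (i, s) h⟩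
  refine ⟨v, fun σ hσ => ?_, hv0, fun M σ τ h1 h2 h3 => hv M σ τ h1 h2 ?_⟩
  · refine inter_eq_zero_of_pos e (f σ : Space E G →ₗ[ℝ] ℝ) fun y hy => ?_
    obtain ⟨⟨i, s⟩, hx, rfl⟩ := List.mem_map.1 hy
    exact hvU i σ hσ s hx
  · rw [Module.finrank_eq_card_basis e, Fintype.card_fin, h3]

end Generic

section Points

variable {G : Type*} [AddCommGroup G] [DecidableEq G] [Fintype G] {d : ℕ}

/-- The homogeneous coordinates of a point, placed at the label zero. -/
def pointVec (p : ℕ → EuclideanSpace ℝ (Fin d)) (i : ℕ) : Space (d + 1) G :=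
  toSpace fun y => if y.2 = 0 then (Fin.cons 1 fun j => p i j : Fin (d + 1) → ℝ) y.1 else 0

lemma orbit_pointVec (p : ℕ → EuclideanSpace ℝ (Fin d)) (x : ℕ × G) :
    orbit (pointVec p) x = toSpace fun y : Fin (d + 1) × G =>
      if y.2 = x.2 then (Fin.cons 1 fun j => p x.1 j : Fin (d + 1) → ℝ) y.1 else 0 := by
  rw [orbit, pointVec, rep_toSpace]
  congr 1
  funext ⟨b, s⟩
  simp [shift_apply, sub_eq_zero]

/-- Sarkaria's trick: a simplex around the origin yields convex hulls with a common point. -/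
lemma exists_common_point (p : ℕ → EuclideanSpace ℝ (Fin d)) (σ : List (ℕ × G))
    (h : (0 : Space (d + 1) G) ∈ convexHull ℝ {y | y ∈ σ.map (orbit (pointVec p))}) :
    ∃ x, ∀ s : G, x ∈ convexHull ℝ (p '' {i | (i, s) ∈ σ}) := by
  rw [convexHull_eq] at h
  obtain ⟨ι, t, w, z, hw, hw1, hz, h0⟩ := h
  rw [t.centerMass_eq_of_sum_1 _ hw1] at h0
  have hz' : ∀ i ∈ t, ∃ x ∈ σ, orbit (pointVec p) x = z i := fun i hi => List.mem_map.1 (hz i hi)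
  choose! y hy hyz using hz'
  have key : ∀ b s, ∑ i ∈ t with (y i).2 = s, w i *
      (Fin.cons 1 fun j => p (y i).1 j : Fin (d + 1) → ℝ) b =
        ∑ i ∈ t with (y i).2 = 0, w i * (Fin.cons 1 fun j => p (y i).1 j : Fin (d + 1) → ℝ) b := by
    intro b s
    have h1 := congrArg (coordDiff b s 0) h0
    rw [map_zero, map_sum] at h1
    rw [Finset.sum_filter, Finset.sum_filter, ← sub_eq_zero, ← Finset.sum_sub_distrib]
    refine (Finset.sum_congr rfl fun i hi => ?_).trans h1
    rw [← hyz i hi, orbit_pointVec, map_smul, coordDiff_toSpace, smul_eq_mul, mul_sub, mul_ite,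
      mul_ite, mul_zero]
    simp only [eq_comm]
  have hmass : ∀ s, ∑ i ∈ t with (y i).2 = s, w i = ∑ i ∈ t with (y i).2 = 0, w i := by
    intro s
    simpa using key 0 s
  have hpos : 0 < ∑ i ∈ t with (y i).2 = 0, w i := by
    refine lt_of_le_of_ne (Finset.sum_nonneg fun i hi => hw i (Finset.mem_filter.1 hi).1) fun h => ?_
    have h1 := Finset.sum_fiberwise t (fun i => (y i).2) w
    rw [hw1] at h1
    simp [hmass, ← h] at h1
  refine ⟨(t.filter fun i => (y i).2 = 0).centerMass w fun i => p (y i).1, fun s => ?_⟩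
  have h1 : (t.filter fun i => (y i).2 = 0).centerMass w (fun i => p (y i).1) =
      (t.filter fun i => (y i).2 = s).centerMass w fun i => p (y i).1 := by
    rw [Finset.centerMass, Finset.centerMass, hmass s]
    congr 1
    ext j
    have := key j.succ s
    simp only [Fin.cons_succ] at this
    simp [this]
  rw [h1]
  refine Finset.centerMass_mem_convexHull _ (fun i hi => hw i (Finset.mem_filter.1 hi).1)
    (by rw [hmass s]; exact hpos) fun i hi => ?_
  obtain ⟨h2, h3⟩ := Finset.mem_filter.1 hi
  refine ⟨(y i).1, ?_, rfl⟩
  rw [Set.mem_ofPred_eq, ← h3]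
  exact hy i h2

/-- The labels that are used more than `n` times. -/
def overfull (n : ℕ) (σ : List (ℕ × G)) : Finset G :=
  Finset.univ.filter fun s => n < (σ.map Prod.snd).count s

lemma mem_overfull {n : ℕ} {σ : List (ℕ × G)} {s : G} :
    s ∈ overfull n σ ↔ n < (σ.map Prod.snd).count s := by simp [overfull]

lemma overfull_listAct (n : ℕ) (g : G) (σ : List (ℕ × G)) :
    overfull n (listAct vertAct g σ) = setAct g (overfull n σ) := by
  ext s
  rw [mem_setAct, mem_overfull, mem_overfull]
  have h1 : (listAct vertAct g σ).map Prod.snd = (σ.map Prod.snd).map (g + ·) := by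
    simp [listAct, vertAct]
  have h2 := List.count_map_of_injective (σ.map Prod.snd) (g + ·) (add_right_injective g) (s - g)
  rw [h1, ← h2]
  simp

lemma overfull_mono (n : ℕ) {σ τ : List (ℕ × G)} (h : τ.Sublist σ) :
    overfull n τ ⊆ overfull n σ := by
  intro s hs
  rw [mem_overfull] at hs ⊢
  exact hs.trans_le ((h.map _).count_le s)

lemma sum_count (σ : List (ℕ × G)) : ∑ s : G, (σ.map Prod.snd).count s = σ.length := by
  have h := Multiset.sum_count_eq_card (s := Finset.univ) (m := ((σ.map Prod.snd : List G) : Multiset G))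
    fun _ _ => Finset.mem_univ _
  simpa using h

lemma Good.length_le {M : ℕ} {σ : List (ℕ × G)} (h : Good M σ) : σ.length ≤ M := by
  have h1 : (σ.map Prod.fst).Nodup := List.pairwise_map.2 (h.1.imp fun h => h.ne')
  have h2 : (σ.map Prod.fst).toFinset ⊆ Finset.range M := by
    intro i hi
    obtain ⟨x, hx, rfl⟩ := List.mem_map.1 (List.mem_toFinset.1 hi)
    exact Finset.mem_range.2 (h.2 x hx)
  have h3 := Finset.card_le_card h2
  rwa [List.toFinset_card_of_nodup h1, Finset.card_range, List.length_map] at h3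

lemma overfull_ne_univ {n M : ℕ} (hM : M < (n + 1) * Fintype.card G) {σ : List (ℕ × G)}
    (h : Good M σ) : overfull n σ ≠ Finset.univ := by
  intro h1
  have h2 : ∑ _s : G, (n + 1) ≤ ∑ s : G, (σ.map Prod.snd).count s :=
    Finset.sum_le_sum fun s _ => mem_overfull.1 (h1 ▸ Finset.mem_univ s)
  rw [sum_count, Finset.sum_const, Finset.card_univ, smul_eq_mul] at h2
  have := h.length_le
  rw [mul_comm] at hM
  omega

lemma count_eq_of_overfull_eq_empty {n : ℕ} {σ : List (ℕ × G)}
    (hl : σ.length = n * Fintype.card G) (h : overfull n σ = ∅) (s : G) :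
    (σ.map Prod.snd).count s = n := by
  have h1 : ∀ s ∈ (Finset.univ : Finset G), (σ.map Prod.snd).count s ≤ n := fun s _ => by
    by_contra hcon
    have : s ∈ overfull n σ := mem_overfull.2 (not_le.1 hcon)
    simp [h] at this
  refine (Finset.sum_eq_sum_iff_of_le h1).1 ?_ s (Finset.mem_univ s)
  rw [sum_count, hl, Finset.sum_const, Finset.card_univ, smul_eq_mul, mul_comm]

/-- The vertices of a simplex with a given label. -/
def labelClass (M : ℕ) (σ : List (ℕ × G)) (s : G) : Finset (Fin M) :=
  Finset.univ.filter fun i => ((i : ℕ), s) ∈ σ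

lemma mem_labelClass {M : ℕ} {σ : List (ℕ × G)} {s : G} {i : Fin M} :
    i ∈ labelClass M σ s ↔ ((i : ℕ), s) ∈ σ := by simp [labelClass]

lemma Good.label_unique {M : ℕ} {σ : List (ℕ × G)} (h : Good M σ) {i : ℕ} {s s' : G}
    (hs : (i, s) ∈ σ) (hs' : (i, s') ∈ σ) : s = s' := by
  have h1 : (σ.map Prod.fst).Nodup := List.pairwise_map.2 (h.1.imp fun h => h.ne')
  have := List.inj_on_of_nodup_map h1 hs hs' rfl
  exact congrArg Prod.snd this

lemma disjoint_labelClass {M : ℕ} {σ : List (ℕ × G)} (h : Good M σ) {s s' : G} (hs : s ≠ s') :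
    Disjoint (labelClass M σ s) (labelClass M σ s') := by
  rw [Finset.disjoint_left]
  exact fun i hi hi' => hs (h.label_unique (mem_labelClass.1 hi) (mem_labelClass.1 hi'))

lemma card_labelClass {M : ℕ} {σ : List (ℕ × G)} (h : Good M σ) (s : G) :
    (labelClass M σ s).card = (σ.map Prod.snd).count s := by
  have h1 : (σ.filter fun x => x.2 = s).Nodup :=
    (h.1.imp fun {x y} hxy (he : x = y) => by simp [he] at hxy).filter _
  have h2 : (σ.filter fun x => x.2 = s).toFinset =
      (labelClass M σ s).image fun i : Fin M => ((i : ℕ), s) := by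
    ext ⟨i, s'⟩
    simp only [List.mem_toFinset, List.mem_filter, decide_eq_true_eq, Finset.mem_image,
      mem_labelClass, Prod.mk.injEq]
    constructor
    · rintro ⟨h3, rfl⟩
      exact ⟨⟨i, h.2 _ h3⟩, h3, rfl, rfl⟩
    · rintro ⟨j, h3, rfl, rfl⟩
      exact ⟨h3, rfl⟩
  have h3 := congrArg Finset.card h2
  rw [List.toFinset_card_of_nodup h1, Finset.card_image_of_injective _ fun i j hij =>
    Fin.ext (congrArg Prod.fst hij)] at h3
  rw [← h3, List.count, List.countP_map, List.countP_eq_length_filter]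
  congr 1

lemma finite_good (M n : ℕ) : {σ : List (ℕ × G) | Good M σ ∧ σ.length = n}.Finite := by
  refine ((List.finite_length_eq (Fin M × G) n).image
    (List.map fun x => ((x.1 : ℕ), x.2))).subset ?_
  rintro σ ⟨h, hl⟩
  have h1 : σ ∈ Set.range (List.map fun x : Fin M × G => ((x.1 : ℕ), x.2)) := by
    rw [Set.range_list_map]
    exact fun x hx => ⟨(⟨x.1, h.2 x hx⟩, x.2), rfl⟩
  obtain ⟨τ, rfl⟩ := h1
  exact ⟨τ, by simpa using hl, rfl⟩

end Points

section Main

variable {G : Type*} [AddCommGroup G] [DecidableEq G] [Fintype G]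

/-- Some simplex around the origin uses every label equally often. -/
theorem exists_balanced_simplex {𝔽 : Type*} [Field 𝔽] {ι : Type*} [Fintype ι] {q : ℕ} [CharP 𝔽 q]
    [Module (ZMod q) G] (hq : q.Prime) (c : ι → 𝔽) (s : ι → G)
    (hcs : ∀ α : G →+ ZMod q, α ≠ 0 → ∑ i, c i * ZMod.castHom (dvd_refl q) 𝔽 (α (s i)) ≠ 0)
    {d n R N M : ℕ} (hR : 0 < R) (hG : Fintype.card G = R + 1) (hN : N = (d + 1) * R)
    (hM : M = N + Fintype.card G) (hn : N + 1 = n * Fintype.card G)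
    (p : ℕ → EuclideanSpace ℝ (Fin d)) :
    ∃ σ : List (ℕ × G), Good M σ ∧ σ.length = N + 1 ∧ overfull n σ = ∅ ∧
      (0 : Space (d + 1) G) ∈ convexHull ℝ {y | y ∈ σ.map (orbit (pointVec p))} := by
  by_contra hcon
  push Not at hcon
  have hNpos : 0 < N := by rw [hN]; positivity
  have hGq : ∀ g : G, q • g = 0 := fun g => ZModModule.char_nsmul_eq_zero q g
  have hcard : Fintype.card (Fin (d + 1) × {s : G // s ≠ 0}) = N := by
    simp [Fintype.card_subtype_compl, hG, hN]
  let e : Module.Basis (Fin N) ℝ (Space (d + 1) G) :=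
    (Pi.basisFun ℝ _).reindex (Fintype.equivFinOfCardEq hcard)
  obtain ⟨v, hv, hv0, hgen⟩ := exists_generic_inter_eq_zero (𝔽 := 𝔽) e (pointVec p)
    {σ | (Good M σ ∧ σ.length = N + 1) ∧ overfull n σ = ∅}
    ((finite_good M (N + 1)).subset fun σ h => h.1)
    fun σ h => hcon σ h.1.1 h.1.2 h.2
  have h0 : chain q c s N (fun σ => inter 𝔽 e (σ.map (orbit v))) = 0 := by
    refine chain_eq_zero_of_big hq c s hcs hM (Big := overfull n) ?_ ?_ (overfull_listAct n)
      (fun σ τ h => overfull_mono n h) (fun σ h => overfull_ne_univ ?_ h) ?_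
    · intro g σ
      have h1 : (listAct vertAct g σ).map (orbit v) = (σ.map (orbit v)).map (rep g) := by
        simp only [listAct, List.map_map]
        exact List.map_congr_left fun x _ => orbit_vertAct v g x
      rw [h1]
      exact inter_map e hq _ (rep_pow hGq g) _
    · intro σ hσ hl
      rw [← dif_map]
      refine inter_cocycle e hNpos _ (by simpa using hl) fun t ht htl => ?_
      obtain ⟨τ, hτ, rfl⟩ := List.sublist_map_iff.1 ht
      have := hgen M τ [] (hσ.sublist hτ) ⟨by simp, List.Pairwise.nil⟩ (by simpa using htl)
      rwa [List.map_nil, List.append_nil] at this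
    · rw [add_mul, ← hn]
      omega
    · intro σ h1 h2 h3
      by_contra h4
      exact h3 (hv σ ⟨⟨h1, h2⟩, Finset.not_nonempty_iff_eq_empty.1 h4⟩)
  refine chain_ne_zero (F := orbit v) (b := ind) (ρ := rep) (e := e) hq c s hcs hNpos
    (M := M) (by omega) isAct_blockAct (rep_pow hGq) (fun g x => orbit_vertAct v g x)
    (fun g x => ind_blockAct g x) Flags (fun τ τ' h h' => h.sublist h') (fun g τ h => h.act g)
    (fun τ h h' => h.exists_ne h') (hgen M) (cycle e 𝔽 hN) (cycle_congr e hN)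
    (cycle_dif e hN hNpos) (cycle_tr e hq hGq hN) ?_ h0
  have h1 : orbit v ((0, 0) : ℕ × G) = v 0 := rep_zero _
  rw [h1, cycle_inter e hN hG _ hv0]
  exact one_ne_zero

end Main

/-- The linear van Kampen–Flores theorem for prime powers, allowing repeated points. -/
theorem exists_disjoint_convexHull_inter {q m R k M : ℕ} (hq : q.Prime) (hm : m ≠ 0) (hR : 0 < R)
    (hRq : R + 1 = q ^ m) (hM : M = R * (k * (R + 1) + 2) + 1)
    (p : Fin M → EuclideanSpace ℝ (Fin (k * (R + 1)))) :
    ∃ A : Fin (R + 1) → Finset (Fin M), (∀ s t, s ≠ t → Disjoint (A s) (A t)) ∧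
      (∀ s, (A s).card = k * R + 1) ∧ (⋂ s, convexHull ℝ (p '' (A s))).Nonempty := by
  classical
  have : Fact q.Prime := ⟨hq⟩
  let _ : Fintype (GaloisField q m) := Fintype.ofFinite _
  have hcard : Fintype.card (GaloisField q m) = R + 1 := by
    rw [hRq, ← Nat.card_eq_fintype_card, GaloisField.card q m hm]
  let b := Module.finBasis (ZMod q) (GaloisField q m)
  have hcs : ∀ α : GaloisField q m →+ ZMod q, α ≠ 0 →
      ∑ i, b i * ZMod.castHom (dvd_refl q) (GaloisField q m) (α (b i)) ≠ 0 := by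
    intro α hα h
    apply hα
    have h1 : ∑ i, α (b i) • b i = 0 := by
      rw [← h]
      refine Finset.sum_congr rfl fun i _ => ?_
      rw [Algebra.smul_def, mul_comm]
      congr 1
      exact congrArg (fun f : ZMod q →+* GaloisField q m => f (α (b i))) (Subsingleton.elim _ _)
    have h2 := Fintype.linearIndependent_iff.1 b.linearIndependent _ h1
    have h3 : α.toZModLinearMap q = 0 := b.ext fun i => h2 i
    ext x
    exact congrArg (fun f : GaloisField q m →ₗ[ZMod q] ZMod q => f x) h3
  let p' : ℕ → EuclideanSpace ℝ (Fin (k * (R + 1))) := fun i => if h : i < M then p ⟨i, h⟩ else 0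
  obtain ⟨σ, hσ, hl, ho, h0⟩ := exists_balanced_simplex hq b b hcs (d := k * (R + 1))
    (n := k * R + 1) (R := R) (M := M) hR hcard rfl (by rw [hM, hcard]; ring)
    (by rw [hcard]; ring) p'
  obtain ⟨x, hx⟩ := exists_common_point p' σ h0
  let θ : Fin (R + 1) ≃ GaloisField q m := (Fintype.equivFinOfCardEq hcard).symm
  refine ⟨fun s => labelClass M σ (θ s), fun s t hst => disjoint_labelClass hσ (θ.injective.ne hst),
    fun s => ?_, x, Set.mem_iInter.2 fun s => ?_⟩
  · rw [card_labelClass hσ]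
    exact count_eq_of_overfull_eq_empty (by rw [hl, hcard]; ring) ho _
  · refine convexHull_mono ?_ (hx (θ s))
    rintro _ ⟨i, hi, rfl⟩
    have hiM : i < M := hσ.2 _ hi
    exact ⟨⟨i, hiM⟩, mem_labelClass.2 hi, by simp [p', hiM]⟩

end VKF

/-- Linear `r`-fold van Kampen–Flores theorem for prime powers: if `r` is a prime power
and `k > 0`, then from any `(r-1)(kr+2)+1` pairwise distinct points in `ℝ^{kr}` one can
choose `r` pairwise disjoint `(k(r-1)+1)`-tuples whose convex hulls have a common
point. -/
theorem stmt_11 (r k : ℕ) (hk : 0 < k)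
    (hr : ∃ q m : ℕ, Nat.Prime q ∧ 1 ≤ m ∧ r = q ^ m)
    (p : Fin ((r - 1) * (k * r + 2) + 1) → EuclideanSpace ℝ (Fin (k * r)))
    (hp : Function.Injective p) :
    ∃ A : Fin r → Finset (Fin ((r - 1) * (k * r + 2) + 1)),
      (∀ s t : Fin r, s ≠ t → Disjoint (A s) (A t)) ∧
      (∀ s : Fin r, (A s).card = k * (r - 1) + 1) ∧
      (⋂ s : Fin r, convexHull ℝ (p '' (A s))).Nonempty := by
  obtain ⟨q, m, hq, hm, hrq⟩ := hr
  have hr1 : 1 < r := hrq ▸ Nat.one_lt_pow (by omega) hq.one_lt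
  obtain ⟨R, rfl⟩ : ∃ R, r = R + 1 := ⟨r - 1, by omega⟩
  exact VKF.exists_disjoint_convexHull_inter hq (by omega) (by omega) hrq rfl p
end

section
/- (Topological Radon theorem.) Let d be a positive integer and let f be a continuous map from the standard simplex Δ_{d+1} = stdSimplex ℝ (Fin (d+2)) to EuclideanSpace ℝ (Fin d). Then there exist two disjoint nonempty subsets A, B ⊆ Fin (d+2) such that the images under f of the faces of Δ_{d+1} spanned by A and by B intersect: f '' {x ∈ Δ_{d+1} : ∀ i ∉ A, x i = 0} ∩ f '' {x ∈ Δ_{d+1} : ∀ i ∉ B, x i = 0} is nonempty. -/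
/-- Mod 2 chains on ordered simplices, an ordered simplex being the list of its vertices.
The empty list is the augmentation simplex. -/
abbrev ListChain (V : Type*) := List V →₀ ZMod 2

namespace ListChain

open Finsupp

variable {V W M : Type*} [AddCommGroup M] [Module (ZMod 2) M]

/-- The chains supported on a set of simplices. -/
abbrev on (s : Set (List V)) : Submodule (ZMod 2) (ListChain V) :=
  Finsupp.supported (ZMod 2) (ZMod 2) s

theorem single_mem_on {s : Set (List V)} {l : List V} (hl : l ∈ s) :
    (single l 1 : ListChain V) ∈ on s :=
  Finsupp.single_mem_supported _ _ hl

theorem eq_of_mem_on {s : Set (List V)} {F G : ListChain V →ₗ[ZMod 2] M}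
    (h : ∀ l ∈ s, F (single l 1) = G (single l 1)) {c : ListChain V} (hc : c ∈ on s) :
    F c = G c := by
  rw [on, Finsupp.supported_eq_span_single] at hc
  refine LinearMap.eqOn_span (s := (fun i => single i 1) '' s) ?_ hc
  rintro _ ⟨l, hl, rfl⟩
  exact h l hl

theorem map_mem_of_mem_on {s : Set (List V)} {F : ListChain V →ₗ[ZMod 2] M}
    {P : Submodule (ZMod 2) M} (h : ∀ l ∈ s, F (single l 1) ∈ P) {c : ListChain V}
    (hc : c ∈ on s) : F c ∈ P := by
  rw [on, Finsupp.supported_eq_span_single] at hc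
  have : Submodule.span (ZMod 2) ((fun i => single i 1) '' s) ≤ P.comap F := by
    rw [Submodule.span_le]
    rintro _ ⟨l, hl, rfl⟩
    exact h l hl
  exact this hc

theorem hom_ext {F G : ListChain V →ₗ[ZMod 2] M}
    (h : ∀ l, F (single l 1) = G (single l 1)) (c : ListChain V) : F c = G c :=
  eq_of_mem_on (s := Set.univ) (fun l _ => h l) (by simp)

/-- Adjoin a new first vertex to every simplex of a chain. -/
noncomputable def cone (x : V) : ListChain V →ₗ[ZMod 2] ListChain V :=
  Finsupp.lmapDomain _ _ (List.cons x)

@[simp]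
theorem cone_single (x : V) (l : List V) : cone x (single l 1) = single (x :: l) 1 := by
  simp [cone]

/-- The boundary of a single simplex. -/
noncomputable def simplexBoundary : List V → ListChain V
  | [] => 0
  | x :: l => single l 1 + cone x (simplexBoundary l)

/-- The boundary operator of the augmented ordered chain complex. -/
noncomputable def boundary : ListChain V →ₗ[ZMod 2] ListChain V :=
  Finsupp.linearCombination _ simplexBoundary

@[simp]
theorem boundary_single_nil : boundary (single ([] : List V) 1) = 0 := by
  simp [boundary, simplexBoundary]

@[simp]
theorem boundary_single_cons (x : V) (l : List V) :
    boundary (single (x :: l) 1) = single l 1 + cone x (boundary (single l 1)) := by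
  simp [boundary, simplexBoundary]

theorem boundary_cone (x : V) (c : ListChain V) :
    boundary (cone x c) = c + cone x (boundary c) :=
  hom_ext (F := boundary ∘ₗ cone x) (G := LinearMap.id + cone x ∘ₗ boundary)
    (fun l => by simp) c

@[simp]
theorem boundary_boundary (c : ListChain V) : boundary (boundary c) = 0 := by
  refine hom_ext (F := boundary ∘ₗ boundary) (G := 0) (fun l => ?_) c
  induction l with
  | nil => simp
  | cons x l ih =>
    simp only [LinearMap.comp_apply, LinearMap.zero_apply] at ih
    simp [boundary_cone, ih, ZModModule.add_self]

theorem cone_mem_on {s t : Set (List V)} {x : V} (h : ∀ l ∈ s, x :: l ∈ t) {c : ListChain V}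
    (hc : c ∈ on s) : cone x c ∈ on t :=
  map_mem_of_mem_on (fun l hl => by simpa using single_mem_on (h l hl)) hc

theorem boundary_single_mem_on (l : List V) :
    boundary (single l 1) ∈ on {m | m.Sublist l ∧ m.length + 1 = l.length} := by
  induction l with
  | nil => simp
  | cons x l ih =>
    rw [boundary_single_cons]
    exact add_mem (single_mem_on (by simp)) (cone_mem_on (fun m hm => by simpa using hm) ih)

theorem boundary_mem_on {s t : Set (List V)}
    (h : ∀ l ∈ s, ∀ m : List V, m.Sublist l → m.length + 1 = l.length → m ∈ t)
    {c : ListChain V} (hc : c ∈ on s) : boundary c ∈ on t :=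
  map_mem_of_mem_on (fun l hl => Finsupp.supported_mono
    (fun m hm => h l hl m hm.1 hm.2) (boundary_single_mem_on l)) hc

theorem boundary_mem_on_length {n : ℕ} {c : ListChain V}
    (hc : c ∈ on {l : List V | l.length = n + 1}) :
    boundary c ∈ on {l : List V | l.length = n} :=
  boundary_mem_on (fun l hl m _ hm => by
    simp only [Set.mem_ofPred_eq] at hl ⊢
    omega) hc

/-- The chain map induced by a map of vertices. -/
noncomputable def push (ν : V → W) : ListChain V →ₗ[ZMod 2] ListChain W :=
  Finsupp.lmapDomain _ _ (List.map ν)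

@[simp]
theorem push_single (ν : V → W) (l : List V) :
    push ν (single l 1) = single (l.map ν) 1 := by
  simp [push]

theorem push_cone (ν : V → W) (x : V) (c : ListChain V) :
    push ν (cone x c) = cone (ν x) (push ν c) :=
  hom_ext (F := push ν ∘ₗ cone x) (G := cone (ν x) ∘ₗ push ν) (fun l => by simp) c

theorem boundary_push (ν : V → W) (c : ListChain V) :
    boundary (push ν c) = push ν (boundary c) := by
  refine hom_ext (F := boundary ∘ₗ push ν) (G := push ν ∘ₗ boundary) (fun l => ?_) c
  induction l with
  | nil => simp
  | cons x l ih =>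
    simp only [LinearMap.comp_apply, push_single] at ih
    simp [push_cone, ih]

theorem push_push_of_involutive {ν : V → V} (hν : Function.Involutive ν) (c : ListChain V) :
    push ν (push ν c) = c :=
  hom_ext (F := push ν ∘ₗ push ν) (G := LinearMap.id)
    (fun l => by simp [hν.comp_self]) c

section Cochains

variable (s : ℕ → V → ZMod 2)

/-- Multiply a cochain by a function of the first vertex. -/
noncomputable def headMul (t : V → ZMod 2) (φ : ListChain V →ₗ[ZMod 2] ZMod 2) :
    ListChain V →ₗ[ZMod 2] ZMod 2 :=
  Finsupp.linearCombination _ fun l => match l with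
    | [] => 0
    | x :: l => t x * φ (single (x :: l) 1)

@[simp]
theorem headMul_nil (t : V → ZMod 2) (φ : ListChain V →ₗ[ZMod 2] ZMod 2) :
    headMul t φ (single [] 1) = 0 := by
  simp [headMul]

@[simp]
theorem headMul_cons (t : V → ZMod 2) (φ : ListChain V →ₗ[ZMod 2] ZMod 2) (x : V)
    (l : List V) : headMul t φ (single (x :: l) 1) = t x * φ (single (x :: l) 1) := by
  simp [headMul]

theorem headMul_cone (t : V → ZMod 2) (φ : ListChain V →ₗ[ZMod 2] ZMod 2) (x : V)
    (c : ListChain V) : headMul t φ (cone x c) = t x * φ (cone x c) :=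
  hom_ext (F := headMul t φ ∘ₗ cone x) (G := t x • (φ ∘ₗ cone x)) (fun l => by simp) c

/-- The cup product of the coboundaries of the `0`-cochains `s 0, …, s (n - 1)`. -/
noncomputable def cupCoboundary : ℕ → ListChain V →ₗ[ZMod 2] ZMod 2
  | 0 => Finsupp.linearCombination _ fun l => if l.length = 1 then 1 else 0
  | n + 1 => headMul (s n) (cupCoboundary n) ∘ₗ boundary

@[simp]
theorem cupCoboundary_zero_single (l : List V) :
    cupCoboundary s 0 (single l 1) = if l.length = 1 then 1 else 0 := by
  simp [cupCoboundary]

theorem cupCoboundary_succ (n : ℕ) (c : ListChain V) :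
    cupCoboundary s (n + 1) c = headMul (s n) (cupCoboundary s n) (boundary c) := rfl

@[simp]
theorem cupCoboundary_boundary (n : ℕ) (c : ListChain V) :
    cupCoboundary s n (boundary c) = 0 := by
  cases n with
  | succ n => simp [cupCoboundary_succ]
  | zero =>
    refine hom_ext (F := cupCoboundary s 0 ∘ₗ boundary) (G := 0) (fun l => ?_) c
    match l with
    | [] => simp
    | [x] => simp
    | [x, y] => simpa using CharTwo.add_self_eq_zero (1 : ZMod 2)
    | x :: y :: z :: l =>
      have h := boundary_single_mem_on (x :: y :: z :: l)
      refine eq_of_mem_on (F := cupCoboundary s 0) (G := 0) (fun m hm => ?_) h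
      have h2 := hm.2
      simp only [List.length_cons] at h2
      have : m.length ≠ 1 := by omega
      simp [this]

theorem cupCoboundary_succ_cons_cons (n : ℕ) (x y : V) (l : List V) :
    cupCoboundary s (n + 1) (single (x :: y :: l) 1) =
      (s n y + s n x) * cupCoboundary s n (single (y :: l) 1) := by
  have h := cupCoboundary_boundary s n (single (x :: y :: l) 1)
  rw [boundary_single_cons, map_add, CharTwo.add_eq_zero] at h
  rw [cupCoboundary_succ, boundary_single_cons, map_add, headMul_cone, ← h, headMul_cons]
  ring

theorem cupCoboundary_eq_zero {n j : ℕ} (hj : j < n) {l : List V} (hl : l.length = n + 1)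
    (hs : ∀ x ∈ l, ∀ y ∈ l, s j x = s j y) : cupCoboundary s n (single l 1) = 0 := by
  induction n generalizing l with
  | zero => omega
  | succ n ih =>
    match l, hl with
    | x :: y :: l, hl =>
      rw [cupCoboundary_succ_cons_cons]
      rcases eq_or_ne j n with rfl | hne
      · rw [hs y (by simp) x (by simp), CharTwo.add_self_eq_zero, zero_mul]
      · rw [ih (by omega) (by simpa using hl)
          fun a ha b hb => hs a (List.mem_cons_of_mem _ ha) b (List.mem_cons_of_mem _ hb),
          mul_zero]

variable {s} {ν : V → V} {P : V → Prop}

@[simp]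
theorem cupCoboundary_nil (n : ℕ) : cupCoboundary s n (single [] 1) = 0 := by
  cases n <;> simp [cupCoboundary_succ]

theorem headMul_push {t : V → ZMod 2} {φ : ListChain V →ₗ[ZMod 2] ZMod 2}
    (ht : ∀ x, P x → t (ν x) = t x + 1) (hnil : φ (single [] 1) = 0)
    (hφ : ∀ c ∈ on {l : List V | ∀ x ∈ l, P x}, φ (push ν c) = φ c) {c : ListChain V}
    (hc : c ∈ on {l : List V | ∀ x ∈ l, P x}) :
    headMul t φ (push ν c) = headMul t φ c + φ c := by
  refine eq_of_mem_on (F := headMul t φ ∘ₗ push ν) (G := headMul t φ + φ) (fun l hl => ?_) hc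
  match l with
  | [] => simp [hnil]
  | x :: l =>
    have h := hφ _ (single_mem_on hl)
    rw [push_single, List.map_cons] at h
    simp [h, ht x (hl x (by simp))]
    ring

theorem cupCoboundary_push {n : ℕ} (hs : ∀ j < n, ∀ x, P x → s j (ν x) = s j x + 1)
    {c : ListChain V} (hc : c ∈ on {l : List V | ∀ x ∈ l, P x}) :
    cupCoboundary s n (push ν c) = cupCoboundary s n c := by
  induction n generalizing c with
  | zero =>
    exact hom_ext (F := cupCoboundary s 0 ∘ₗ push ν) (G := cupCoboundary s 0)
      (fun l => by simp) c
  | succ n ih =>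
    have hc' : boundary c ∈ on {l : List V | ∀ x ∈ l, P x} :=
      boundary_mem_on (s := {l : List V | ∀ x ∈ l, P x})
        (fun l hl m hm _ x hx => hl x (hm.subset hx)) hc
    rw [cupCoboundary_succ, cupCoboundary_succ, boundary_push,
      headMul_push (hs n (by omega)) (cupCoboundary_nil n)
        (fun c hc => ih (fun j hj => hs j (by omega)) hc) hc',
      cupCoboundary_boundary, add_zero]

/-- A sequence of chains filling the hemispheres of an antipodal sphere pairs nontrivially with
the cup product of the coboundaries of antipodal `0`-cochains. -/
theorem cupCoboundary_hemisphere {h : ℕ → ListChain V} {n : ℕ} {x : V}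
    (hs : ∀ j < n, ∀ x, P x → s j (ν x) = s j x + 1) (h0 : h 0 = single [x] 1)
    (hP : ∀ k < n, h k ∈ on {l : List V | ∀ x ∈ l, P x})
    (hh : ∀ k < n, boundary (h (k + 1)) = h k + push ν (h k)) :
    cupCoboundary s n (h n) = 1 := by
  induction n with
  | zero => simp [h0]
  | succ n ih =>
    have hn : ∀ j < n, ∀ x, P x → s j (ν x) = s j x + 1 := fun j hj => hs j (by omega)
    rw [cupCoboundary_succ, hh n (by omega), map_add,
      headMul_push (hs n (by omega)) (cupCoboundary_nil n)
        (fun c hc => cupCoboundary_push hn hc) (hP n (by omega)),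
      ih hn (fun k hk => hP k (by omega)) (fun k hk => hh k (by omega)),
      ← add_assoc, CharTwo.add_self_eq_zero, zero_add]

end Cochains

section Subdivision

theorem norm_sum_map_sub_le {E : Type*} [SeminormedAddCommGroup E] {l : List E} {v : E}
    {D : ℝ} (h : ∀ x ∈ l, dist x v ≤ D) :
    ‖(l.map (· - v)).sum‖ ≤ l.length * D := by
  induction l with
  | nil => simp
  | cons x l ih =>
    have h1 := h x (by simp)
    have h2 := ih fun y hy => h y (by simp [hy])
    rw [dist_eq_norm] at h1
    simp only [List.map_cons, List.sum_cons, List.length_cons, Nat.cast_add, Nat.cast_one]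
    linarith [norm_add_le (x - v) (l.map (· - v)).sum]

variable {E : Type*} [NormedAddCommGroup E] [NormedSpace ℝ E]

/-- The barycenter of a list of points. -/
noncomputable def barycenter (l : List E) : E := (l.length : ℝ)⁻¹ • l.sum

theorem barycenter_map_neg (l : List E) : barycenter (l.map Neg.neg) = -barycenter l := by
  have : (l.map Neg.neg).sum = -l.sum := by
    induction l with
    | nil => simp
    | cons x l ih => simp [ih, add_comm]
  simp [barycenter, this]

theorem barycenter_mem_convexHull {l : List E} (hl : l ≠ []) :
    barycenter l ∈ convexHull ℝ {x | x ∈ l} := by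
  have hpos : (l.length : ℝ) ≠ 0 := by simpa using hl
  have : barycenter l = ∑ i : Fin l.length, (l.length : ℝ)⁻¹ • l[i] := by
    rw [← Finset.smul_sum, barycenter]
    exact congrArg _ (Fin.sum_univ_getElem l).symm
  rw [this]
  refine (convex_convexHull ℝ _).sum_mem (fun _ _ => by positivity) (by simp [hpos])
    fun i _ => subset_convexHull ℝ _ ?_
  simp

theorem dist_barycenter_le {l : List E} {v : E} {D : ℝ} (hv : v ∈ l)
    (h : ∀ x ∈ l, dist x v ≤ D) : dist v (barycenter l) ≤ (1 - (l.length : ℝ)⁻¹) * D := by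
  have hpos : (0 : ℝ) < l.length := by
    exact_mod_cast List.length_pos_of_mem hv
  have hsum : (l.map (· - v)).sum = l.sum - (l.length : ℝ) • v := by
    clear hv h hpos
    induction l with
    | nil => simp
    | cons x l ih =>
      simp only [List.map_cons, List.sum_cons, ih, List.length_cons, Nat.cast_add, Nat.cast_one]
      module
  have key : ‖(l.map (· - v)).sum‖ ≤ (l.length - 1) * D := by
    obtain ⟨a, b, rfl⟩ := List.append_of_mem hv
    have ha := norm_sum_map_sub_le (l := a) (v := v) fun x hx => h x (by simp [hx])
    have hb := norm_sum_map_sub_le (l := b) (v := v) fun x hx => h x (by simp [hx])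
    simp only [List.map_append, List.map_cons, sub_self, List.sum_append, List.sum_cons,
      zero_add, List.length_append, List.length_cons, Nat.cast_add, Nat.cast_one]
    linarith [norm_add_le (a.map (· - v)).sum (b.map (· - v)).sum]
  have : barycenter l - v = (l.length : ℝ)⁻¹ • (l.map (· - v)).sum := by
    rw [hsum, barycenter, smul_sub, inv_smul_smul₀ hpos.ne']
  rw [dist_comm, dist_eq_norm, this, norm_smul, norm_inv, Real.norm_natCast]
  calc (l.length : ℝ)⁻¹ * ‖(l.map (· - v)).sum‖
      ≤ (l.length : ℝ)⁻¹ * ((l.length - 1) * D) := by gcongr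
    _ = (1 - (l.length : ℝ)⁻¹) * D := by field_simp

/-- Barycentric subdivision of chains of simplices with `n` vertices. -/
noncomputable def subdivision : ℕ → ListChain E →ₗ[ZMod 2] ListChain E
  | 0 => LinearMap.id
  | n + 1 => Finsupp.linearCombination _ fun l =>
      cone (barycenter l) (subdivision n (boundary (single l 1)))

theorem subdivision_zero (c : ListChain E) : subdivision 0 c = c := by
  simp [subdivision]

theorem subdivision_succ_single (n : ℕ) (l : List E) : subdivision (n + 1) (single l 1) =
    cone (barycenter l) (subdivision n (boundary (single l 1))) := by
  simp [subdivision]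

theorem subdivision_push_neg (n : ℕ) (c : ListChain E) :
    subdivision n (push Neg.neg c) = push Neg.neg (subdivision n c) := by
  induction n generalizing c with
  | zero => simp [subdivision_zero]
  | succ n ih =>
    rw [← LinearMap.comp_apply, ← LinearMap.comp_apply]
    refine hom_ext (fun l => ?_) c
    have := ih (boundary (single l 1))
    rw [← boundary_push, push_single] at this
    simp only [LinearMap.comp_apply, push_single, subdivision_succ_single, this, push_cone,
      barycenter_map_neg]

theorem boundary_subdivision {n : ℕ} {c : ListChain E}
    (hc : c ∈ on {l : List E | l.length = n + 1}) :
    boundary (subdivision (n + 1) c) = subdivision n (boundary c) := by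
  induction n generalizing c with
  | zero =>
    rw [← LinearMap.comp_apply, ← LinearMap.comp_apply]
    refine eq_of_mem_on (fun l hl => ?_) hc
    obtain ⟨x, rfl⟩ := List.length_eq_one_iff.1 hl
    simp [subdivision_succ_single, subdivision_zero]
  | succ n ih =>
    rw [← LinearMap.comp_apply, ← LinearMap.comp_apply]
    refine eq_of_mem_on (fun l hl => ?_) hc
    have := ih (boundary_mem_on_length (single_mem_on hl))
    simp only [LinearMap.comp_apply, subdivision_succ_single (n + 1), boundary_cone, this,
      boundary_boundary, map_zero, add_zero]

theorem subdivision_single_mem_on {n N : ℕ} (hN : n ≤ N) {D : ℝ} (hD : 0 ≤ D) {l : List E}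
    (hl : l.length = n) (hdist : ∀ x ∈ l, ∀ y ∈ l, dist x y ≤ D) :
    subdivision n (single l 1) ∈ on {m : List E | m.length = n ∧
      (∀ x ∈ m, x ∈ convexHull ℝ {x | x ∈ l}) ∧
      ∀ x ∈ m, ∀ y ∈ m, dist x y ≤ (1 - (N : ℝ)⁻¹) * D} := by
  induction n generalizing l with
  | zero =>
    obtain rfl := List.length_eq_zero_iff.1 hl
    rw [subdivision_zero]
    exact single_mem_on (by simp)
  | succ n ih =>
    rw [subdivision_succ_single]
    have hne : l ≠ [] := by
      rintro rfl
      simp at hl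
    have hr : (1 - (l.length : ℝ)⁻¹) * D ≤ (1 - (N : ℝ)⁻¹) * D := by
      have : (0 : ℝ) < l.length := by
        rw [hl]
        positivity
      have : (l.length : ℝ) ≤ N := by
        rw [hl]
        exact_mod_cast hN
      gcongr
    have hr0 : 0 ≤ (1 - (N : ℝ)⁻¹) * D := by
      refine mul_nonneg (sub_nonneg.2 (inv_le_one_of_one_le₀ ?_)) hD
      exact_mod_cast (Nat.succ_pos n).trans_le hN
    have hball : ∀ y ∈ convexHull ℝ {x | x ∈ l},
        dist y (barycenter l) ≤ (1 - (N : ℝ)⁻¹) * D := fun y hy =>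
      convexHull_min (fun v hv => (dist_barycenter_le hv fun x hx => hdist x hx v hv).trans hr)
        (convex_closedBall _ _) hy
    refine cone_mem_on (s := {m : List E | m.length = n ∧
      (∀ x ∈ m, x ∈ convexHull ℝ {x | x ∈ l}) ∧
      ∀ x ∈ m, ∀ y ∈ m, dist x y ≤ (1 - (N : ℝ)⁻¹) * D}) ?_ ?_
    · rintro m ⟨hm, hconv, hd⟩
      refine ⟨by simp [hm], ?_, ?_⟩
      · intro x hx
        rcases List.mem_cons.1 hx with rfl | hx
        exacts [barycenter_mem_convexHull hne, hconv x hx]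
      · intro x hx y hy
        rcases List.mem_cons.1 hx with rfl | hx <;> rcases List.mem_cons.1 hy with rfl | hy
        · simpa using hr0
        · rw [dist_comm]
          exact hball y (hconv y hy)
        · exact hball x (hconv x hx)
        · exact hd x hx y hy
    · refine map_mem_of_mem_on (fun m hm => ?_) (boundary_single_mem_on l)
      refine Finsupp.supported_mono ?_ (ih (by omega) (l := m) (by have := hm.2; omega)
        fun x hx y hy => hdist x (hm.1.subset hx) y (hm.1.subset hy))
      rintro p ⟨hp, hconv, hd⟩
      exact ⟨hp, fun x hx => convexHull_mono (fun y hy => hm.1.subset hy) (hconv x hx), hd⟩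

end Subdivision

section Sphere

/-- The facet of the cross-polytope with sign vector `ε`. -/
def orthantFace {m : ℕ} (ε : Fin m → ℝ) : Set (Fin m → ℝ) :=
  {x | (∀ i, 0 ≤ ε i * x i) ∧ ∑ i, ε i * x i = 1}

theorem convex_orthantFace {m : ℕ} (ε : Fin m → ℝ) : Convex ℝ (orthantFace ε) := by
  rintro x ⟨hx, hx1⟩ y ⟨hy, hy1⟩ a b ha hb hab
  have h : ∀ i, ε i * (a • x + b • y) i = a * (ε i * x i) + b * (ε i * y i) := fun i => by
    simp only [Pi.add_apply, Pi.smul_apply, smul_eq_mul]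
    ring
  refine ⟨fun i => ?_, ?_⟩
  · rw [h]
    have := hx i
    have := hy i
    positivity
  · simp only [h, Finset.sum_add_distrib, ← Finset.mul_sum, hx1, hy1, mul_one, hab]

theorem sum_abs_of_mem_orthantFace {m : ℕ} {ε x : Fin m → ℝ} (hε : ∀ i, |ε i| = 1)
    (hx : x ∈ orthantFace ε) : ∑ i, |x i| = 1 := by
  rw [← hx.2]
  refine Finset.sum_congr rfl fun i _ => ?_
  rw [← abs_of_nonneg (hx.1 i), abs_mul, hε, one_mul]

/-- The sequence `h` consists of chains that successively fill a hemisphere of the boundary of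
the cross-polytope, by simplices of diameter at most `D` contained in facets. -/
structure FillsHemispheres (m : ℕ) (D : ℝ) (h : ℕ → ListChain (Fin m → ℝ)) : Prop where
  zero : ∃ x, h 0 = single [x] 1
  boundary_succ : ∀ k, k + 1 < m → boundary (h (k + 1)) = h k + push Neg.neg (h k)
  mem_on : ∀ k < m, h k ∈ on {l : List (Fin m → ℝ) | l.length = k + 1 ∧
    (∃ ε : Fin m → ℝ, (∀ i, |ε i| = 1) ∧ ∀ x ∈ l, x ∈ orthantFace ε) ∧
    ∀ x ∈ l, ∀ y ∈ l, dist x y ≤ D}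

/-- The chains filling hemispheres of the boundary of the cross-polytope by facets. -/
noncomputable def crossPolytopeChain (m : ℕ) : ℕ → ListChain (Fin m → ℝ)
  | 0 => single [fun i => if i.val = 0 then 1 else 0] 1
  | k + 1 => cone (fun i => if i.val = k + 1 then 1 else 0)
      (crossPolytopeChain m k + push Neg.neg (crossPolytopeChain m k))

theorem boundary_crossPolytopeChain (m k : ℕ) : boundary (crossPolytopeChain m (k + 1)) =
    crossPolytopeChain m k + push Neg.neg (crossPolytopeChain m k) := by
  have h : boundary (crossPolytopeChain m k) + push Neg.neg (boundary (crossPolytopeChain m k)) =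
      0 := by
    induction k with
    | zero => simp [crossPolytopeChain, ZModModule.add_self]
    | succ k ih =>
      rw [crossPolytopeChain, boundary_cone, map_add boundary, boundary_push, ih, map_zero,
        add_zero, map_add, push_push_of_involutive neg_involutive, add_comm (push _ _),
        ZModModule.add_self]
  rw [crossPolytopeChain, boundary_cone, map_add, boundary_push, h, map_zero, add_zero]

theorem crossPolytopeChain_mem_on {m k : ℕ} (hk : k < m) :
    crossPolytopeChain m k ∈ on {l : List (Fin m → ℝ) | l.length = k + 1 ∧
      ∃ ε : Fin m → ℝ, (∀ i, |ε i| = 1) ∧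
        ∀ x ∈ l, x ∈ orthantFace ε ∧ ∀ i, k < i.val → x i = 0} := by
  induction k with
  | zero =>
    refine single_mem_on ⟨rfl, 1, by simp, fun x hx => ?_⟩
    obtain rfl := List.mem_singleton.1 hx
    refine ⟨⟨fun i => ?_, ?_⟩, fun i hi => if_neg hi.ne'⟩
    · simp only [Pi.one_apply, one_mul]
      split_ifs <;> norm_num
    · rw [Finset.sum_eq_single ⟨0, hk⟩] <;> simp [Fin.ext_iff]
  | succ k ih =>
    have ih := ih (by omega)
    refine cone_mem_on ?_ (add_mem ih (map_mem_of_mem_on (P := on _) ?_ ih))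
    · rintro l ⟨hl, ε, hε, hx⟩
      refine ⟨by simp [hl], fun i => if i.val = k + 1 then 1 else ε i, fun i => ?_, ?_⟩
      · beta_reduce
        split_ifs
        · simp
        · exact hε i
      · intro x hxl
        rcases List.mem_cons.1 hxl with rfl | hxl
        · refine ⟨⟨fun i => ?_, ?_⟩, fun i hi => if_neg hi.ne'⟩
          · beta_reduce
            split_ifs <;> norm_num
          · rw [Finset.sum_eq_single ⟨k + 1, hk⟩] <;> simp +contextual [Fin.ext_iff]
        · obtain ⟨⟨h1, h2⟩, h3⟩ := hx x hxl
          have h : ∀ i : Fin m, (if i.val = k + 1 then 1 else ε i) * x i = ε i * x i := by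
            intro i
            split_ifs with hi
            · rw [h3 i (by omega), mul_zero, mul_zero]
            · rfl
          refine ⟨⟨fun i => ?_, ?_⟩, fun i hi => h3 i (by omega)⟩
          · rw [h]
            exact h1 i
          · simp only [h, h2]
    · rintro l ⟨hl, ε, hε, hx⟩
      rw [push_single]
      refine single_mem_on ⟨by simp [hl], -ε, by simpa using hε, fun x hxl => ?_⟩
      obtain ⟨y, hy, rfl⟩ := List.mem_map.1 hxl
      simpa [orthantFace] using hx y hy

theorem fillsHemispheres_crossPolytopeChain (m : ℕ) :
    FillsHemispheres m 2 (crossPolytopeChain m) where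
  zero := ⟨_, rfl⟩
  boundary_succ k _ := boundary_crossPolytopeChain m k
  mem_on k hk := by
    refine Finsupp.supported_mono ?_ (crossPolytopeChain_mem_on hk)
    rintro l ⟨hl, ε, hε, hx⟩
    have hle : ∀ x ∈ l, ∀ i, |x i| ≤ 1 := fun x hxl i =>
      (Finset.single_le_sum (f := fun i => |x i|) (fun i _ => abs_nonneg _)
        (Finset.mem_univ i)).trans_eq (sum_abs_of_mem_orthantFace hε (hx x hxl).1)
    refine ⟨hl, ⟨ε, hε, fun x hxl => (hx x hxl).1⟩, fun x hxl y hyl => ?_⟩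
    refine (dist_pi_le_iff (by norm_num)).2 fun i => ?_
    rw [Real.dist_eq]
    linarith [abs_sub (x i) (y i), hle x hxl i, hle y hyl i]

theorem FillsHemispheres.subdivision {m : ℕ} {D : ℝ} {h : ℕ → ListChain (Fin m → ℝ)}
    (hh : FillsHemispheres m D h) (hD : 0 ≤ D) :
    FillsHemispheres m ((1 - (m : ℝ)⁻¹) * D) fun k => subdivision (k + 1) (h k) where
  zero := by
    obtain ⟨x, hx⟩ := hh.zero
    exact ⟨barycenter [x], by simp [hx, subdivision_succ_single, subdivision_zero]⟩
  boundary_succ k hk := by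
    rw [boundary_subdivision (Finsupp.supported_mono (fun l hl => hl.1) (hh.mem_on _ hk)),
      hh.boundary_succ k hk, map_add, subdivision_push_neg]
  mem_on k hk := by
    refine map_mem_of_mem_on ?_ (hh.mem_on k hk)
    rintro l ⟨hl, ⟨ε, hε, hx⟩, hdist⟩
    refine Finsupp.supported_mono ?_ (subdivision_single_mem_on hk hD hl hdist)
    rintro p ⟨hp, hconv, hd⟩
    exact ⟨hp, ⟨ε, hε, fun x hxp => convexHull_min hx (convex_orthantFace ε) (hconv x hxp)⟩, hd⟩

theorem exists_fillsHemispheres {m : ℕ} (hm : 0 < m) {D : ℝ} (hD : 0 < D) :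
    ∃ D' < D, ∃ h, FillsHemispheres m D' h := by
  have hm1 : (1 : ℝ) ≤ m := by exact_mod_cast hm
  have hr0 : 0 ≤ 1 - (m : ℝ)⁻¹ := sub_nonneg.2 (inv_le_one_of_one_le₀ hm1)
  have hr1 : 1 - (m : ℝ)⁻¹ < 1 := by
    have : 0 < (m : ℝ)⁻¹ := by positivity
    linarith
  have key : ∀ j : ℕ, ∃ h, FillsHemispheres m ((1 - (m : ℝ)⁻¹) ^ j * 2) h := by
    intro j
    induction j with
    | zero => exact ⟨_, by simpa using fillsHemispheres_crossPolytopeChain m⟩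
    | succ j ih =>
      obtain ⟨h, hh⟩ := ih
      exact ⟨_, by simpa only [pow_succ', mul_assoc] using hh.subdivision (by positivity)⟩
  obtain ⟨j, hj⟩ := exists_pow_lt_of_lt_one (half_pos hD) hr1
  exact ⟨_, by linarith, key j⟩

end Sphere

end ListChain

/-- The **Borsuk–Ulam theorem**: an odd map to `ℝ^d`, continuous away from the origin
of `ℝ^(d+1)`, has a nonzero zero. -/
theorem exists_ne_zero_eq_zero_of_odd {d : ℕ} {g : (Fin (d + 1) → ℝ) → Fin d → ℝ}
    (hg : ContinuousOn g {0}ᶜ) (hodd : ∀ x, x ≠ 0 → g (-x) = -g x) :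
    ∃ x, x ≠ 0 ∧ g x = 0 := by
  classical
  by_contra! hne
  set K : Set (Fin (d + 1) → ℝ) := {x | ∑ i, |x i| = 1}
  have hK0 : ∀ x ∈ K, x ≠ 0 := by
    rintro x hx rfl
    simp [K] at hx
  have hK : IsCompact K := by
    refine Metric.isCompact_of_isClosed_isBounded
      (isClosed_eq (by fun_prop) continuous_const) (isBounded_iff_forall_norm_le.2 ⟨1, ?_⟩)
    intro x hx
    refine (pi_norm_le_iff_of_nonneg zero_le_one).2 fun i => ?_
    exact (Finset.single_le_sum (f := fun i => |x i|) (fun i _ => abs_nonneg _)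
      (Finset.mem_univ i)).trans_eq hx
  let c : Fin d × Bool → Set (Fin (d + 1) → ℝ) := fun p =>
    {0}ᶜ ∩ g ⁻¹' {y | if p.2 then 0 < y p.1 else y p.1 < 0}
  have hc : ∀ p, IsOpen (c p) := by
    rintro ⟨i, b⟩
    refine hg.isOpen_inter_preimage isOpen_compl_singleton ?_
    cases b
    · simpa using isOpen_lt (continuous_apply i) continuous_const
    · simpa using isOpen_lt continuous_const (continuous_apply i)
  have hcover : K ⊆ ⋃ p, c p := by
    intro x hx
    obtain ⟨i, hi⟩ := Function.ne_iff.1 (hne x (hK0 x hx))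
    rcases lt_or_gt_of_ne hi with h | h
    · exact Set.mem_iUnion.2 ⟨(i, false), hK0 x hx, by simpa using h⟩
    · exact Set.mem_iUnion.2 ⟨(i, true), hK0 x hx, by simpa using h⟩
  obtain ⟨δ, hδ, hball⟩ := lebesgue_number_lemma_of_metric hK hc hcover
  obtain ⟨D, hD, h, hh⟩ := ListChain.exists_fillsHemispheres d.succ_pos hδ
  let s : ℕ → (Fin (d + 1) → ℝ) → ZMod 2 := fun j x =>
    if hj : j < d then
      if g x ⟨j, hj⟩ = 0 then (if 0 < toLex x then 1 else 0)
      else if 0 < g x ⟨j, hj⟩ then 1 else 0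
    else 0
  have hs : ∀ j < d, ∀ x, x ≠ 0 → s j (-x) = s j x + 1 := by
    intro j hj x hx
    have h2 : (0 : ZMod 2) = 1 + 1 := (CharTwo.add_self_eq_zero 1).symm
    simp only [s, hj, dif_pos, hodd x hx, Pi.neg_apply, neg_eq_zero, neg_pos, toLex_neg]
    split_ifs with h1 h3 h4 h4 h5 h6 h6
    · exact absurd h3 h4.not_gt
    · simp
    · exact h2
    · exact absurd (le_antisymm (not_lt.1 h4) (not_lt.1 h3)) (by simpa using hx)
    · exact absurd h5 h6.not_gt
    · simp
    · exact h2
    · exact absurd (le_antisymm (not_lt.1 h6) (not_lt.1 h5)) h1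
  obtain ⟨x₀, hx₀⟩ := hh.zero
  have h1 : ListChain.cupCoboundary s d (h d) = 1 := by
    refine ListChain.cupCoboundary_hemisphere (P := fun x => x ≠ 0) hs hx₀ (fun k hk => ?_)
      fun k hk => hh.boundary_succ k (by omega)
    refine Finsupp.supported_mono ?_ (hh.mem_on k (by omega))
    rintro l ⟨-, ⟨ε, hε, hx⟩, -⟩ x hxl
    exact hK0 x (ListChain.sum_abs_of_mem_orthantFace hε (hx x hxl))
  have h0 : ListChain.cupCoboundary s d (h d) = 0 := by
    refine ListChain.eq_of_mem_on (G := 0) ?_ (hh.mem_on d (by omega))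
    rintro l ⟨hl, ⟨ε, hε, hx⟩, hdist⟩
    obtain ⟨y, hy⟩ := List.exists_mem_of_length_pos (l := l) (by omega)
    obtain ⟨⟨i, b⟩, hi⟩ := hball y (ListChain.sum_abs_of_mem_orthantFace hε (hx y hy))
    refine ListChain.cupCoboundary_eq_zero s i.2 hl ?_
    have hconst : ∀ x ∈ l, s i x = if b then 1 else 0 := by
      intro x hxl
      have hx' := (hi (Metric.mem_ball.2 ((hdist x hxl y hy).trans_lt hD))).2
      cases b
      · have hx' : g x i < 0 := by simpa using hx'
        simp [s, hx'.ne, hx'.not_gt]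
      · have hx' : 0 < g x i := by simpa using hx'
        simp [s, hx'.ne', hx']
    intro x hxl z hzl
    rw [hconst x hxl, hconst z hzl]
  exact one_ne_zero (h1.symm.trans h0)

/-- The vector of coordinate sum zero extending `y`. -/
noncomputable def sumZeroExtension {n : ℕ} (y : Fin n → ℝ) : Fin (n + 1) → ℝ :=
  Fin.cons (-∑ i, y i) y

theorem sum_sumZeroExtension {n : ℕ} (y : Fin n → ℝ) : ∑ i, sumZeroExtension y i = 0 := by
  simp [sumZeroExtension, Fin.sum_univ_succ]

theorem sumZeroExtension_neg {n : ℕ} (y : Fin n → ℝ) (i : Fin (n + 1)) :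
    sumZeroExtension (-y) i = -sumZeroExtension y i := by
  cases i using Fin.cases <;> simp [sumZeroExtension]

theorem continuous_sumZeroExtension {n : ℕ} (i : Fin (n + 1)) :
    Continuous fun y : Fin n → ℝ => sumZeroExtension y i := by
  cases i using Fin.cases
  · simp only [sumZeroExtension, Fin.cons_zero]
    fun_prop
  · simp only [sumZeroExtension, Fin.cons_succ]
    fun_prop

theorem sum_max_sumZeroExtension_pos {n : ℕ} {y : Fin n → ℝ} (hy : y ≠ 0) :
    0 < ∑ j, max (sumZeroExtension y j) 0 := by
  refine (Finset.sum_nonneg fun j _ => le_max_right _ _).lt_of_ne' fun h => hy ?_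
  rw [Finset.sum_eq_zero_iff_of_nonneg fun j _ => le_max_right _ _] at h
  have hle : ∀ j ∈ Finset.univ, sumZeroExtension y j ≤ 0 := fun j hj => max_eq_right_iff.1 (h j hj)
  have h0 := (Finset.sum_eq_zero_iff_of_nonpos hle).1 (sum_sumZeroExtension y)
  ext i
  simpa [sumZeroExtension] using h0 i.succ (Finset.mem_univ _)

/-- The normalized positive part of the extension of `y` to a vector of coordinate sum zero. -/
noncomputable def positivePoint {n : ℕ} (y : Fin n → ℝ) : Fin (n + 1) → ℝ := fun i =>
  max (sumZeroExtension y i) 0 / ∑ j, max (sumZeroExtension y j) 0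

theorem positivePoint_mem_stdSimplex {n : ℕ} {y : Fin n → ℝ} (hy : y ≠ 0) :
    positivePoint y ∈ stdSimplex ℝ (Fin (n + 1)) := by
  have h := sum_max_sumZeroExtension_pos hy
  refine ⟨fun i => div_nonneg (le_max_right _ _) h.le, ?_⟩
  simp only [positivePoint, ← Finset.sum_div]
  exact div_self h.ne'

theorem continuousOn_positivePoint {n : ℕ} :
    ContinuousOn (positivePoint (n := n)) {0}ᶜ := by
  have h : ∀ i, Continuous fun y : Fin n → ℝ => max (sumZeroExtension y i) 0 := fun i =>
    (continuous_sumZeroExtension i).max continuous_const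
  exact continuousOn_pi.2 fun i => (h i).continuousOn.div
    (continuous_finsetSum _ fun j _ => h j).continuousOn
    fun y hy => (sum_max_sumZeroExtension_pos hy).ne'

theorem nonempty_of_mem_stdSimplex {ι : Type*} [Fintype ι] {x : ι → ℝ} {A : Set ι}
    (hx : x ∈ stdSimplex ℝ ι) (hA : ∀ i ∉ A, x i = 0) : A.Nonempty := by
  by_contra hne
  rw [Set.not_nonempty_iff_eq_empty] at hne
  subst hne
  have := hx.2
  simp [hA] at this

/-- Topological Radon theorem: for any continuous map from the `(d+1)`-simplex to `ℝ^d`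
there are two disjoint faces whose images intersect. -/
theorem stmt_12 (d : ℕ) (hd : 0 < d)
    (f : (Fin (d + 2) → ℝ) → EuclideanSpace ℝ (Fin d))
    (hf : ContinuousOn f (stdSimplex ℝ (Fin (d + 2)))) :
    ∃ A B : Set (Fin (d + 2)), A.Nonempty ∧ B.Nonempty ∧ Disjoint A B ∧
      (f '' {x ∈ stdSimplex ℝ (Fin (d + 2)) | ∀ i ∉ A, x i = 0} ∩
        f '' {x ∈ stdSimplex ℝ (Fin (d + 2)) | ∀ i ∉ B, x i = 0}).Nonempty := by
  have hcont : ContinuousOn (fun y : Fin (d + 1) → ℝ => f (positivePoint y)) {0}ᶜ :=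
    hf.comp continuousOn_positivePoint fun y hy => positivePoint_mem_stdSimplex hy
  have hcont' : ContinuousOn (fun y : Fin (d + 1) → ℝ => f (positivePoint (-y))) {0}ᶜ :=
    hcont.comp continuous_neg.continuousOn fun y hy => by simpa using hy
  obtain ⟨y, hy, hgy⟩ := exists_ne_zero_eq_zero_of_odd
    (g := fun y => (f (positivePoint y) - f (positivePoint (-y))).ofLp)
    ((PiLp.continuous_ofLp 2 _).comp_continuousOn (hcont.sub hcont'))
    (fun y _ => by simp)
  have heq : f (positivePoint (-y)) = f (positivePoint y) := by
    have h : f (positivePoint y) - f (positivePoint (-y)) = 0 := by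
      ext i
      exact congrFun hgy i
    exact (sub_eq_zero.1 h).symm
  have hmem := positivePoint_mem_stdSimplex hy
  have hmem' := positivePoint_mem_stdSimplex (neg_ne_zero.2 hy)
  have hA : ∀ i ∉ {i | 0 < sumZeroExtension y i}, positivePoint y i = 0 := fun i hi => by
    have : sumZeroExtension y i ≤ 0 := not_lt.1 hi
    simp [positivePoint, this]
  have hB : ∀ i ∉ {i | sumZeroExtension y i < 0}, positivePoint (-y) i = 0 := fun i hi => by
    have : 0 ≤ sumZeroExtension y i := not_lt.1 hi
    simp [positivePoint, sumZeroExtension_neg, this]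
  refine ⟨{i | 0 < sumZeroExtension y i}, {i | sumZeroExtension y i < 0},
    nonempty_of_mem_stdSimplex hmem hA, nonempty_of_mem_stdSimplex hmem' hB,
    Set.disjoint_left.2 fun i (hi : 0 < sumZeroExtension y i) hi' => lt_asymm hi hi',
    f (positivePoint y),
    ⟨_, ⟨hmem, hA⟩, rfl⟩, ⟨_, ⟨hmem', hB⟩, heq⟩⟩
end
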